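/- The plane Cremona group is hopfian: every surjective group endomorphism of Bir(ℙ²_ℂ) = Aut_ℂ(ℂ(x,y)) is injective, hence is a group automorphism. -/

import Mathlib

set_option autoImplicit false

noncomputable section

/-- The field `ℂ(x,y)` of rational functions in two variables over `ℂ`. -/
abbrev K2 : Type := FractionRing (MvPolynomial (Fin 2) ℂ)

/-- The plane Cremona group `Bir(ℙ²_ℂ)`, identified with the group `Aut_ℂ(ℂ(x,y))`
of `ℂ`-algebra automorphisms of `ℂ(x,y)`. -/
abbrev Cremona2 : Type := K2 ≃ₐ[ℂ] K2

/-- The coordinate function `x`. -/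
def X0 : K2 := algebraMap (MvPolynomial (Fin 2) ℂ) K2 (MvPolynomial.X 0)

/-- The coordinate function `y`. -/
def X1 : K2 := algebraMap (MvPolynomial (Fin 2) ℂ) K2 (MvPolynomial.X 1)

theorem K2.ringHom_ext {S : Type*} [Field S] {f g : K2 →+* S}
    (hC : ∀ c : ℂ, f (algebraMap ℂ K2 c) = g (algebraMap ℂ K2 c))
    (h0 : f X0 = g X0) (h1 : f X1 = g X1) : f = g := by
  apply IsLocalization.ringHom_ext (nonZeroDivisors (MvPolynomial (Fin 2) ℂ))
  refine MvPolynomial.ringHom_ext ?_ ?_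
  · intro c
    have := hC c
    rwa [IsScalarTower.algebraMap_apply ℂ (MvPolynomial (Fin 2) ℂ) K2] at this
  · intro i
    fin_cases i
    · exact h0
    · exact h1

theorem K2.algHom_ext {S : Type*} [Field S] [Algebra ℂ S] {f g : K2 →ₐ[ℂ] S}
    (h0 : f X0 = g X0) (h1 : f X1 = g X1) : f = g := by
  have := K2.ringHom_ext (f := (f : K2 →+* S)) (g := (g : K2 →+* S)) (by simp) h0 h1
  exact AlgHom.ext fun x => DFunLike.congr_fun this x

theorem Cremona2.ext_gens {f g : Cremona2} (h0 : f X0 = g X0) (h1 : f X1 = g X1) : f = g := by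
  have := K2.algHom_ext (f := (f : K2 →ₐ[ℂ] K2)) (g := (g : K2 →ₐ[ℂ] K2)) h0 h1
  ext x
  exact DFunLike.congr_fun this x

theorem K2.algebraicIndependent_X : AlgebraicIndependent ℂ ![X0, X1] := by
  have h := (MvPolynomial.algebraicIndependent_X (Fin 2) ℂ).map'
    (f := IsScalarTower.toAlgHom ℂ (MvPolynomial (Fin 2) ℂ) K2)
    (IsFractionRing.injective (MvPolynomial (Fin 2) ℂ) K2)
  convert h using 1
  ext i
  fin_cases i <;> rfl

theorem K2.adjoin_X : IntermediateField.adjoin ℂ {X0, X1} = ⊤ := by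
  rw [eq_top_iff]
  intro z _
  obtain ⟨p, q, hq, rfl⟩ := IsFractionRing.div_surjective (A := MvPolynomial (Fin 2) ℂ) z
  have key : ∀ p : MvPolynomial (Fin 2) ℂ,
      algebraMap _ K2 p ∈ IntermediateField.adjoin ℂ {X0, X1} := by
    intro p
    induction p using MvPolynomial.induction_on with
    | C a =>
      have : algebraMap _ K2 (MvPolynomial.C a : MvPolynomial (Fin 2) ℂ) = algebraMap ℂ K2 a := by
        rw [IsScalarTower.algebraMap_apply ℂ (MvPolynomial (Fin 2) ℂ) K2]; rfl
      rw [this]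
      exact IntermediateField.algebraMap_mem _ a
    | add p q hp hq => rw [map_add]; exact add_mem hp hq
    | mul_X p i hp =>
      rw [map_mul]
      refine mul_mem hp ?_
      apply IntermediateField.subset_adjoin
      fin_cases i
      · left; rfl
      · right; rfl
  exact div_mem (key p) (key q)

theorem K2.isTranscendenceBasis_X : IsTranscendenceBasis ℂ ![X0, X1] := by
  have := IsLocalization.isAlgebraic (R := MvPolynomial (Fin 2) ℂ) (S := K2)
    (nonZeroDivisors (MvPolynomial (Fin 2) ℂ))
  have h := (IsTranscendenceBasis.mvPolynomial (Fin 2) ℂ).algebraMap_comp (A := K2)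
  convert h using 1
  ext i
  fin_cases i <;> rfl

theorem K2.isAlgebraic_adjoin_of_adjoin_eq_top {S : Set K2}
    (h : IntermediateField.adjoin ℂ S = ⊤) : Algebra.IsAlgebraic (Algebra.adjoin ℂ S) K2 := by
  refine ⟨fun z => ?_⟩
  have hz : z ∈ IntermediateField.adjoin ℂ S := h ▸ IntermediateField.mem_top
  obtain ⟨r, hr, s, hs, rfl⟩ := IntermediateField.mem_adjoin_iff_div.1 hz
  rw [div_eq_mul_inv]
  exact (isAlgebraic_algebraMap (A := K2) (⟨r, hr⟩ : Algebra.adjoin ℂ S)).mul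
    (isAlgebraic_algebraMap (A := K2) (⟨s, hs⟩ : Algebra.adjoin ℂ S)).inv

theorem K2.adjoin_eq_top {p q : K2}
    (h0 : X0 ∈ IntermediateField.adjoin ℂ {p, q}) (h1 : X1 ∈ IntermediateField.adjoin ℂ {p, q}) :
    IntermediateField.adjoin ℂ {p, q} = ⊤ := by
  rw [eq_top_iff, ← K2.adjoin_X, IntermediateField.adjoin_le_iff]
  rintro _ (rfl | rfl)
  · exact h0
  · exact h1

theorem K2.algebraicIndependent_of_mem_adjoin {p q : K2}
    (h0 : X0 ∈ IntermediateField.adjoin ℂ {p, q}) (h1 : X1 ∈ IntermediateField.adjoin ℂ {p, q}) :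
    AlgebraicIndependent ℂ ![p, q] := by
  have := K2.isAlgebraic_adjoin_of_adjoin_eq_top (K2.adjoin_eq_top h0 h1)
  obtain ⟨t, ht, hb⟩ := exists_isTranscendenceBasis_subset (R := ℂ) ({p, q} : Set K2)
  have hc := hb.cardinalMk_eq_trdeg
  have hX := K2.isTranscendenceBasis_X.cardinalMk_eq_trdeg
  rw [← hX, Cardinal.mk_fin] at hc
  have hn : t.ncard = 2 := by
    rw [Set.ncard_def, Set.encard, ENat.card, hc]; simp
  have htpq : t = {p, q} := by
    refine Set.eq_of_subset_of_ncard_le ht ?_ (by simp)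
    rw [hn]
    exact (Set.ncard_insert_le _ _).trans (by simp)
  have hne : p ≠ q := by
    rintro rfl
    rw [htpq] at hn
    simp at hn
  subst htpq
  have hinj : Function.Injective ![(⟨p, by simp⟩ : ({p, q} : Set K2)), ⟨q, by simp⟩] := by
    intro i j hij
    fin_cases i <;> fin_cases j <;> simp_all [Subtype.ext_iff]
  have := hb.1.comp _ hinj
  convert this using 1
  ext i
  fin_cases i <;> rfl

theorem Cremona2.exists_apply {p q : K2}
    (h0 : X0 ∈ IntermediateField.adjoin ℂ {p, q}) (h1 : X1 ∈ IntermediateField.adjoin ℂ {p, q}) :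
    ∃ f : Cremona2, f X0 = p ∧ f X1 = q := by
  have hi := K2.algebraicIndependent_of_mem_adjoin h0 h1
  let g : K2 →ₐ[ℂ] K2 := IsFractionRing.liftAlgHom (g := MvPolynomial.aeval ![p, q]) hi
  have g0 : g X0 = p := by
    refine (IsFractionRing.lift_algebraMap (K := K2) (g := (MvPolynomial.aeval ![p, q] :
      MvPolynomial (Fin 2) ℂ →ₐ[ℂ] K2).toRingHom) hi _).trans ?_
    simp
  have g1 : g X1 = q := by
    refine (IsFractionRing.lift_algebraMap (K := K2) (g := (MvPolynomial.aeval ![p, q] :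
      MvPolynomial (Fin 2) ℂ →ₐ[ℂ] K2).toRingHom) hi _).trans ?_
    simp
  have hs : Function.Surjective g := by
    rw [← AlgHom.fieldRange_eq_top, eq_top_iff, ← K2.adjoin_X, IntermediateField.adjoin_le_iff]
    have : IntermediateField.adjoin ℂ {p, q} ≤ g.fieldRange := by
      rw [IntermediateField.adjoin_le_iff]
      rintro _ (rfl | rfl)
      · exact ⟨_, g0⟩
      · exact ⟨_, g1⟩
    rintro _ (rfl | rfl)
    · exact this h0
    · exact this h1
  exact ⟨AlgEquiv.ofBijective g ⟨g.toRingHom.injective, hs⟩, g0, g1⟩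

namespace Cremona2

/-- The automorphism sending `(x, y)` to `(p, q)`, or the identity if there is none. -/
def ofImages (p q : K2) : Cremona2 :=
  open Classical in if h : ∃ f : Cremona2, f X0 = p ∧ f X1 = q then h.choose else 1

theorem ofImages_apply {p q : K2}
    (h0 : X0 ∈ IntermediateField.adjoin ℂ {p, q}) (h1 : X1 ∈ IntermediateField.adjoin ℂ {p, q}) :
    ofImages p q X0 = p ∧ ofImages p q X1 = q := by
  have h := exists_apply h0 h1
  rw [ofImages, dif_pos h]
  exact h.choose_spec

end Cremona2

theorem K2.left_mem_adjoin (p q : K2) : p ∈ IntermediateField.adjoin ℂ {p, q} :=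
  IntermediateField.subset_adjoin _ _ (by simp)

theorem K2.right_mem_adjoin (p q : K2) : q ∈ IntermediateField.adjoin ℂ {p, q} :=
  IntermediateField.subset_adjoin _ _ (by simp)

theorem X0_ne_zero : X0 ≠ 0 := by
  have := K2.algebraicIndependent_X.ne_zero 0
  simpa using this

theorem X1_ne_zero : X1 ≠ 0 := by
  have := K2.algebraicIndependent_X.ne_zero 1
  simpa using this

/-- A complex number seen as a constant rational function. -/
abbrev cst (a : ℂ) : K2 := algebraMap ℂ K2 a

namespace Cremona2

/-- The translation `x ↦ x + a`. -/
def tx (a : ℂ) : Cremona2 := ofImages (X0 + cst a) X1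
/-- The dilation `x ↦ l x`. -/
def dx (l : ℂˣ) : Cremona2 := ofImages (cst l * X0) X1
/-- The inversion `x ↦ 1 / x`. -/
def ix : Cremona2 := ofImages X0⁻¹ X1
/-- The swap of the two coordinates. -/
def w : Cremona2 := ofImages X1 X0
/-- The map `y ↦ x y`. -/
def m : Cremona2 := ofImages X0 (X0 * X1)

theorem tx_apply (a : ℂ) : tx a X0 = X0 + cst a ∧ tx a X1 = X1 := by
  refine ofImages_apply ?_ (K2.right_mem_adjoin _ _)
  have := sub_mem (K2.left_mem_adjoin (X0 + cst a) X1)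
    (IntermediateField.algebraMap_mem (IntermediateField.adjoin ℂ {X0 + cst a, X1}) a)
  simpa using this

theorem dx_apply (l : ℂˣ) : dx l X0 = cst l * X0 ∧ dx l X1 = X1 := by
  refine ofImages_apply ?_ (K2.right_mem_adjoin _ _)
  have := mul_mem (IntermediateField.algebraMap_mem
    (IntermediateField.adjoin ℂ {cst l * X0, X1}) (l⁻¹ : ℂ)) (K2.left_mem_adjoin (cst l * X0) X1)
  rwa [← mul_assoc, ← map_mul, inv_mul_cancel₀ l.ne_zero, map_one, one_mul] at this

theorem ix_apply : ix X0 = X0⁻¹ ∧ ix X1 = X1 := by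
  refine ofImages_apply ?_ (K2.right_mem_adjoin _ _)
  have := inv_mem (K2.left_mem_adjoin X0⁻¹ X1)
  rwa [inv_inv] at this

theorem w_apply : w X0 = X1 ∧ w X1 = X0 :=
  ofImages_apply (K2.right_mem_adjoin _ _) (K2.left_mem_adjoin _ _)

theorem m_apply : m X0 = X0 ∧ m X1 = X0 * X1 := by
  refine ofImages_apply (K2.left_mem_adjoin _ _) ?_
  have := div_mem (K2.right_mem_adjoin X0 (X0 * X1)) (K2.left_mem_adjoin X0 (X0 * X1))
  rwa [mul_div_cancel_left₀ _ X0_ne_zero] at this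

@[simp] theorem tx_X0 (a : ℂ) : tx a X0 = X0 + cst a := (tx_apply a).1
@[simp] theorem tx_X1 (a : ℂ) : tx a X1 = X1 := (tx_apply a).2
@[simp] theorem dx_X0 (l : ℂˣ) : dx l X0 = cst l * X0 := (dx_apply l).1
@[simp] theorem dx_X1 (l : ℂˣ) : dx l X1 = X1 := (dx_apply l).2
@[simp] theorem ix_X0 : ix X0 = X0⁻¹ := ix_apply.1
@[simp] theorem ix_X1 : ix X1 = X1 := ix_apply.2
@[simp] theorem w_X0 : w X0 = X1 := w_apply.1
@[simp] theorem w_X1 : w X1 = X0 := w_apply.2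
@[simp] theorem m_X0 : m X0 = X0 := m_apply.1
@[simp] theorem m_X1 : m X1 = X0 * X1 := m_apply.2

@[simp] theorem w_w : w * w = 1 := ext_gens (by simp) (by simp)
@[simp] theorem ix_ix : ix * ix = 1 := ext_gens (by simp) (by simp)
theorem w_inv : w⁻¹ = w := inv_eq_of_mul_eq_one_left w_w
theorem ix_inv : ix⁻¹ = ix := inv_eq_of_mul_eq_one_left ix_ix

/-- The translation `y ↦ y + a`. -/
def ty (a : ℂ) : Cremona2 := w * tx a * w
/-- The dilation `y ↦ l y`. -/
def dy (l : ℂˣ) : Cremona2 := w * dx l * w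
/-- The inversion `y ↦ 1 / y`. -/
def iy : Cremona2 := w * ix * w

@[simp] theorem ty_X0 (a : ℂ) : ty a X0 = X0 := by simp [ty]
@[simp] theorem ty_X1 (a : ℂ) : ty a X1 = X1 + cst a := by simp [ty]
@[simp] theorem dy_X0 (l : ℂˣ) : dy l X0 = X0 := by simp [dy]
@[simp] theorem dy_X1 (l : ℂˣ) : dy l X1 = cst l * X1 := by simp [dy]
@[simp] theorem iy_X0 : iy X0 = X0 := by simp [iy]
@[simp] theorem iy_X1 : iy X1 = X1⁻¹ := by simp [iy]

/-- The subgroup generated by the standard elementary maps. -/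
def H : Subgroup Cremona2 :=
  Subgroup.closure (Set.range tx ∪ Set.range dx ∪ {ix, w, m})

theorem tx_mem (a : ℂ) : tx a ∈ H := Subgroup.subset_closure (by simp)
theorem dx_mem (l : ℂˣ) : dx l ∈ H := Subgroup.subset_closure (by simp)
theorem ix_mem : ix ∈ H := Subgroup.subset_closure (by simp)
theorem w_mem : w ∈ H := Subgroup.subset_closure (by simp)
theorem m_mem : m ∈ H := Subgroup.subset_closure (by simp)
theorem ty_mem (a : ℂ) : ty a ∈ H := mul_mem (mul_mem w_mem (tx_mem a)) w_mem
theorem dy_mem (l : ℂˣ) : dy l ∈ H := mul_mem (mul_mem w_mem (dx_mem l)) w_mem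
theorem iy_mem : iy ∈ H := mul_mem (mul_mem w_mem ix_mem) w_mem

end Cremona2

section

open scoped WithZero
open Polynomial

section Evaluation

variable {K : Type*} [Field K] [Algebra ℂ K]

/-- Evaluation at `(a, b)` of the polynomial with coefficients `A`. -/
def ev (a b : K) : ((ℕ × ℕ) →₀ ℂ) →ₗ[ℂ] K :=
  Finsupp.linearCombination ℂ fun ij => a ^ ij.1 * b ^ ij.2

theorem ev_apply (a b : K) (A : (ℕ × ℕ) →₀ ℂ) :
    ev a b A = A.sum fun ij c => algebraMap ℂ K c * (a ^ ij.1 * b ^ ij.2) := by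
  simp [ev, Finsupp.linearCombination_apply, Algebra.smul_def]

theorem map_ev {K' : Type*} [Field K'] [Algebra ℂ K'] (f : K →ₐ[ℂ] K') (a b : K)
    (A : (ℕ × ℕ) →₀ ℂ) : f (ev a b A) = ev (f a) (f b) A := by
  simp [ev_apply, Finsupp.sum]

theorem ev_mapDomain {g : ℕ × ℕ → ℕ × ℕ} {a b a' b' M : K} {A : (ℕ × ℕ) →₀ ℂ}
    (h : ∀ ij ∈ A.support, a ^ ij.1 * b ^ ij.2 = M * (a' ^ (g ij).1 * b' ^ (g ij).2)) :
    ev a b A = M * ev a' b' (A.mapDomain g) := by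
  rw [ev, ev, Finsupp.linearCombination_mapDomain, Finsupp.linearCombination_apply,
    Finsupp.linearCombination_apply, Finsupp.sum, Finsupp.sum, Finset.mul_sum]
  refine Finset.sum_congr rfl fun ij hij => ?_
  rw [h ij hij, Function.comp_apply, mul_smul_comm]

theorem mapDomain_ne_zero {g : ℕ × ℕ → ℕ × ℕ} {A : (ℕ × ℕ) →₀ ℂ} {ij : ℕ × ℕ}
    (hg : Set.InjOn g A.support) (h : A ij ≠ 0) : A.mapDomain g (g ij) ≠ 0 := by
  rwa [Finsupp.mapDomain_apply' (A.support : Set (ℕ × ℕ)) A subset_rfl hg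
    (Finsupp.mem_support_iff.2 h)]

theorem exists_of_mapDomain_ne_zero {g : ℕ × ℕ → ℕ × ℕ} {A : (ℕ × ℕ) →₀ ℂ} {ij : ℕ × ℕ}
    (h : A.mapDomain g ij ≠ 0) : ∃ kl, A kl ≠ 0 ∧ g kl = ij := by
  classical
  have := Finsupp.mapDomain_support (Finsupp.mem_support_iff.2 h)
  obtain ⟨kl, hkl, rfl⟩ := Finset.mem_image.1 this
  exact ⟨kl, Finsupp.mem_support_iff.1 hkl, rfl⟩

/-- The substitution `Y ↦ Y + γ`. -/
def shiftY (γ : ℂ) : ((ℕ × ℕ) →₀ ℂ) →ₗ[ℂ] ((ℕ × ℕ) →₀ ℂ) :=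
  Finsupp.linearCombination ℂ fun ij =>
    ∑ s ∈ Finset.range (ij.2 + 1), Finsupp.single (ij.1, s) (γ ^ (ij.2 - s) * (ij.2.choose s : ℂ))

theorem ev_shiftY (γ : ℂ) (a b : K) (A : (ℕ × ℕ) →₀ ℂ) :
    ev a b (shiftY γ A) = ev a (b + algebraMap ℂ K γ) A := by
  induction A using Finsupp.induction_linear with
  | zero => simp
  | add A B hA hB => rw [map_add, map_add, map_add, hA, hB]
  | single ij c =>
    obtain ⟨i, j⟩ := ij
    simp only [shiftY, Finsupp.linearCombination_single, map_smul, map_sum, ev, add_pow,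
      Finset.mul_sum]
    congr 1
    refine Finset.sum_congr rfl fun s _ => ?_
    simp only [Algebra.smul_def, map_mul, map_pow, map_natCast]
    ring

theorem shiftY_apply (γ : ℂ) (A : (ℕ × ℕ) →₀ ℂ) (i s : ℕ) :
    shiftY γ A (i, s) = A.sum fun ij c =>
      if ij.1 = i ∧ s ≤ ij.2 then c * (γ ^ (ij.2 - s) * (ij.2.choose s : ℂ)) else 0 := by
  rw [shiftY, Finsupp.linearCombination_apply, Finsupp.sum_apply]
  refine Finsupp.sum_congr fun ij _ => ?_
  obtain ⟨i', j'⟩ := ij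
  simp only [Finsupp.smul_apply, Finsupp.finsetSum_apply, Finsupp.single_apply, Prod.mk.injEq,
    smul_eq_mul]
  split_ifs with h
  · obtain ⟨rfl, hs⟩ := h
    rw [Finset.sum_eq_single s]
    · simp
    · intro b _ hb; simp [hb]
    · intro hs'; simp at hs'; omega
  · rw [Finset.sum_eq_zero, mul_zero]
    intro b hb
    rw [if_neg]
    rintro ⟨rfl, rfl⟩
    exact h ⟨rfl, by simpa [Nat.lt_succ_iff] using hb⟩

theorem exists_of_shiftY_ne_zero {γ : ℂ} {A : (ℕ × ℕ) →₀ ℂ} {i s : ℕ}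
    (h : shiftY γ A (i, s) ≠ 0) : ∃ j, s ≤ j ∧ A (i, j) ≠ 0 := by
  rw [shiftY_apply] at h
  obtain ⟨⟨i', j⟩, hm, h⟩ := Finset.exists_ne_zero_of_sum_ne_zero h
  simp only [ne_eq, ite_eq_right_iff, Classical.not_imp] at h
  obtain ⟨⟨rfl, hs⟩, -⟩ := h
  exact ⟨j, hs, Finsupp.mem_support_iff.1 hm⟩

theorem shiftY_apply_top {γ : ℂ} {A : (ℕ × ℕ) →₀ ℂ} {i j : ℕ}
    (h : ∀ j', j < j' → A (i, j') = 0) : shiftY γ A (i, j) = A (i, j) := by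
  rw [shiftY_apply, Finsupp.sum, Finset.sum_eq_single (i, j)]
  · simp
  · rintro ⟨i', j'⟩ hm hne
    rw [if_neg]
    rintro ⟨rfl, hs⟩
    rcases hs.lt_or_eq with hs | rfl
    · exact Finsupp.mem_support_iff.1 hm (h j' hs)
    · exact hne rfl
  · intro hm
    simp [Finsupp.notMem_support_iff.1 hm]

/-- A polynomial with a nonzero coefficient in the bottom row keeps one after `Y ↦ Y + γ`. -/
theorem exists_shiftY_ne_zero {γ : ℂ} {A : (ℕ × ℕ) →₀ ℂ} {i μ : ℕ}
    (h : ∃ j, A (i, j) ≠ 0) (hμ : ∀ j, A (i, j) ≠ 0 → j ≤ μ) :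
    ∃ j ≤ μ, shiftY γ A (i, j) ≠ 0 := by
  classical
  obtain ⟨j0, hj0⟩ := h
  have hne : ∃ j, j ≤ μ ∧ A (i, j) ≠ 0 := ⟨j0, hμ _ hj0, hj0⟩
  refine ⟨Nat.findGreatest (fun j => A (i, j) ≠ 0) μ, Nat.findGreatest_le _, ?_⟩
  rw [shiftY_apply_top]
  · exact Nat.findGreatest_spec (P := fun j => A (i, j) ≠ 0) (hμ _ hj0) hj0
  · intro j' hj'
    by_contra hne
    exact absurd hj' (not_lt.2 (Nat.le_findGreatest (hμ _ hne) hne))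

/-- Exchange of the two variables. -/
def swapVars (A : (ℕ × ℕ) →₀ ℂ) : (ℕ × ℕ) →₀ ℂ := A.mapDomain Prod.swap

theorem ev_swapVars (a b : K) (A : (ℕ × ℕ) →₀ ℂ) : ev b a (swapVars A) = ev a b A := by
  refine ((ev_mapDomain (a := a) (b := b) (g := Prod.swap) (M := 1) fun ij _ => ?_).trans
    (one_mul _)).symm
  simp [mul_comm]

theorem swapVars_apply (A : (ℕ × ℕ) →₀ ℂ) (i j : ℕ) : swapVars A (i, j) = A (j, i) :=
  Finsupp.mapDomain_apply Prod.swap_injective A (j, i)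

end Evaluation

section Jacobian

variable {K : Type*} [Field K] [Algebra ℂ K]

/-- The Jacobian determinant with respect to two derivations. -/
def jac (D₁ D₂ : Derivation ℂ K K) (a b : K) : K := D₁ a * D₂ b - D₂ a * D₁ b

variable (D₁ D₂ : Derivation ℂ K K)

theorem jac_swap (a b : K) : jac D₁ D₂ b a = -jac D₁ D₂ a b := by
  simp only [jac]; ring

theorem jac_add_const (a b : K) (c : ℂ) :
    jac D₁ D₂ a (b + algebraMap ℂ K c) = jac D₁ D₂ a b := by
  simp [jac]

theorem jac_mul_self (a b : K) : jac D₁ D₂ a (a * b) = a * jac D₁ D₂ a b := by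
  simp only [jac, Derivation.leibniz, smul_eq_mul]; ring

end Jacobian

section Valuation

variable {K : Type*} [Field K] [Algebra ℂ K] (v : Valuation K ℤᵐ⁰)

theorem valuation_const_le (hv : ∀ z : ℂ, z ≠ 0 → v (algebraMap ℂ K z) = 1) (z : ℂ) :
    v (algebraMap ℂ K z) ≤ 1 := by
  rcases eq_or_ne z 0 with rfl | h
  · simp
  · exact (hv z h).le

theorem residue_dichotomy (hv : ∀ z : ℂ, z ≠ 0 → v (algebraMap ℂ K z) = 1) {c : K} (hc : v c ≤ 1) :
    (∃ γ : ℂ, v (c - algebraMap ℂ K γ) < 1) ∨ ∀ p : ℂ[X], p ≠ 0 → v (aeval c p) = 1 := by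
  refine or_iff_not_imp_left.2 fun h p hp => ?_
  have h1 : ∀ γ : ℂ, v (c - algebraMap ℂ K γ) = 1 := fun γ =>
    le_antisymm ((v.map_sub _ _).trans (max_le hc (valuation_const_le v hv γ)))
      (not_lt.1 fun hlt => h ⟨γ, hlt⟩)
  have h2 : ∀ s : Multiset ℂ, v (aeval c (s.map fun a => X - C a).prod) = 1 := by
    intro s
    induction s using Multiset.induction_on with
    | empty => simp
    | cons a s ih => simp [ih, h1]
  rw [(IsAlgClosed.splits p).eq_prod_roots, map_mul, map_mul, h2]
  simp [hv _ (leadingCoeff_ne_zero.2 hp)]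

theorem valuation_ev_le_one (hv : ∀ z : ℂ, z ≠ 0 → v (algebraMap ℂ K z) = 1) {a b : K}
    (ha : v a ≤ 1) (hb : v b ≤ 1) (A : (ℕ × ℕ) →₀ ℂ) : v (ev a b A) ≤ 1 := by
  rw [ev_apply]
  refine v.map_sum_le fun ij _ => ?_
  rw [map_mul, map_mul, map_pow, map_pow]
  exact mul_le_one' (valuation_const_le v hv _) (mul_le_one' (pow_le_one' ha _) (pow_le_one' hb _))

/-- If the bottom row of `A` is nonzero then `A(a, c)` is a unit when `a` reduces to zero and `c`
to something transcendental. -/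
theorem valuation_ev_eq_one (hv : ∀ z : ℂ, z ≠ 0 → v (algebraMap ℂ K z) = 1) {a c : K}
    (ha : v a < 1) (hc : v c ≤ 1) (hp : ∀ p : ℂ[X], p ≠ 0 → v (aeval c p) = 1)
    {A : (ℕ × ℕ) →₀ ℂ} (hA : ∃ j, A (0, j) ≠ 0) : v (ev a c A) = 1 := by
  classical
  rw [← Finsupp.filter_add_filter_not A (fun ij => ij.1 = 0), map_add]
  have h2 : v (ev a c (A.filter fun ij => ¬ ij.1 = 0)) < 1 := by
    rw [ev_apply]
    refine v.map_sum_lt one_ne_zero fun ij hij => ?_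
    rw [Finsupp.support_filter, Finset.mem_filter] at hij
    rw [map_mul, map_mul, map_pow, map_pow]
    refine mul_lt_one_of_nonneg_of_lt_one_right (valuation_const_le v hv _) zero_le ?_
    exact mul_lt_one_of_nonneg_of_lt_one_left zero_le (pow_lt_one₀ zero_le ha hij.2)
      (pow_le_one' hc _)
  have h1 : v (ev a c (A.filter fun ij => ij.1 = 0)) = 1 := by
    let p : ℂ[X] := (A.filter fun ij => ij.1 = 0).sum fun ij z => monomial ij.2 z
    have hev : ev a c (A.filter fun ij => ij.1 = 0) = aeval c p := by
      rw [ev_apply, Finsupp.sum, map_finsuppSum, Finsupp.sum]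
      refine Finset.sum_congr rfl fun ij hij => ?_
      rw [Finsupp.support_filter, Finset.mem_filter] at hij
      rw [hij.2, aeval_monomial, pow_zero, one_mul]
    rw [hev]
    refine hp p ?_
    obtain ⟨j, hj⟩ := hA
    intro h0
    apply hj
    have : p.coeff j = A (0, j) := by
      simp only [p, Finsupp.sum, finsetSum_coeff, coeff_monomial]
      rw [Finset.sum_eq_single (0, j)]
      · simp
      · rintro ⟨i', j'⟩ hm hne
        rw [Finsupp.support_filter, Finset.mem_filter] at hm
        obtain ⟨-, rfl⟩ := hm
        rw [if_neg]
        rintro rfl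
        exact hne rfl
      · intro hm
        rw [if_pos rfl]
        simpa using hm
    rw [← this, h0, coeff_zero]
  rw [Valuation.map_add_eq_of_lt_left] <;> rw [h1]
  exact h2

variable (D₁ D₂ : Derivation ℂ K K)

theorem valuation_jac_le_one (h₁ : ∀ a, v a ≤ 1 → v (D₁ a) ≤ 1) (h₂ : ∀ a, v a ≤ 1 → v (D₂ a) ≤ 1)
    {a b : K} (ha : v a ≤ 1) (hb : v b ≤ 1) : v (jac D₁ D₂ a b) ≤ 1 := by
  refine (v.map_sub _ _).trans (max_le ?_ ?_) <;> rw [map_mul] <;> apply mul_le_one' <;> simp [*]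

theorem local_adjunction (hv : ∀ z : ℂ, z ≠ 0 → v (algebraMap ℂ K z) = 1)
    (h₁ : ∀ a, v a ≤ 1 → v (D₁ a) ≤ 1) (h₂ : ∀ a, v a ≤ 1 → v (D₂ a) ≤ 1) {x : K} (hx : v x = 1)
    {a b : K} {A B : (ℕ × ℕ) →₀ ℂ} {m : ℕ} (ha : v a < 1) (hb : v b < 1)
    (hJ : jac D₁ D₂ a b ≠ 0) (hAB : ev a b A = x * ev a b B)
    (hm : ∃ ij, (A ij ≠ 0 ∨ B ij ≠ 0) ∧ ij.1 + ij.2 ≤ m) :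
    v (jac D₁ D₂ a b) ^ m ≤ v (ev a b B) := by
  obtain ⟨N, hN⟩ : ∃ N : ℕ, -(N : ℤ) ≤ WithZero.log (v (jac D₁ D₂ a b)) :=
    ⟨(-WithZero.log (v (jac D₁ D₂ a b))).toNat, by omega⟩
  induction N using Nat.strong_induction_on generalizing a b A B m with
  | _ N ih => ?_
  wlog hab : v b ≤ v a generalizing a b A B
  · have h1 : v (jac D₁ D₂ b a) = v (jac D₁ D₂ a b) := by rw [jac_swap, Valuation.map_neg]
    have := this (a := b) (b := a) (A := swapVars A) (B := swapVars B) hb ha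
      (by rw [jac_swap]; simpa using hJ) (by rw [ev_swapVars, ev_swapVars, hAB])
      (by
        obtain ⟨⟨i, j⟩, h, hij⟩ := hm
        exact ⟨(j, i), by simpa [swapVars_apply] using h, by simpa [add_comm] using hij⟩)
      (by rw [h1]; exact hN) (not_le.1 hab).le
    rwa [h1, ev_swapVars] at this
  classical
  have ha0 : a ≠ 0 := by rintro rfl; simp [jac] at hJ
  have hva0 : v a ≠ 0 := (Valuation.ne_zero_iff v).2 ha0
  have hex : ∃ μ, ∃ ij : ℕ × ℕ, (A ij ≠ 0 ∨ B ij ≠ 0) ∧ ij.1 + ij.2 = μ := by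
    obtain ⟨ij, h, -⟩ := hm
    exact ⟨_, ij, h, rfl⟩
  obtain ⟨μ, ⟨⟨i₀, j₀⟩, hij₀, hμ⟩, hmin⟩ : ∃ μ, (∃ ij : ℕ × ℕ, (A ij ≠ 0 ∨ B ij ≠ 0) ∧
      ij.1 + ij.2 = μ) ∧ ∀ ij : ℕ × ℕ, (A ij ≠ 0 ∨ B ij ≠ 0) → μ ≤ ij.1 + ij.2 :=
    ⟨_, Nat.find_spec hex, fun ij h => Nat.find_min' hex ⟨ij, h, rfl⟩⟩
  replace hμ : i₀ + j₀ = μ := hμ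
  have hμm : μ ≤ m := by
    obtain ⟨ij, h, hij⟩ := hm
    exact (hmin ij h).trans hij
  have hva1 : v a ^ m ≤ v a ^ μ := pow_le_pow_right_of_le_one' ha.le hμm
  let g : ℕ × ℕ → ℕ × ℕ := fun ij => (ij.1 + ij.2 - μ, ij.2)
  set c := b / a with hc
  have hbac : b = a * c := by rw [hc]; field_simp
  have hvc : v c ≤ 1 := by
    rw [hc, map_div₀]
    exact div_le_one_of_le₀ hab zero_le
  have hev : ∀ C : (ℕ × ℕ) →₀ ℂ, (∀ ij, C ij ≠ 0 → μ ≤ ij.1 + ij.2) →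
      ev a b C = a ^ μ * ev a c (C.mapDomain g) := by
    intro C hC
    refine ev_mapDomain fun ij hij => ?_
    obtain ⟨k, hk⟩ := Nat.exists_eq_add_of_le (hC ij (Finsupp.mem_support_iff.1 hij))
    simp only [g, hk, Nat.add_sub_cancel_left]
    rw [hbac, mul_pow, ← mul_assoc, ← pow_add, ← mul_assoc, ← pow_add, hk]
  have hinj : ∀ C : (ℕ × ℕ) →₀ ℂ, (∀ ij, C ij ≠ 0 → μ ≤ ij.1 + ij.2) →
      Set.InjOn g C.support := by
    rintro C hC ⟨i, j⟩ hij ⟨i', j'⟩ hij' h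
    have e1 := hC _ (Finsupp.mem_support_iff.1 hij)
    have e2 := hC _ (Finsupp.mem_support_iff.1 hij')
    simp only [g, Prod.mk.injEq] at h e1 e2 ⊢
    omega
  have hrow : ∀ C : (ℕ × ℕ) →₀ ℂ, (∀ ij, C ij ≠ 0 → μ ≤ ij.1 + ij.2) →
      ∀ j, C.mapDomain g (0, j) ≠ 0 → j ≤ μ := by
    intro C hC j hj
    obtain ⟨⟨k, l⟩, h, hkl⟩ := exists_of_mapDomain_ne_zero hj
    have := hC _ h
    simp only [g, Prod.mk.injEq] at hkl this
    omega
  have hnz : ∀ C : (ℕ × ℕ) →₀ ℂ, (∀ ij, C ij ≠ 0 → μ ≤ ij.1 + ij.2) → C (i₀, j₀) ≠ 0 →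
      ∃ j, C.mapDomain g (0, j) ≠ 0 := by
    intro C hC h
    refine ⟨j₀, ?_⟩
    have := mapDomain_ne_zero (hinj C hC) h
    have hg : g (i₀, j₀) = (0, j₀) := by
      change (i₀ + j₀ - μ, j₀) = (0, j₀)
      rw [hμ, Nat.sub_self]
    rwa [hg] at this
  have hA := fun ij h => hmin ij (Or.inl h)
  have hB := fun ij h => hmin ij (Or.inr h)
  have hAB' : ev a c (A.mapDomain g) = x * ev a c (B.mapDomain g) := by
    have := hAB
    rw [hev A hA, hev B hB, mul_left_comm] at this
    exact mul_left_cancel₀ (pow_ne_zero _ ha0) this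
  have hJac : jac D₁ D₂ a b = a * jac D₁ D₂ a c := by rw [hbac, jac_mul_self]
  have hJc : jac D₁ D₂ a c ≠ 0 := fun h => hJ (by rw [hJac, h, mul_zero])
  have hJc1 := valuation_jac_le_one v D₁ D₂ h₁ h₂ ha.le hvc
  rw [hev B hB, hJac, map_mul, map_mul, map_pow, mul_pow]
  refine mul_le_mul' hva1 ?_
  rcases residue_dichotomy v hv hvc with ⟨γ, hγ⟩ | hp
  · set b₁ := c - algebraMap ℂ K γ with hb₁
    have hcb : c = b₁ + algebraMap ℂ K γ := by rw [hb₁]; ring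
    have hJb : jac D₁ D₂ a c = jac D₁ D₂ a b₁ := by rw [hcb, jac_add_const]
    rw [hJb] at hJc hJac ⊢
    rw [hcb, ← ev_shiftY, ← ev_shiftY] at hAB'
    rw [hcb, ← ev_shiftY]
    rw [hJb] at hJc1
    have hvJ0 := (Valuation.ne_zero_iff v).2 hJc
    have hlog : WithZero.log (v (jac D₁ D₂ a b)) =
        WithZero.log (v a) + WithZero.log (v (jac D₁ D₂ a b₁)) := by
      rw [hJac, map_mul, WithZero.log_mul hva0 hvJ0]
    have hla : WithZero.log (v a) < 0 := by
      rw [← WithZero.log_one, WithZero.log_lt_log hva0 one_ne_zero]; exact ha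
    have hlJ : WithZero.log (v (jac D₁ D₂ a b₁)) ≤ 0 := by
      rw [← WithZero.log_one, WithZero.log_le_log hvJ0 one_ne_zero]; exact hJc1
    refine ih (N - 1) (by omega) ha hγ hJc hAB' ?_ (by omega)
    rcases hij₀ with h | h
    · obtain ⟨j, hj, hj'⟩ := exists_shiftY_ne_zero (γ := γ) (hnz A hA h) (hrow A hA)
      exact ⟨(0, j), Or.inl hj', by simpa using hj.trans hμm⟩
    · obtain ⟨j, hj, hj'⟩ := exists_shiftY_ne_zero (γ := γ) (hnz B hB h) (hrow B hB)
      exact ⟨(0, j), Or.inr hj', by simpa using hj.trans hμm⟩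
  · have hvB : v (ev a c (B.mapDomain g)) = 1 := by
      rcases hij₀ with h | h
      · have := valuation_ev_eq_one v hv ha hvc hp (hnz A hA h)
        rwa [hAB', map_mul, hx, one_mul] at this
      · exact valuation_ev_eq_one v hv ha hvc hp (hnz B hB h)
    rw [hvB]
    exact pow_le_one' hJc1 _

end Valuation

end

section

open scoped WithZero
open Polynomial

/-- The substitution `X ↦ X + γ`. -/
def shiftX (γ : ℂ) (A : (ℕ × ℕ) →₀ ℂ) : (ℕ × ℕ) →₀ ℂ := swapVars (shiftY γ (swapVars A))

theorem ev_shiftX {K : Type*} [Field K] [Algebra ℂ K] (γ : ℂ) (a b : K) (A : (ℕ × ℕ) →₀ ℂ) :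
    ev a b (shiftX γ A) = ev (a + algebraMap ℂ K γ) b A := by
  rw [shiftX, ev_swapVars, ev_shiftY, ev_swapVars]

theorem exists_of_shiftX_ne_zero {γ : ℂ} {A : (ℕ × ℕ) →₀ ℂ} {s j : ℕ}
    (h : shiftX γ A (s, j) ≠ 0) : ∃ i, s ≤ i ∧ A (i, j) ≠ 0 := by
  rw [shiftX, swapVars_apply] at h
  obtain ⟨i, hi, h⟩ := exists_of_shiftY_ne_zero h
  exact ⟨i, hi, by rwa [swapVars_apply] at h⟩

section Pencil

variable {K : Type*} [Field K] [Algebra ℂ K]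

/-- `A(a, b) = x B(a, b)` with `A` and `B` supported in the trapezoid `j ≤ n`, `i + k j ≤ e`. -/
structure Pencil (x : K) (n k e : ℕ) (a b : K) (A B : (ℕ × ℕ) →₀ ℂ) : Prop where
  supp : ∀ i j, A (i, j) ≠ 0 ∨ B (i, j) ≠ 0 → j ≤ n ∧ i + k * j ≤ e
  rel : ev a b A = x * ev a b B
  ne_zero : ev a b B ≠ 0

variable {x : K} {n k e : ℕ} {a b : K} {A B : (ℕ × ℕ) →₀ ℂ}

theorem Pencil.shiftY (h : Pencil x n k e a b A B) (γ : ℂ) :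
    Pencil x n k e a (b - algebraMap ℂ K γ) (shiftY γ A) (shiftY γ B) where
  supp i j hij := by
    have : ∃ j', j ≤ j' ∧ (A (i, j') ≠ 0 ∨ B (i, j') ≠ 0) := by
      rcases hij with h | h
      · obtain ⟨j', h1, h2⟩ := exists_of_shiftY_ne_zero h
        exact ⟨j', h1, Or.inl h2⟩
      · obtain ⟨j', h1, h2⟩ := exists_of_shiftY_ne_zero h
        exact ⟨j', h1, Or.inr h2⟩
    obtain ⟨j', h1, h2⟩ := this
    have h3 := h.supp i j' h2
    have := Nat.mul_le_mul_left k h1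
    omega
  rel := by simp only [ev_shiftY, sub_add_cancel, h.rel]
  ne_zero := by simpa only [ev_shiftY, sub_add_cancel] using h.ne_zero

theorem Pencil.shiftX (h : Pencil x n k e a b A B) (γ : ℂ) :
    Pencil x n k e (a - algebraMap ℂ K γ) b (shiftX γ A) (shiftX γ B) where
  supp i j hij := by
    have : ∃ i', i ≤ i' ∧ (A (i', j) ≠ 0 ∨ B (i', j) ≠ 0) := by
      rcases hij with h | h
      · obtain ⟨j', h1, h2⟩ := exists_of_shiftX_ne_zero h
        exact ⟨j', h1, Or.inl h2⟩
      · obtain ⟨j', h1, h2⟩ := exists_of_shiftX_ne_zero h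
        exact ⟨j', h1, Or.inr h2⟩
    obtain ⟨i', h1, h2⟩ := this
    have h3 := h.supp i' j h2
    omega
  rel := by simp only [ev_shiftX, sub_add_cancel, h.rel]
  ne_zero := by simpa only [ev_shiftX, sub_add_cancel] using h.ne_zero

/-- Monomial substitutions act on pencils. -/
theorem Pencil.mapDomain (h : Pencil x n k e a b A B) {n' k' e' : ℕ} {a' b' M : K}
    (g : ℕ × ℕ → ℕ × ℕ)
    (hg : ∀ i j, A (i, j) ≠ 0 ∨ B (i, j) ≠ 0 → j ≤ n → i + k * j ≤ e →
      (g (i, j)).2 ≤ n' ∧ (g (i, j)).1 + k' * (g (i, j)).2 ≤ e' ∧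
      a ^ i * b ^ j = M * (a' ^ (g (i, j)).1 * b' ^ (g (i, j)).2)) :
    Pencil x n' k' e' a' b' (A.mapDomain g) (B.mapDomain g) ∧
      ev a b B = M * ev a' b' (B.mapDomain g) := by
  have hA : ev a b A = M * ev a' b' (A.mapDomain g) := ev_mapDomain fun ij hij => by
    have h0 := Or.inl (b := B (ij.1, ij.2) ≠ 0) (Finsupp.mem_support_iff.1 hij)
    exact (hg _ _ h0 (h.supp _ _ h0).1 (h.supp _ _ h0).2).2.2
  have hB : ev a b B = M * ev a' b' (B.mapDomain g) := ev_mapDomain fun ij hij => by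
    have h0 := Or.inr (a := A (ij.1, ij.2) ≠ 0) (Finsupp.mem_support_iff.1 hij)
    exact (hg _ _ h0 (h.supp _ _ h0).1 (h.supp _ _ h0).2).2.2
  have h0 := h.ne_zero
  rw [hB] at h0
  refine ⟨⟨?_, ?_, right_ne_zero_of_mul h0⟩, hB⟩
  · intro i j hij
    have : ∃ kl : ℕ × ℕ, (A kl ≠ 0 ∨ B kl ≠ 0) ∧ g kl = (i, j) := by
      rcases hij with h | h
      · obtain ⟨j', h1, h2⟩ := exists_of_mapDomain_ne_zero h
        exact ⟨j', Or.inl h1, h2⟩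
      · obtain ⟨j', h1, h2⟩ := exists_of_mapDomain_ne_zero h
        exact ⟨j', Or.inr h1, h2⟩
    obtain ⟨⟨i', j'⟩, h1, h2⟩ := this
    have := hg i' j' h1 (h.supp _ _ h1).1 (h.supp _ _ h1).2
    rw [h2] at this
    exact ⟨this.1, this.2.1⟩
  · have := h.rel
    rw [hA, hB, mul_left_comm] at this
    exact mul_left_cancel₀ (left_ne_zero_of_mul h0) this

theorem Pencil.inv (h : Pencil x n k e a b A B) (ha : a ≠ 0) :
    ∃ A' B', Pencil x n k e a⁻¹ (b / a ^ k) A' B' ∧ ev a b B = a ^ e * ev a⁻¹ (b / a ^ k) B' := by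
  refine ⟨_, _, h.mapDomain (fun ij => (e - k * ij.2 - ij.1, ij.2)) ?_⟩
  intro i j _ hj hij
  refine ⟨hj, by dsimp; omega, ?_⟩
  dsimp
  obtain ⟨l, hl⟩ := Nat.exists_eq_add_of_le hij
  rw [show e - k * j - i = l by omega, hl, div_pow, ← pow_mul, inv_pow, pow_add, pow_add]
  field_simp

end Pencil

section NoetherFano

variable {K : Type*} [Field K] [Algebra ℂ K]

/-- A valuation trivial on constants and on `x`, preserved by two derivations. -/
structure IsPlace (x : K) (v : Valuation K ℤᵐ⁰) (D₁ D₂ : Derivation ℂ K K) : Prop where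
  const : ∀ z : ℂ, z ≠ 0 → v (algebraMap ℂ K z) = 1
  map_x : v x = 1
  left : ∀ a, v a ≤ 1 → v (D₁ a) ≤ 1
  right : ∀ a, v a ≤ 1 → v (D₂ a) ≤ 1

/-- The conditions bounding the base points of a pencil. -/
structure Tame (n m : ℕ) (a b : K) (A B : (ℕ × ℕ) →₀ ℂ) : Prop where
  corner : ∃ i j, (A (i, j) ≠ 0 ∨ B (i, j) ≠ 0) ∧ i + j ≤ m
  corner' : ∃ i j, (A (i, j) ≠ 0 ∨ B (i, j) ≠ 0) ∧ i + (n - j) ≤ m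
  row : ∃ j, A (0, j) ≠ 0 ∨ B (0, j) ≠ 0
  top : ∃ i, A (i, n) ≠ 0 ∨ B (i, n) ≠ 0
  bezout : ∃ (U V : (ℕ × ℕ) →₀ ℂ) (R : ℂ[X]), R ≠ 0 ∧
    ev a b U * ev a b A + ev a b V * ev a b B = aeval a R

/-- A family of coordinate pairs all of whose pencils are tame. -/
structure TameClass (x : K) (n k e m : ℕ) (C : K → K → Prop) : Prop where
  subX : ∀ a b, C a b → ∀ γ : ℂ, C (a - algebraMap ℂ K γ) b
  subY : ∀ a b, C a b → ∀ γ : ℂ, C a (b - algebraMap ℂ K γ)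
  inv : ∀ a b, C a b → C a⁻¹ (b / a ^ k)
  tame : ∀ a b A B, C a b → Pencil x n k e a b A B → Tame n m a b A B

variable {x : K} {v : Valuation K ℤᵐ⁰} {D₁ D₂ : Derivation ℂ K K} {n k e m p q : ℕ}
  {C : K → K → Prop} {a b : K} {A B : (ℕ × ℕ) →₀ ℂ}

theorem jac_inv_right (ha : b ≠ 0) : jac D₁ D₂ a b = -b ^ 2 * jac D₁ D₂ a b⁻¹ := by
  simp only [jac, Derivation.leibniz_inv, smul_eq_mul]
  field_simp
  ring

theorem jac_toric (ha : a ≠ 0) (k : ℕ) :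
    jac D₁ D₂ a b = -a ^ (k + 2) * jac D₁ D₂ a⁻¹ (b / a ^ k) := by
  have h : ∀ D : Derivation ℂ K K, D (b / a ^ k) =
      (a ^ k)⁻¹ * D b + (b * (-(k : K) * a ^ (k - 1) / (a ^ k) ^ 2)) * D a := by
    intro D
    rw [div_eq_mul_inv, Derivation.leibniz, Derivation.leibniz_inv, Derivation.leibniz_pow]
    simp only [smul_eq_mul, nsmul_eq_mul]
    ring
  simp only [jac, Derivation.leibniz_inv, h, smul_eq_mul]
  field_simp
  ring

theorem pow_le_pow_of_local {s t : ℤᵐ⁰} (hs : s ≤ 1) (h : s ^ m ≤ t) (hmq : m * q ≤ p) :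
    s ^ p ≤ t ^ q := by
  calc s ^ p ≤ s ^ (m * q) := pow_le_pow_right_of_le_one' hs hmq
    _ = (s ^ m) ^ q := pow_mul _ _ _
    _ ≤ t ^ q := pow_le_pow_left' h q

theorem IsPlace.valuation_eq_one (hv : IsPlace x v D₁ D₂) (hrel : ev a b A = x * ev a b B)
    (h : v (ev a b A) = 1 ∨ v (ev a b B) = 1) : v (ev a b B) = 1 := by
  rcases h with h | h
  · rwa [hrel, map_mul, hv.map_x, one_mul] at h
  · exact h

/-- The part of the estimate where `v b > 1`. -/
theorem nf_inv_right (hP : Pencil x n k e a b A B) (hb : 1 < v b)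
    (hqn : 2 * p ≤ q * n)
    (h : ∀ A' B' : (ℕ × ℕ) →₀ ℂ, Pencil x n 0 e a b⁻¹ A' B' →
      (∀ i j, j ≤ n → (A (i, j) ≠ 0 ∨ B (i, j) ≠ 0) → A' (i, n - j) ≠ 0 ∨ B' (i, n - j) ≠ 0) →
      v (jac D₁ D₂ a b⁻¹) ^ p ≤ v (ev a b⁻¹ B') ^ q) :
    v (jac D₁ D₂ a b) ^ p ≤ v (ev a b B) ^ q := by
  have hb0 : b ≠ 0 := by rintro rfl; simp at hb
  let g : ℕ × ℕ → ℕ × ℕ := fun ij => (ij.1, n - ij.2)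
  obtain ⟨hP', hB⟩ := hP.mapDomain (n' := n) (k' := 0) (e' := e) (a' := a) (b' := b⁻¹)
    (M := b ^ n) g (by
      intro i j _ hj hij
      refine ⟨Nat.sub_le _ _, by dsimp [g]; have := Nat.zero_le (k * j); omega, ?_⟩
      dsimp [g]
      obtain ⟨l, rfl⟩ := Nat.exists_eq_add_of_le hj
      rw [Nat.add_sub_cancel_left, pow_add, inv_pow]
      field_simp)
  have hinj : ∀ C : (ℕ × ℕ) →₀ ℂ, (∀ i j, C (i, j) ≠ 0 → j ≤ n) → Set.InjOn g C.support := by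
    rintro C hC ⟨i, j⟩ hij ⟨i', j'⟩ hij' h
    have e1 := hC _ _ (Finsupp.mem_support_iff.1 hij)
    have e2 := hC _ _ (Finsupp.mem_support_iff.1 hij')
    simp only [g, Prod.mk.injEq] at h ⊢
    omega
  have key := h _ _ hP' (by
    intro i j _ h
    rcases h with h | h
    · exact Or.inl (mapDomain_ne_zero (hinj A fun i j h => (hP.supp i j (Or.inl h)).1) h)
    · exact Or.inr (mapDomain_ne_zero (hinj B fun i j h => (hP.supp i j (Or.inr h)).1) h))
  rw [hB, jac_inv_right hb0]
  simp only [map_mul, map_pow, Valuation.map_neg, mul_pow, ← pow_mul]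
  exact mul_le_mul' (pow_le_pow_right₀ hb.le (by linarith)) key

theorem nf_left_lt (hv : IsPlace x v D₁ D₂) (hC : TameClass x n k e m C)
    (hmq : m * q ≤ p) (hqn : 2 * p ≤ q * n) (hab : C a b)
    (hP : Pencil x n k e a b A B) (hJ : jac D₁ D₂ a b ≠ 0) (ha : v a < 1) :
    v (jac D₁ D₂ a b) ^ p ≤ v (ev a b B) ^ q := by
  rcases le_or_gt (v b) 1 with hb | hb
  · rcases residue_dichotomy v hv.const hb with ⟨γ, hγ⟩ | hp
    · have hP' := hP.shiftY γ
      have hT := hC.tame _ _ _ _ (hC.subY _ _ hab γ) hP'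
      have hJ' : jac D₁ D₂ a b = jac D₁ D₂ a (b - algebraMap ℂ K γ) := by
        rw [← jac_add_const _ _ _ (b - algebraMap ℂ K γ) γ, sub_add_cancel]
      have hB : ev a b B = ev a (b - algebraMap ℂ K γ) (shiftY γ B) := by
        rw [ev_shiftY, sub_add_cancel]
      obtain ⟨i, j, h, hij⟩ := hT.corner
      have := local_adjunction v D₁ D₂ hv.const hv.left hv.right hv.map_x ha hγ (hJ' ▸ hJ)
        hP'.rel ⟨(i, j), h, hij⟩
      rw [hB, hJ']
      exact pow_le_pow_of_local (valuation_jac_le_one v D₁ D₂ hv.left hv.right ha.le hγ.le)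
        this hmq
    · obtain ⟨j, hj⟩ := (hC.tame _ _ _ _ hab hP).row
      rw [hv.valuation_eq_one hP.rel (hj.imp
        (fun h => valuation_ev_eq_one v hv.const ha hb hp ⟨j, h⟩)
        (fun h => valuation_ev_eq_one v hv.const ha hb hp ⟨j, h⟩)), one_pow]
      exact pow_le_one' (valuation_jac_le_one v D₁ D₂ hv.left hv.right ha.le hb) _
  · refine nf_inv_right hP hb hqn fun A' B' hP' h' => ?_
    have hb0 : b ≠ 0 := by rintro rfl; simp at hb
    have hb1 : v b⁻¹ < 1 := by rw [map_inv₀]; exact inv_lt_one_of_one_lt₀ hb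
    have hJ' : jac D₁ D₂ a b⁻¹ ≠ 0 := fun h0 => hJ (by rw [jac_inv_right hb0, h0, mul_zero])
    obtain ⟨i, j, h, hij⟩ := (hC.tame _ _ _ _ hab hP).corner'
    have := local_adjunction v D₁ D₂ hv.const hv.left hv.right hv.map_x ha hb1 hJ' hP'.rel
      ⟨(i, n - j), h' i j (hP.supp i j h).1 h, hij⟩
    exact pow_le_pow_of_local (valuation_jac_le_one v D₁ D₂ hv.left hv.right ha.le hb1.le)
      this hmq

theorem nf_left_le (hv : IsPlace x v D₁ D₂) (hC : TameClass x n k e m C)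
    (hmq : m * q ≤ p) (hqn : 2 * p ≤ q * n) (hab : C a b)
    (hP : Pencil x n k e a b A B) (hJ : jac D₁ D₂ a b ≠ 0) (ha : v a ≤ 1) :
    v (jac D₁ D₂ a b) ^ p ≤ v (ev a b B) ^ q := by
  rcases residue_dichotomy v hv.const ha with ⟨γ, hγ⟩ | hp
  · have hJ' : jac D₁ D₂ a b = jac D₁ D₂ (a - algebraMap ℂ K γ) b := by simp [jac]
    have hB : ev a b B = ev (a - algebraMap ℂ K γ) b (shiftX γ B) := by
      rw [ev_shiftX, sub_add_cancel]
    rw [hJ', hB]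
    exact nf_left_lt hv hC hmq hqn (hC.subX _ _ hab γ) (hP.shiftX γ) (hJ' ▸ hJ) hγ
  have hT := hC.tame _ _ _ _ hab hP
  rcases le_or_gt (v b) 1 with hb | hb
  · obtain ⟨U, V, R, hR, hUV⟩ := hT.bezout
    have hA1 := valuation_ev_le_one v hv.const ha hb A
    have hB1 := valuation_ev_le_one v hv.const ha hb B
    have hU1 := valuation_ev_le_one v hv.const ha hb U
    have hV1 := valuation_ev_le_one v hv.const ha hb V
    have hvB : v (ev a b B) = 1 := by
      refine le_antisymm hB1 (not_lt.1 fun hlt => ?_)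
      have hlt' : v (ev a b A) < 1 := by rwa [hP.rel, map_mul, hv.map_x, one_mul]
      have : v (ev a b U * ev a b A + ev a b V * ev a b B) < 1 := by
        refine v.map_add_lt ?_ ?_ <;> rw [map_mul]
        · exact mul_lt_one_of_nonneg_of_lt_one_right hU1 zero_le hlt'
        · exact mul_lt_one_of_nonneg_of_lt_one_right hV1 zero_le hlt
      rw [hUV, hp R hR] at this
      exact lt_irrefl _ this
    rw [hvB, one_pow]
    exact pow_le_one' (valuation_jac_le_one v D₁ D₂ hv.left hv.right ha hb) _
  · refine nf_inv_right hP hb hqn fun A' B' hP' h' => ?_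
    have hb1 : v b⁻¹ < 1 := by rw [map_inv₀]; exact inv_lt_one_of_one_lt₀ hb
    obtain ⟨i, hi⟩ := hT.top
    have hi' := h' i n le_rfl hi
    rw [Nat.sub_self] at hi'
    have hone : ∀ C : (ℕ × ℕ) →₀ ℂ, C (i, 0) ≠ 0 → v (ev a b⁻¹ C) = 1 := fun C h => by
      rw [← ev_swapVars]
      exact valuation_ev_eq_one v hv.const hb1 ha hp ⟨i, by rwa [swapVars_apply]⟩
    rw [hv.valuation_eq_one hP'.rel (hi'.imp (hone _) (hone _)), one_pow]
    exact pow_le_one' (valuation_jac_le_one v D₁ D₂ hv.left hv.right ha hb1.le) _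

theorem noether_fano_local (hv : IsPlace x v D₁ D₂) (hC : TameClass x n k e m C)
    (hmq : m * q ≤ p) (hqn : 2 * p ≤ q * n) (hqe : p * (k + 2) ≤ q * e) (hab : C a b)
    (hP : Pencil x n k e a b A B) (hJ : jac D₁ D₂ a b ≠ 0) :
    v (jac D₁ D₂ a b) ^ p ≤ v (ev a b B) ^ q := by
  rcases le_or_gt (v a) 1 with ha | ha
  · exact nf_left_le hv hC hmq hqn hab hP hJ ha
  have ha0 : a ≠ 0 := by rintro rfl; simp at ha
  obtain ⟨A', B', hP', hB⟩ := hP.inv ha0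
  have hJ' : jac D₁ D₂ a⁻¹ (b / a ^ k) ≠ 0 := fun h0 => hJ (by rw [jac_toric ha0 k, h0, mul_zero])
  have ha1 : v a⁻¹ < 1 := by rw [map_inv₀]; exact inv_lt_one_of_one_lt₀ ha
  have key := nf_left_lt hv hC hmq hqn (hC.inv _ _ hab) hP' hJ' ha1
  rw [hB, jac_toric ha0 k]
  simp only [map_mul, map_pow, Valuation.map_neg, mul_pow, ← pow_mul]
  exact mul_le_mul' (pow_le_pow_right₀ ha.le (by linarith)) key

end NoetherFano

end

section

open scoped WithZero
open Polynomial

theorem exists_derivation_extends {R K : Type*} [CommRing R] [IsDomain R] [Algebra ℂ R] [Field K]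
    [Algebra R K] [Algebra ℂ K] [IsScalarTower ℂ R K] [IsFractionRing R K] (d : Derivation ℂ R R) :
    ∃ D : Derivation ℂ K K, ∀ r, D (algebraMap R K r) = algebraMap R K (d r) := by
  have : Algebra.FormallyEtale R K := Algebra.FormallyEtale.of_isLocalization (nonZeroDivisors R)
  let l : Ω[R⁄ℂ] →ₗ[R] K := (Algebra.linearMap R K).comp d.liftKaehlerDifferential
  let L : Ω[K⁄ℂ] →ₗ[K] K := (l.liftBaseChange K).comp
    (KaehlerDifferential.tensorKaehlerEquivOfFormallyEtale ℂ R K).symm.toLinearMap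
  refine ⟨L.compDer (KaehlerDifferential.D ℂ K), fun r => ?_⟩
  simp [L, l, KaehlerDifferential.tensorKaehlerEquivOfFormallyEtale_symm_D_algebraMap]

theorem K2.exists_dX0 : ∃ D : Derivation ℂ K2 K2, D X0 = 1 ∧ D X1 = 0 := by
  obtain ⟨D, hD⟩ := exists_derivation_extends (K := K2) (MvPolynomial.pderiv (R := ℂ) (0 : Fin 2))
  exact ⟨D, by simp [X0, hD], by simp [X1, hD, MvPolynomial.pderiv_X]⟩

theorem K2.exists_dX1 : ∃ D : Derivation ℂ K2 K2, D X0 = 0 ∧ D X1 = 1 := by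
  obtain ⟨D, hD⟩ := exists_derivation_extends (K := K2) (MvPolynomial.pderiv (R := ℂ) (1 : Fin 2))
  exact ⟨D, by simp [X0, hD, MvPolynomial.pderiv_X], by simp [X1, hD]⟩

end

section

open scoped WithZero
open Polynomial

/-- The field `ℂ(x)` inside `ℂ(x, y)`. -/
abbrev LX : IntermediateField ℂ K2 := IntermediateField.adjoin ℂ {X0}

theorem LX.transcendental_X1 : Transcendental LX X1 := by
  have h := K2.algebraicIndependent_X.transcendental_adjoin (s := {0}) (i := 1) (by simp)
  have h0 : ![X0, X1] '' {0} = {X0} := by simp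
  rw [h0] at h
  exact IntermediateField.transcendental_adjoin_iff.2 h

theorem LX.adjoin_X1 : IntermediateField.adjoin LX {X1} = ⊤ := by
  have h : (⊤ : IntermediateField ℂ K2) ≤
      (IntermediateField.adjoin LX {X1}).restrictScalars ℂ := by
    rw [← K2.adjoin_X, IntermediateField.adjoin_le_iff]
    rintro _ (rfl | rfl)
    · exact (IntermediateField.adjoin LX {X1}).algebraMap_mem
        ⟨X0, IntermediateField.mem_adjoin_simple_self ℂ X0⟩
    · exact IntermediateField.mem_adjoin_simple_self LX X1
  rw [eq_top_iff]
  intro z _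
  exact h (x := z) trivial

/-- `ℂ(x, y)` as an algebra over `ℂ(x)[Y]`. -/
abbrev LX.algebraPoly : Algebra LX[X] K2 := (aeval X1 : LX[X] →ₐ[LX] K2).toAlgebra

attribute [local instance] LX.algebraPoly

theorem LX.algebraMap_poly (p : LX[X]) : algebraMap LX[X] K2 p = aeval X1 p := rfl

theorem LX.isFractionRing : IsFractionRing LX[X] K2 := by
  have : FaithfulSMul LX[X] K2 := (faithfulSMul_iff_algebraMap_injective _ _).2
    (transcendental_iff_injective.1 LX.transcendental_X1)
  refine IsFractionRing.of_field _ _ fun z => ?_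
  have hz : z ∈ IntermediateField.adjoin LX {X1} := LX.adjoin_X1 ▸ IntermediateField.mem_top
  exact (IntermediateField.mem_adjoin_simple_iff _ _).1 hz

attribute [local instance] LX.isFractionRing

theorem LX.derivation_mem {D : Derivation ℂ K2 K2} (h : D X0 ∈ LX) {z : K2} (hz : z ∈ LX) :
    D z ∈ LX := by
  induction hz using IntermediateField.adjoin_induction with
  | mem z hz => rw [Set.mem_singleton_iff.1 hz]; exact h
  | algebraMap c => simp
  | add a b _ _ ha hb => rw [map_add]; exact add_mem ha hb
  | inv a ha ha' =>
    rw [Derivation.leibniz_inv, smul_eq_mul]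
    exact mul_mem (neg_mem (pow_mem (inv_mem ha) 2)) ha'
  | mul a b ha hb ha' hb' =>
    rw [Derivation.leibniz, smul_eq_mul, smul_eq_mul]
    exact add_mem (mul_mem ha hb') (mul_mem hb ha')

theorem LX.derivation_poly {D : Derivation ℂ K2 K2} (h0 : D X0 ∈ LX)
    (h1 : D X1 ∈ (algebraMap LX[X] K2).range) (p : LX[X]) :
    D (algebraMap LX[X] K2 p) ∈ (algebraMap LX[X] K2).range := by
  have hC : ∀ z ∈ LX, z ∈ (algebraMap LX[X] K2).range := fun z hz =>
    ⟨C ⟨z, hz⟩, by simp [LX.algebraMap_poly]⟩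
  induction p using Polynomial.induction_on' with
  | add p q hp hq => rw [map_add, map_add]; exact add_mem hp hq
  | monomial n a =>
    have : algebraMap LX[X] K2 (monomial n a) = (a : K2) * X1 ^ n := by
      simp [LX.algebraMap_poly, aeval_monomial]
    have hX : X1 ∈ (algebraMap LX[X] K2).range := ⟨X, by simp [LX.algebraMap_poly]⟩
    rw [this, Derivation.leibniz, Derivation.leibniz_pow, smul_eq_mul, smul_eq_mul, smul_eq_mul]
    refine add_mem (mul_mem (hC _ a.2) ?_) (mul_mem (pow_mem hX _) ?_)
    · exact nsmul_mem (mul_mem (pow_mem hX _) h1) _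
    · exact hC _ (LX.derivation_mem h0 a.2)

open IsDedekindDomain in
theorem LX.derivation_valuation_le_one {D : Derivation ℂ K2 K2} (h0 : D X0 ∈ LX)
    (h1 : D X1 ∈ (algebraMap LX[X] K2).range) (v : HeightOneSpectrum LX[X]) {z : K2}
    (hz : v.valuation K2 z ≤ 1) : v.valuation K2 (D z) ≤ 1 := by
  obtain ⟨n, d, h⟩ := v.exists_primeCompl_mul_eq_of_integer z hz
  have hd : v.valuation K2 (algebraMap LX[X] K2 d) = 1 :=
    v.valuation_eq_one_iff_notMem.2 d.2
  have hp : ∀ p, v.valuation K2 (D (algebraMap LX[X] K2 p)) ≤ 1 := fun p => by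
    obtain ⟨q, hq⟩ := LX.derivation_poly h0 h1 p
    rw [← hq]
    exact v.valuation_le_one q
  have h2 : D z * algebraMap LX[X] K2 d =
      D (algebraMap LX[X] K2 n) - z * D (algebraMap LX[X] K2 d) := by
    rw [← h, Derivation.leibniz, smul_eq_mul, smul_eq_mul]; ring
  have h3 : v.valuation K2 (D z * algebraMap LX[X] K2 d) ≤ 1 := by
    rw [h2]
    refine (Valuation.map_sub _ _ _).trans (max_le (hp n) ?_)
    rw [map_mul]
    exact mul_le_one' hz (hp d)
  rwa [map_mul, hd, mul_one] at h3

open IsDedekindDomain in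
theorem LX.valuation_eq_one (v : HeightOneSpectrum LX[X]) {z : K2} (hz : z ∈ LX) (h0 : z ≠ 0) :
    v.valuation K2 z = 1 := by
  have h : z = algebraMap LX[X] K2 (C ⟨z, hz⟩) := by simp [LX.algebraMap_poly]
  rw [h, v.valuation_eq_one_iff_notMem]
  intro hm
  refine v.isPrime.ne_top (Ideal.eq_top_of_isUnit_mem _ hm (isUnit_C.2 (IsUnit.mk0 _ ?_)))
  simpa [Subtype.ext_iff] using h0

open IsDedekindDomain in
theorem LX.isPlace (v : HeightOneSpectrum LX[X]) {D₁ D₂ : Derivation ℂ K2 K2} (h10 : D₁ X0 ∈ LX)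
    (h11 : D₁ X1 ∈ (algebraMap LX[X] K2).range) (h20 : D₂ X0 ∈ LX)
    (h21 : D₂ X1 ∈ (algebraMap LX[X] K2).range) : IsPlace X0 (v.valuation K2) D₁ D₂ where
  const z hz := LX.valuation_eq_one v (LX.algebraMap_mem z)
    (by simpa using hz)
  map_x := LX.valuation_eq_one v (IntermediateField.mem_adjoin_simple_self ℂ X0) X0_ne_zero
  left _ := LX.derivation_valuation_le_one h10 h11 v
  right _ := LX.derivation_valuation_le_one h20 h21 v

theorem K2.map_derivation {D D' : Derivation ℂ K2 K2} {f : Cremona2} (h0 : f (D' X0) = D (f X0))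
    (h1 : f (D' X1) = D (f X1)) (z : K2) : f (D' z) = D (f z) := by
  have hz : z ∈ IntermediateField.adjoin ℂ {X0, X1} := K2.adjoin_X ▸ IntermediateField.mem_top
  induction hz using IntermediateField.adjoin_induction with
  | mem z hz => rcases hz with rfl | rfl <;> assumption
  | algebraMap c => simp
  | add a b _ _ ha hb => simp [ha, hb]
  | inv a _ ha => simp [Derivation.leibniz_inv, ha]
  | mul a b _ _ ha hb => simp [ha, hb]

theorem IsPlace.comap {v : Valuation K2 ℤᵐ⁰} {D₁ D₂ D₁' D₂' : Derivation ℂ K2 K2}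
    (h : IsPlace X0 v D₁ D₂) {f : Cremona2} (hf : f X0 = X0) (h1 : ∀ z, f (D₁' z) = D₁ (f z))
    (h2 : ∀ z, f (D₂' z) = D₂ (f z)) :
    IsPlace X0 (v.comap (f : K2 →+* K2)) D₁' D₂' where
  const z hz := by simpa using h.const z hz
  map_x := by simpa [hf] using h.map_x
  left z hz := by
    have := h.left (f z) hz
    rwa [← h1] at this
  right z hz := by
    have := h.right (f z) hz
    rwa [← h2] at this

theorem LX.apply_eq {f : Cremona2} (hf : f X0 = X0) {z : K2} (hz : z ∈ LX) : f z = z := by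
  induction hz using IntermediateField.adjoin_induction with
  | mem z hz => rw [Set.mem_singleton_iff.1 hz]; exact hf
  | algebraMap c => simp
  | add a b _ _ ha hb => rw [map_add, ha, hb]
  | inv a _ ha => rw [map_inv₀, ha]
  | mul a b _ _ ha hb => rw [map_mul, ha, hb]

theorem noether_fano {n k e m p q : ℕ} {C : K2 → K2 → Prop} {a b : K2} {A B : (ℕ × ℕ) →₀ ℂ}
    (hC : TameClass X0 n k e m C) (hmq : m * q ≤ p) (hqn : 2 * p ≤ q * n)
    (hqe : p * (k + 2) ≤ q * e) (hp : 1 ≤ p) (hab : C a b) (hP : Pencil X0 n k e a b A B)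
    {D₁ D₂ : Derivation ℂ K2 K2} (h10 : D₁ X0 = 1) (h11 : D₁ X1 = 0) (h20 : D₂ X0 = 0)
    (h21 : D₂ X1 = 1) : jac D₁ D₂ a b = 0 := by
  by_contra hJ
  have hB := hP.ne_zero
  set J := jac D₁ D₂ a b with hJdef
  set b' := ev a b B
  obtain ⟨g, hg⟩ : J ^ p / b' ^ q ∈ (algebraMap LX[X] K2).range := by
    refine IsDedekindDomain.HeightOneSpectrum.mem_integers_of_valuation_le_one K2 _ fun v => ?_
    have hv := LX.isPlace v (D₁ := D₁) (D₂ := D₂) (h10 ▸ one_mem _) (h11 ▸ zero_mem _)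
      (h20 ▸ zero_mem _) (h21 ▸ one_mem _)
    have h := noether_fano_local hv hC hmq hqn hqe hab hP hJ
    rw [map_div₀, map_pow, map_pow]
    exact div_le_one_of_le₀ h zero_le
  have hX : Prime (X : LX[X]) := prime_X
  let v : IsDedekindDomain.HeightOneSpectrum LX[X] :=
    ⟨Ideal.span {X}, (Ideal.span_singleton_prime X_ne_zero).2 hX, by simp⟩
  have hvy : v.valuation K2 X1 < 1 := by
    have : X1 = algebraMap LX[X] K2 X := by simp [LX.algebraMap_poly]
    rw [this, v.valuation_lt_one_iff_mem]
    exact Ideal.mem_span_singleton_self _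
  have hvy0 : v.valuation K2 X1 ≠ 0 := by simpa using X1_ne_zero
  have hv := (LX.isPlace v (D₁ := D₁) (D₂ := D₂) (h10 ▸ one_mem _) (h11 ▸ zero_mem _)
      (h20 ▸ zero_mem _) (h21 ▸ one_mem _)).comap (D₁' := D₁) (D₂' := (-X1 ^ 2) • D₂)
      Cremona2.iy_X0 (K2.map_derivation (by simp [h10]) (by simp [h11, Derivation.leibniz_inv]))
      (K2.map_derivation (by simp [h20]) (by simp [h21, Derivation.leibniz_inv]))
  have hJ' : jac D₁ ((-X1 ^ 2) • D₂) a b = - X1 ^ 2 * J := by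
    simp only [hJdef, jac, Derivation.smul_apply, smul_eq_mul]; ring
  have h := noether_fano_local hv hC hmq hqn hqe hab hP
    (by rw [hJ']; exact mul_ne_zero (by simpa using X1_ne_zero) hJ)
  have hg0 : g ≠ 0 := by
    rintro rfl
    rw [map_zero] at hg
    exact div_ne_zero (pow_ne_zero p hJ) (pow_ne_zero q hB) hg.symm
  have hiy : Cremona2.iy (algebraMap LX[X] K2 g) = aeval X1 g.reverse * X1⁻¹ ^ g.natDegree := by
    let F : K2 →+* K2 := Cremona2.iy
    have hF : F.comp (algebraMap LX K2) = algebraMap LX K2 :=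
      RingHom.ext fun c => LX.apply_eq Cremona2.iy_X0 c.2
    let := invertibleOfNonzero (inv_ne_zero X1_ne_zero)
    have hr := eval₂_reverse_mul_pow (algebraMap LX K2) X1⁻¹ g
    rw [invOf_eq_inv, inv_inv] at hr
    rw [LX.algebraMap_poly, aeval_def, aeval_def, hr]
    refine (hom_eval₂ g (algebraMap LX K2) F X1).trans ?_
    rw [hF]
    congr 1
    exact Cremona2.iy_X1
  have hrev : v.valuation K2 (aeval X1 g.reverse) = 1 := by
    rw [← LX.algebraMap_poly, v.valuation_eq_one_iff_notMem, Ideal.mem_span_singleton,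
      X_dvd_iff, coeff_zero_reverse]
    simpa using hg0
  have hvg : 1 ≤ v.valuation K2 (Cremona2.iy (algebraMap LX[X] K2 g)) := by
    rw [hiy, map_mul, hrev, one_mul, map_pow, map_inv₀]
    exact one_le_pow₀ ((one_le_inv₀ (zero_lt_iff.2 hvy0)).2 hvy.le)
  rw [hg, map_div₀, map_div₀, map_pow, map_pow, map_pow, map_pow] at hvg
  rw [hJ', Valuation.comap_apply, Valuation.comap_apply] at h
  simp only [RingHom.coe_coe, map_mul, map_neg, map_pow, Cremona2.iy_X1, Valuation.map_neg,
    map_inv₀] at h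
  have hj : v.valuation K2 (Cremona2.iy J) ≠ 0 := by simpa using hJ
  have hβ : v.valuation K2 (Cremona2.iy b') ≠ 0 := by simpa using hB
  rw [one_le_div₀ (zero_lt_iff.2 (pow_ne_zero q hβ))] at hvg
  have h1 := h.trans hvg
  rw [mul_pow] at h1
  have h2 : 1 < ((v.valuation K2 X1)⁻¹ ^ 2) ^ p :=
    one_lt_pow₀ (one_lt_pow₀ ((one_lt_inv₀ (zero_lt_iff.2 hvy0)).2 hvy) two_ne_zero) (by omega)
  have h3 := mul_lt_mul_of_pos_right h2 (zero_lt_iff.2 (pow_ne_zero p hj))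
  rw [one_mul] at h3
  exact absurd h1 (not_le.2 h3)

end

section

open Polynomial

section Rational

variable {F E : Type*} [Field F] [Field E] [Algebra F E] {y z : E}

theorem exists_ratFunc_equiv (hy : Transcendental F y) (hyt : IntermediateField.adjoin F {y} = ⊤) :
    ∃ e : RatFunc F ≃ₐ[F] E, e RatFunc.X = y := by
  refine ⟨(RatFunc.algEquivOfTranscendental y hy).trans
    ((IntermediateField.equivOfEq hyt).trans IntermediateField.topEquiv), ?_⟩
  simp

theorem mem_range_of_isAlgebraic (hy : Transcendental F y)
    (hyt : IntermediateField.adjoin F {y} = ⊤) (hz : IsAlgebraic F z) :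
    ∃ c : F, z = algebraMap F E c := by
  obtain ⟨e, -⟩ := exists_ratFunc_equiv hy hyt
  by_contra h
  have := RatFunc.transcendental_of_ne_C (e.symm z) (by
    rintro ⟨c, hc⟩
    refine h ⟨c, ?_⟩
    rw [AlgEquiv.symm_apply_eq] at hc
    rw [hc]
    exact e.commutes c)
  exact this (hz.algHom e.symm.toAlgHom)

theorem mobius_of_adjoin (hy : Transcendental F y) (hyt : IntermediateField.adjoin F {y} = ⊤)
    (hzt : IntermediateField.adjoin F {z} = ⊤) :
    ∃ α β γ δ : F, α * δ - β * γ ≠ 0 ∧ algebraMap F E γ * y + algebraMap F E δ ≠ 0 ∧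
      z = (algebraMap F E α * y + algebraMap F E β) /
        (algebraMap F E γ * y + algebraMap F E δ) := by
  obtain ⟨e, he⟩ := exists_ratFunc_equiv hy hyt
  set r := e.symm z with hr
  have hrt : IntermediateField.adjoin F {r} = ⊤ := by
    have := congrArg (IntermediateField.map (e.symm : E →ₐ[F] RatFunc F)) hzt
    rw [IntermediateField.adjoin_map, Set.image_singleton, ← AlgHom.fieldRange_eq_map] at this
    refine this.trans ?_
    exact AlgHom.fieldRange_eq_top.2 e.symm.surjective
  have hd := RatFunc.finrank_eq_max_natDegree r
  rw [hrt, IntermediateField.finrank_top] at hd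
  have hn := exists_eq_X_add_C_of_natDegree_le_one (hd.symm ▸ le_max_left _ _ : r.num.natDegree ≤ 1)
  have hde := exists_eq_X_add_C_of_natDegree_le_one
    (hd.symm ▸ le_max_right _ _ : r.denom.natDegree ≤ 1)
  obtain ⟨α, β, hn⟩ := hn
  obtain ⟨γ, δ, hde⟩ := hde
  have hz : z = e (algebraMap F[X] _ r.num) / e (algebraMap F[X] _ r.denom) := by
    rw [← map_div₀, RatFunc.num_div_denom, hr, AlgEquiv.apply_symm_apply]
  have hl : ∀ a b : F, e (algebraMap F[X] (RatFunc F) (C a * X + C b)) =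
      algebraMap F E a * y + algebraMap F E b := fun a b => by
    have h : ∀ a : F, e (algebraMap F[X] (RatFunc F) (C a)) = algebraMap F E a := fun a => by
      rw [← e.commutes a]; rfl
    rw [map_add, map_mul, map_add, map_mul, h, h, RatFunc.algebraMap_X, he]
  have h0 : e (algebraMap F[X] _ r.denom) ≠ 0 := by
    simpa using r.denom_ne_zero
  rw [hde, hl] at h0
  rw [hn, hde, hl, hl] at hz
  refine ⟨α, β, γ, δ, fun h => ?_, h0, hz⟩
  have hc : ∃ c : F, z = algebraMap F E c := by
    by_cases hγ : γ = 0
    · subst hγ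
      have hδ : δ ≠ 0 := by rintro rfl; simp at h0
      have hα : α = 0 := by simpa [hδ] using h
      subst hα
      exact ⟨β / δ, by simpa using hz⟩
    · refine ⟨α / γ, ?_⟩
      have hγ' : algebraMap F E γ ≠ 0 := by simpa using hγ
      have h' := congrArg (algebraMap F E) h
      simp only [map_sub, map_mul, map_zero] at h'
      rw [hz, map_div₀, div_eq_div_iff h0 hγ']
      linear_combination -h'
  obtain ⟨c, hc⟩ := hc
  have hy' : y ∈ IntermediateField.adjoin F {z} := hzt ▸ IntermediateField.mem_top
  rw [hc, IntermediateField.adjoin_simple_eq_bot_iff.2 (IntermediateField.algebraMap_mem _ c),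
    IntermediateField.mem_bot] at hy'
  obtain ⟨c', rfl⟩ := hy'
  exact hy (isAlgebraic_algebraMap c')

end Rational

end

section

open Polynomial

theorem affine_eq {K : Type*} [Field K] {α β δ y : K} (h : δ ≠ 0) :
    (α * y + β) / (0 * y + δ) = α / δ * y + β / δ := by
  rw [zero_mul, zero_add]
  field_simp

theorem mobius_eq {K : Type*} [Field K] {α β γ δ y : K} (hγ : γ ≠ 0) (h : γ * y + δ ≠ 0) :
    (α * y + β) / (γ * y + δ) = -(α * δ - β * γ) / γ ^ 2 * (y + δ / γ)⁻¹ + α / γ := by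
  obtain ⟨D, hD⟩ : ∃ D, D = γ * y + δ := ⟨_, rfl⟩
  have hy : y = (D - δ) / γ := by rw [hD]; field_simp; ring
  have h1 : y + δ / γ = D / γ := by rw [hy]; ring
  rw [h1, ← hD, inv_div, hy]
  rw [← hD] at h
  field_simp
  ring

namespace Cremona2

/-- `y ↦ r y` lies in `H`. -/
def ScaleMem (r : K2) : Prop := r ∈ LX ∧ ∃ f ∈ H, f X0 = X0 ∧ f X1 = r * X1

theorem ScaleMem.mul {r s : K2} (hr : ScaleMem r) (hs : ScaleMem s) : ScaleMem (r * s) := by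
  obtain ⟨hr, f, hf, hf0, hf1⟩ := hr
  obtain ⟨hs, g, hg, hg0, hg1⟩ := hs
  refine ⟨mul_mem hr hs, f * g, mul_mem hf hg, by simp [hg0, hf0], ?_⟩
  rw [AlgEquiv.mul_apply, hg1, map_mul, LX.apply_eq hf0 hs, hf1]
  ring

theorem ScaleMem.ne_zero {r : K2} (hr : ScaleMem r) : r ≠ 0 := by
  rintro rfl
  obtain ⟨-, f, -, -, h⟩ := hr
  simp [X1_ne_zero] at h

theorem ScaleMem.inv {r : K2} (hr : ScaleMem r) : ScaleMem r⁻¹ := by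
  have h0 := hr.ne_zero
  obtain ⟨hr, f, hf, hf0, hf1⟩ := hr
  refine ⟨inv_mem hr, f⁻¹, inv_mem hf, f.symm_apply_eq.2 hf0.symm, f.symm_apply_eq.2 ?_⟩
  rw [map_mul, map_inv₀, LX.apply_eq hf0 hr, hf1, inv_mul_cancel_left₀ h0]

theorem scaleMem_const {c : ℂ} (hc : c ≠ 0) : ScaleMem (cst c) :=
  ⟨LX.algebraMap_mem c, dy (Units.mk0 c hc), dy_mem _, by simp, by simp⟩

theorem scaleMem_add_const (c : ℂ) : ScaleMem (X0 + cst c) :=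
  ⟨add_mem (IntermediateField.mem_adjoin_simple_self ℂ X0) (LX.algebraMap_mem c),
    tx c * m * tx (-c), mul_mem (mul_mem (tx_mem _) m_mem) (tx_mem _), by simp, by simp⟩

theorem scaleMem_poly {p : ℂ[X]} (hp : p ≠ 0) : ScaleMem (aeval X0 p) := by
  have h := (IsAlgClosed.splits p).eq_prod_roots
  rw [h, map_mul, aeval_C]
  refine (scaleMem_const (leadingCoeff_ne_zero.2 hp)).mul ?_
  generalize p.roots = s
  induction s using Multiset.induction with
  | empty =>
    have := scaleMem_const one_ne_zero
    simpa using this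
  | cons a s ih =>
    rw [Multiset.map_cons, Multiset.prod_cons, map_mul]
    refine ScaleMem.mul ?_ ih
    simpa [sub_eq_add_neg] using scaleMem_add_const (-a)

theorem scaleMem {r : K2} (hr : r ∈ LX) (h0 : r ≠ 0) : ScaleMem r := by
  obtain ⟨p, q, rfl⟩ := (IntermediateField.mem_adjoin_simple_iff _ _).1 hr
  have hp : p ≠ 0 := by rintro rfl; simp at h0
  have hq : q ≠ 0 := by rintro rfl; simp at h0
  rw [div_eq_mul_inv]
  exact (scaleMem_poly hp).mul (scaleMem_poly hq).inv

theorem exists_mem_H_scale {r : K2} (hr : r ∈ LX) (h0 : r ≠ 0) :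
    ∃ f ∈ H, f X0 = X0 ∧ f X1 = r * X1 := (scaleMem hr h0).2

theorem exists_mem_H_add {r : K2} (hr : r ∈ LX) : ∃ f ∈ H, f X0 = X0 ∧ f X1 = X1 + r := by
  by_cases h0 : r = 0
  · exact ⟨1, one_mem _, by simp, by simp [h0]⟩
  · obtain ⟨f, hf, hf0, hf1⟩ := exists_mem_H_scale (inv_mem hr) (inv_ne_zero h0)
    have h0' : f⁻¹ X0 = X0 := f.symm_apply_eq.2 hf0.symm
    have h1' : f⁻¹ X1 = r * X1 := f.symm_apply_eq.2 (by
      rw [map_mul, LX.apply_eq hf0 hr, hf1, mul_inv_cancel_left₀ h0])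
    refine ⟨f * ty 1 * f⁻¹, mul_mem (mul_mem hf (ty_mem 1)) (inv_mem hf), by simp [h0', hf0], ?_⟩
    have h1 : (f * ty 1 * f⁻¹) X1 = f (ty 1 (f⁻¹ X1)) := rfl
    rw [h1, h1', map_mul, LX.apply_eq (ty_X0 1) hr, map_mul, LX.apply_eq hf0 hr, ty_X1, cst,
      map_one,
      map_add, map_one, hf1, mul_add, mul_inv_cancel_left₀ h0, mul_one]

theorem mem_H_of_X0 {f : Cremona2} (hf : f X0 = X0) : f ∈ H := by
  have htop : IntermediateField.adjoin LX {f X1} = ⊤ := by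
    have h : (⊤ : IntermediateField ℂ K2) ≤
        (IntermediateField.adjoin LX {f X1}).restrictScalars ℂ := by
      have h1 := congrArg (IntermediateField.map (f : K2 →ₐ[ℂ] K2)) K2.adjoin_X
      rw [IntermediateField.adjoin_map, ← AlgHom.fieldRange_eq_map,
        AlgHom.fieldRange_eq_top.2 f.surjective, Set.image_pair] at h1
      rw [← h1, IntermediateField.adjoin_le_iff]
      rintro _ (rfl | rfl)
      · change f X0 ∈ _
        rw [hf]
        exact (IntermediateField.adjoin LX {f X1}).algebraMap_mem
          ⟨X0, IntermediateField.mem_adjoin_simple_self ℂ X0⟩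
      · exact IntermediateField.mem_adjoin_simple_self LX (f X1)
    rw [eq_top_iff]
    intro z _
    exact h (x := z) trivial
  obtain ⟨α, β, γ, δ, hdet, hden, hf1⟩ :=
    mobius_of_adjoin LX.transcendental_X1 LX.adjoin_X1 htop
  simp only [IntermediateField.algebraMap_apply] at hden hf1
  have hdet' : (α : K2) * δ - β * γ ≠ 0 := by
    intro h; apply hdet; ext; simpa using h
  by_cases hγ : (γ : K2) = 0
  · rw [hγ, zero_mul, zero_add] at hden
    rw [hγ, mul_zero, sub_zero] at hdet'
    obtain ⟨s, hs, hs0, hs1⟩ := exists_mem_H_scale (div_mem α.2 δ.2)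
      (div_ne_zero (left_ne_zero_of_mul hdet') hden)
    obtain ⟨e, he, he0, he1⟩ := exists_mem_H_add (div_mem β.2 δ.2)
    have : f = s * e := ext_gens (by simp [he0, hs0, hf]) (by
      rw [AlgEquiv.mul_apply, he1, map_add, hs1, LX.apply_eq hs0 (div_mem β.2 δ.2), hf1, hγ]
      exact affine_eq hden)
    exact this ▸ mul_mem hs he
  · have hc : -((α : K2) * δ - β * γ) / γ ^ 2 ∈ LX :=
      div_mem (neg_mem (sub_mem (mul_mem α.2 δ.2) (mul_mem β.2 γ.2))) (pow_mem γ.2 2)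
    have ht : (α : K2) / γ ∈ LX := div_mem α.2 γ.2
    obtain ⟨u, hu, hu0, hu1⟩ := exists_mem_H_add (div_mem δ.2 γ.2)
    obtain ⟨s, hs, hs0, hs1⟩ := exists_mem_H_scale hc
      (div_ne_zero (neg_ne_zero.2 hdet') (pow_ne_zero 2 hγ))
    obtain ⟨e, he, he0, he1⟩ := exists_mem_H_add ht
    have : f = u * (iy * (s * e)) := ext_gens (by simp [he0, hs0, hu0, hf]) (by
      rw [AlgEquiv.mul_apply, AlgEquiv.mul_apply, AlgEquiv.mul_apply, he1, map_add, hs1,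
        LX.apply_eq hs0 ht, map_add, map_mul, LX.apply_eq iy_X0 hc, LX.apply_eq iy_X0 ht, iy_X1,
        map_add, map_mul, map_inv₀, LX.apply_eq hu0 hc, LX.apply_eq hu0 ht, hu1, hf1]
      exact mobius_eq hγ hden)
    exact this ▸ mul_mem hu (mul_mem iy_mem (mul_mem hs he))

theorem mem_LX_of_isAlgebraic {z : K2} (hz : IsAlgebraic LX z) : z ∈ LX := by
  obtain ⟨c, rfl⟩ := mem_range_of_isAlgebraic LX.transcendental_X1 LX.adjoin_X1 hz
  exact c.2

theorem transcendental_X0 : Transcendental ℂ X0 :=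
  K2.algebraicIndependent_X.transcendental 0

theorem isAlgebraic_symm_X0 {f : Cremona2} (h : f X0 ∈ LX) : IsAlgebraic LX (f.symm X0) := by
  obtain ⟨p, q, hpq⟩ := (IntermediateField.mem_adjoin_simple_iff _ _).1 h
  have hq : aeval X0 q ≠ 0 := by
    intro h0
    rw [h0, div_zero] at hpq
    exact X0_ne_zero (by simpa using hpq)
  rw [eq_div_iff hq] at hpq
  let g : LX := IntermediateField.AdjoinSimple.gen ℂ X0
  refine ⟨C g * q.map (algebraMap ℂ LX) - p.map (algebraMap ℂ LX), fun h0 => hq ?_, ?_⟩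
  · suffices q = 0 by simp [this]
    ext i
    have h1 := congrArg (fun P => algebraMap LX K2 (P.coeff i)) h0
    simp only [coeff_sub, coeff_C_mul, coeff_map, coeff_zero, map_sub, map_mul, map_zero] at h1
    change X0 * cst (q.coeff i) - cst (p.coeff i) = 0 at h1
    rw [coeff_zero]
    by_contra hqi
    refine transcendental_X0 ⟨C (q.coeff i) * X - C (p.coeff i), fun h2 => hqi ?_, ?_⟩
    · simpa using congrArg (fun P => P.coeff 1) h2
    · simp only [map_sub, map_mul, aeval_C, aeval_X]
      linear_combination h1
  · have h1 := congrArg f.symm hpq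
    rw [map_mul, AlgEquiv.symm_apply_apply, ← aeval_algHom_apply, ← aeval_algHom_apply] at h1
    rw [map_sub, map_mul, aeval_C, aeval_map_algebraMap, aeval_map_algebraMap, ← h1]
    exact sub_self _

theorem adjoin_LX_eq_top {z : LX} (h : X0 ∈ IntermediateField.adjoin ℂ {(z : K2)}) :
    IntermediateField.adjoin ℂ {z} = ⊤ := by
  have hle : LX ≤ IntermediateField.adjoin ℂ {(z : K2)} := by
    rw [IntermediateField.adjoin_le_iff, Set.singleton_subset_iff]
    exact h
  have hm : IntermediateField.adjoin ℂ {(z : K2)} =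
      (IntermediateField.adjoin ℂ {z}).map LX.val := by
    rw [IntermediateField.adjoin_map, Set.image_singleton]
    rfl
  rw [eq_top_iff]
  intro u _
  have hu := hle u.2
  rw [hm] at hu
  obtain ⟨u', hu', he⟩ := hu
  rwa [← Subtype.ext he]

theorem mem_H_of_X0_mem_LX {f : Cremona2} (h : f X0 ∈ LX) : f ∈ H := by
  have h' : f.symm X0 ∈ LX := mem_LX_of_isAlgebraic (isAlgebraic_symm_X0 h)
  have htop : IntermediateField.adjoin ℂ {(⟨f X0, h⟩ : LX)} = ⊤ := by
    refine adjoin_LX_eq_top ?_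
    obtain ⟨p, q, hpq⟩ := (IntermediateField.mem_adjoin_simple_iff _ _).1 h'
    refine (IntermediateField.mem_adjoin_simple_iff _ _).2 ⟨p, q, ?_⟩
    have := congrArg f hpq
    rwa [AlgEquiv.apply_symm_apply, map_div₀, ← aeval_algHom_apply,
      ← aeval_algHom_apply] at this
  have htr : Transcendental ℂ (IntermediateField.AdjoinSimple.gen ℂ X0) :=
    fun h => transcendental_X0 (h.algebraMap (A := K2))
  have hgen : IntermediateField.adjoin ℂ {IntermediateField.AdjoinSimple.gen ℂ X0} = ⊤ :=
    adjoin_LX_eq_top (IntermediateField.mem_adjoin_simple_self ℂ X0)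
  obtain ⟨α, β, γ, δ, hdet, hden, hf⟩ := mobius_of_adjoin htr hgen htop
  suffices hh : ∃ h ∈ H, h X0 = f X0 by
    obtain ⟨h, hh, hh0⟩ := hh
    have h2 : h⁻¹ * f ∈ H := mem_H_of_X0 (h.symm_apply_eq.2 hh0.symm)
    have := mul_mem hh h2
    rwa [mul_inv_cancel_left] at this
  replace hf := congrArg (algebraMap LX K2) hf
  have hden' := (map_ne_zero (algebraMap LX K2)).2 hden
  simp only [map_div₀, map_add, map_mul, IntermediateField.algebraMap_apply,
    IntermediateField.AdjoinSimple.coe_gen] at hf hden'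
  change f X0 = (cst α * X0 + cst β) / (cst γ * X0 + cst δ) at hf
  change cst γ * X0 + cst δ ≠ 0 at hden'
  by_cases hγ : γ = 0
  · subst hγ
    have hδ : δ ≠ 0 := by rintro rfl; simp at hden'
    have hα : α ≠ 0 := by rintro rfl; simp at hdet
    rw [cst, cst, cst, cst, map_zero, affine_eq (by simpa using hδ)] at hf
    exact ⟨dx (Units.mk0 (α / δ) (div_ne_zero hα hδ)) * tx (β / δ),
      mul_mem (dx_mem _) (tx_mem _), by simp [hf]⟩
  · rw [mobius_eq (by simpa using hγ) hden'] at hf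
    refine ⟨tx (δ / γ) * (ix * (dx (Units.mk0 (-(α * δ - β * γ) / γ ^ 2)
      (div_ne_zero (neg_ne_zero.2 hdet) (pow_ne_zero 2 hγ))) * tx (α / γ))),
      mul_mem (tx_mem _) (mul_mem ix_mem (mul_mem (dx_mem _) (tx_mem _))), ?_⟩
    rw [hf]
    simp

end Cremona2

end

section

open Polynomial

theorem exists_finsupp_of_polys (n : ℕ) (p : ℕ → ℂ[X]) :
    ∃ A : (ℕ × ℕ) →₀ ℂ, (∀ i j, A (i, j) ≠ 0 → j < n) ∧
      ∀ a b : K2, ev a b A = ∑ j ∈ Finset.range n, aeval a (p j) * b ^ j := by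
  refine ⟨∑ j ∈ Finset.range n, ∑ i ∈ (p j).support, Finsupp.single (i, j) ((p j).coeff i),
    fun i j h => ?_, fun a b => ?_⟩
  · have hm : (∑ j ∈ Finset.range n, ∑ i ∈ (p j).support, Finsupp.single (i, j) ((p j).coeff i)) ∈
        Finsupp.supported ℂ ℂ {ij : ℕ × ℕ | ij.2 < n} :=
      sum_mem fun j hj => sum_mem fun i _ =>
        Finsupp.single_mem_supported ℂ _ (by simpa using hj)
    exact hm (Finsupp.mem_support_iff.2 h)
  · simp only [map_sum]
    refine Finset.sum_congr rfl fun j _ => ?_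
    rw [aeval_eq_sum_range, Finset.sum_mul, ← (p j).sum_def
      (fun i c => ev a b (Finsupp.single (i, j) c)), sum_over_range]
    · refine Finset.sum_congr rfl fun i _ => ?_
      simp [ev_apply, Algebra.smul_def, mul_assoc]
    · simp

theorem exists_common_denom {ι : Type*} (s : Finset ι) (c : ι → LX) :
    ∃ d : ℂ[X], d ≠ 0 ∧ ∀ i ∈ s, ∃ p : ℂ[X], aeval X0 d * (c i : K2) = aeval X0 p := by
  classical
  induction s using Finset.induction with
  | empty => exact ⟨1, one_ne_zero, by simp⟩
  | insert i s _ ih =>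
    obtain ⟨d, hd, h⟩ := ih
    obtain ⟨p, q, hpq⟩ := (IntermediateField.mem_adjoin_simple_iff _ _).1 (c i).2
    by_cases hq : aeval X0 q = 0
    · refine ⟨d, hd, fun j hj => ?_⟩
      rcases Finset.mem_insert.1 hj with rfl | hj
      · exact ⟨0, by rw [hpq, hq]; simp⟩
      · exact h j hj
    · refine ⟨d * q, mul_ne_zero hd (by rintro rfl; simp at hq), fun j hj => ?_⟩
      rcases Finset.mem_insert.1 hj with rfl | hj
      · refine ⟨d * p, ?_⟩
        rw [hpq, map_mul, map_mul]
        field_simp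
      · obtain ⟨p', hp'⟩ := h j hj
        exact ⟨p' * q, by rw [map_mul, map_mul, ← hp']; ring⟩

/-- Two polynomials over `ℂ(x)` are brought to a common denominator. -/
theorem exists_finsupp_pair {n : ℕ} {P Q : LX[X]} (hP : P.natDegree < n) (hQ : Q.natDegree < n) :
    ∃ (d : ℂ[X]) (A B : (ℕ × ℕ) →₀ ℂ), d ≠ 0 ∧ (∀ i j, A (i, j) ≠ 0 ∨ B (i, j) ≠ 0 → j < n) ∧
      ev X0 X1 A = aeval X0 d * aeval X1 P ∧ ev X0 X1 B = aeval X0 d * aeval X1 Q := by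
  obtain ⟨d, hd, h⟩ := exists_common_denom (Finset.univ ×ˢ Finset.range n)
    (fun ij : Bool × ℕ => if ij.1 then P.coeff ij.2 else Q.coeff ij.2)
  have key : ∀ (R : LX[X]), R.natDegree < n →
      (∀ j ∈ Finset.range n, ∃ p : ℂ[X], aeval X0 d * (R.coeff j : K2) = aeval X0 p) →
      ∃ A : (ℕ × ℕ) →₀ ℂ, (∀ i j, A (i, j) ≠ 0 → j < n) ∧
        ev X0 X1 A = aeval X0 d * aeval X1 R := by
    intro R hR hj
    choose! p hp using hj
    obtain ⟨A, hA, hev⟩ := exists_finsupp_of_polys n p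
    refine ⟨A, hA, ?_⟩
    rw [hev, aeval_eq_sum_range' hR, Finset.mul_sum]
    refine Finset.sum_congr rfl fun j hj => ?_
    rw [← hp j hj, Algebra.smul_def, mul_assoc]
    rfl
  obtain ⟨A, hA, hA'⟩ := key P hP fun j hj => by simpa using h (true, j) (by simpa using hj)
  obtain ⟨B, hB, hB'⟩ := key Q hQ fun j hj => by simpa using h (false, j) (by simpa using hj)
  exact ⟨d, A, B, hd, fun i j h => h.elim (hA i j) (hB i j), hA', hB'⟩

theorem exists_poly_of_finsupp {n : ℕ} {A : (ℕ × ℕ) →₀ ℂ} (hA : ∀ i j, A (i, j) ≠ 0 → j ≤ n) :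
    ∃ P : LX[X], P.natDegree ≤ n ∧ aeval X1 P = ev X0 X1 A := by
  let g : LX := IntermediateField.AdjoinSimple.gen ℂ X0
  refine ⟨A.sum fun ij c => monomial ij.2 (algebraMap ℂ LX c * g ^ ij.1), ?_, ?_⟩
  · refine natDegree_sum_le_of_forall_le _ _ fun ij hij => ?_
    exact (natDegree_monomial_le _).trans (hA ij.1 ij.2 (Finsupp.mem_support_iff.1 hij))
  · rw [Finsupp.sum, map_sum, ev_apply, Finsupp.sum]
    refine Finset.sum_congr rfl fun ij _ => ?_
    simp [aeval_monomial, g, mul_assoc, IntermediateField.algebraMap_apply]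

theorem exists_bound (A B : (ℕ × ℕ) →₀ ℂ) :
    ∃ n e, ∀ i j, A (i, j) ≠ 0 ∨ B (i, j) ≠ 0 → j ≤ n ∧ i + 0 * j ≤ e := by
  classical
  refine ⟨(A.support ∪ B.support).sup Prod.snd, (A.support ∪ B.support).sup Prod.fst,
    fun i j h => ?_⟩
  have hm : (i, j) ∈ A.support ∪ B.support := by simpa using h
  exact ⟨Finset.le_sup (f := Prod.snd) hm, by simpa using Finset.le_sup (f := Prod.fst) hm⟩

theorem jac_ne_zero {f : Cremona2} {D₁ D₂ : Derivation ℂ K2 K2} (h10 : D₁ X0 = 1)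
    (h11 : D₁ X1 = 0) (h21 : D₂ X1 = 1) :
    jac D₁ D₂ (f X0) (f X1) ≠ 0 := by
  have key : ∀ D : Derivation ℂ K2 K2, D (f X0) = 0 → D (f X1) = 0 → ∀ z, D z = 0 := by
    intro D h0 h1 z
    have hz : ∀ z, D (f z) = 0 := by
      intro z
      have := K2.map_derivation (D := D) (D' := 0) (f := f) (by simp [h0]) (by simp [h1]) z
      simpa using this.symm
    simpa using hz (f.symm z)
  intro hJ
  rw [jac] at hJ
  have ha := key (D₂ (f X0) • D₁ - D₁ (f X0) • D₂) (by simp [mul_comm])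
    (by simp; linear_combination -hJ)
  have hb := key (D₂ (f X1) • D₁ - D₁ (f X1) • D₂) (by simp; linear_combination hJ)
    (by simp [mul_comm])
  have ha0 := ha X0
  have hb0 := hb X0
  have ha1 := ha X1
  have hb1 := hb X1
  simp [h10, h11, h21] at ha0 hb0 ha1 hb1
  have := key D₁ ha1 hb1 X0
  rw [h10] at this
  exact one_ne_zero this

end

section

open Polynomial

/-- A set of coordinate systems of `ℂ(x, y)` stable under the elementary moves. -/
structure CoordClass (C : K2 → K2 → Prop) : Prop where
  gen : ∀ a b, C a b → ∃ f : Cremona2, f X0 = a ∧ f X1 = b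
  sub : ∀ a b, C a b → ∀ γ : ℂ, C (a - cst γ) b
  swap : ∀ a b, C a b → C b a
  inv : ∀ a b, C a b → C a⁻¹ b
  mul : ∀ a b, C a b → C a (b * a)
  div : ∀ a b, C a b → C a (b / a)

namespace CoordClass

variable {C : K2 → K2 → Prop} {a b : K2} {n k e : ℕ} {A B : (ℕ × ℕ) →₀ ℂ}

theorem ne_zero (hC : CoordClass C) (h : C a b) : a ≠ 0 ∧ b ≠ 0 := by
  obtain ⟨f, rfl, rfl⟩ := hC.gen _ _ h
  exact ⟨by simpa using X0_ne_zero, by simpa using X1_ne_zero⟩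

theorem div_pow (hC : CoordClass C) (h : C a b) (k : ℕ) : C a (b / a ^ k) := by
  induction k with
  | zero => simpa using h
  | succ k ih =>
    have := hC.div _ _ ih
    rwa [div_div, ← pow_succ] at this

theorem exists_supp (hP : Pencil X0 n k e a b A B) : ∃ i j, A (i, j) ≠ 0 ∨ B (i, j) ≠ 0 := by
  by_contra! h
  have : B = 0 := by ext ⟨i, j⟩; exact (h i j).2
  exact hP.ne_zero (by simp [this])

/-- `n` is the least degree in the second variable of a pencil for `C`. -/
def MinDeg (C : K2 → K2 → Prop) (n : ℕ) : Prop :=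
  ∀ a b n' k e A B, C a b → Pencil X0 n' k e a b A B → n ≤ n'

theorem top (hmin : MinDeg C n) (hn : 1 ≤ n) (h : C a b) (hP : Pencil X0 n k e a b A B) :
    ∃ i, A (i, n) ≠ 0 ∨ B (i, n) ≠ 0 := by
  by_contra! hno
  have : Pencil X0 (n - 1) k e a b A B := ⟨fun i j hij => by
    have h1 := hP.supp i j hij
    have h2 : j ≠ n := by
      rintro rfl
      rcases hij with h | h
      · exact h (hno i).1
      · exact h (hno i).2
    omega, hP.rel, hP.ne_zero⟩
  have := hmin _ _ _ _ _ _ _ h this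
  omega

theorem bezout (hC : CoordClass C) (hmin : MinDeg C n) (hn : 1 ≤ n) (h : C a b)
    (hP : Pencil X0 n k e a b A B) : ∃ (U V : (ℕ × ℕ) →₀ ℂ) (R : ℂ[X]), R ≠ 0 ∧
      ev a b U * ev a b A + ev a b V * ev a b B = aeval a R := by
  obtain ⟨f, rfl, rfl⟩ := hC.gen _ _ h
  have hf : ∀ A, ev (f X0) (f X1) A = f (ev X0 X1 A) := fun A =>
    (map_ev (f : K2 →ₐ[ℂ] K2) X0 X1 A).symm
  obtain ⟨P, hPd, hPA⟩ := exists_poly_of_finsupp (A := A) (n := n) fun i j h =>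
    (hP.supp i j (Or.inl h)).1
  obtain ⟨Q, hQd, hQB⟩ := exists_poly_of_finsupp (A := B) (n := n) fun i j h =>
    (hP.supp i j (Or.inr h)).1
  have hrel : aeval X1 P = f.symm X0 * aeval X1 Q := by
    apply f.injective
    rw [hPA, hQB, map_mul, AlgEquiv.apply_symm_apply, ← hf, ← hf, hP.rel]
  have hQ0 : aeval X1 Q ≠ 0 := by
    rw [hQB]
    intro h0
    exact hP.ne_zero (by rw [hf, h0, map_zero])
  have hcop : IsCoprime P Q := by
    rw [← EuclideanDomain.gcd_isUnit_iff]
    by_contra hu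
    obtain ⟨P', hP'⟩ := EuclideanDomain.gcd_dvd_left P Q
    obtain ⟨Q', hQ'⟩ := EuclideanDomain.gcd_dvd_right P Q
    set G := EuclideanDomain.gcd P Q
    have hQ00 : Q ≠ 0 := by rintro rfl; simp at hQ0
    have hP00 : P ≠ 0 := by
      rintro rfl
      rw [map_zero] at hrel
      exact mul_ne_zero (by simpa using X0_ne_zero) hQ0 hrel.symm
    have hG0 : G ≠ 0 := by intro h0; rw [h0, zero_mul] at hQ'; exact hQ00 hQ'
    have hGd : 1 ≤ G.natDegree := by
      rw [Nat.one_le_iff_ne_zero]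
      intro h0
      rw [natDegree_eq_zero] at h0
      obtain ⟨c, hc⟩ := h0
      exact hu (hc ▸ isUnit_C.2 (IsUnit.mk0 c (by rintro rfl; exact hG0 (by simp [← hc]))))
    have hP'0 : P' ≠ 0 := by rintro rfl; exact hP00 (by simpa using hP')
    have hQ'0 : Q' ≠ 0 := by rintro rfl; exact hQ00 (by simpa using hQ')
    have hPd' := congrArg natDegree hP'
    have hQd' := congrArg natDegree hQ'
    rw [natDegree_mul hG0 hP'0] at hPd'
    rw [natDegree_mul hG0 hQ'0] at hQd'
    obtain ⟨d, A', B', hd, hsupp, hA', hB'⟩ := exists_finsupp_pair (n := n) (P := P') (Q := Q')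
      (by omega) (by omega)
    have haG : aeval X1 G ≠ 0 := by
      intro h0
      rw [hQ', map_mul, h0, zero_mul] at hQ0
      exact hQ0 rfl
    have hd0 : aeval X0 d ≠ 0 := fun h0 => Cremona2.transcendental_X0 ⟨d, hd, h0⟩
    have hQ'1 : aeval X1 Q' ≠ 0 := by
      intro h0
      rw [hQ', map_mul, h0, mul_zero] at hQ0
      exact hQ0 rfl
    have hrel' : aeval X1 P' = f.symm X0 * aeval X1 Q' := by
      rw [hP', hQ', map_mul, map_mul] at hrel
      apply mul_left_cancel₀ haG
      linear_combination hrel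
    obtain ⟨n₁, e', he'⟩ := exists_bound A' B'
    have hp : Pencil X0 (n - 1) 0 e' (f X0) (f X1) A' B' := by
      refine ⟨fun i j hij => ⟨?_, (he' i j hij).2⟩, ?_, ?_⟩
      · have := hsupp i j hij
        omega
      · rw [hf, hf, hA', hB', hrel']
        simp only [map_mul, AlgEquiv.apply_symm_apply]
        ring
      · rw [hf, hB']
        simpa using ⟨hd0, hQ'1⟩
    have := hmin _ _ _ _ _ _ _ h hp
    omega
  obtain ⟨u, v, huv⟩ := hcop
  obtain ⟨d, U, V, hd, -, hU, hV⟩ := exists_finsupp_pair (P := u) (Q := v)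
    (n := u.natDegree + v.natDegree + 1) (by omega) (by omega)
  refine ⟨U, V, d, hd, ?_⟩
  rw [hf, hf, hf, hf, ← map_mul f, ← map_mul f, ← map_add f]
  refine Eq.trans ?_ (aeval_algHom_apply f X0 d).symm
  congr 1
  rw [hU, hV, ← hPA, ← hQB]
  have := congrArg (aeval X1) huv
  rw [map_add, map_mul, map_mul, map_one] at this
  linear_combination (aeval X0 d) * this

end CoordClass

end

section

open Polynomial

namespace CoordClass

variable {C : K2 → K2 → Prop} {a b : K2} {n k e : ℕ} {A B : (ℕ × ℕ) →₀ ℂ}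

/-- `2 e - n k` is minimal among pencils of degree `n`. -/
def MinSlope (C : K2 → K2 → Prop) (n k e : ℕ) : Prop :=
  ∀ a b k' e' A B, C a b → Pencil X0 n k' e' a b A B → 2 * e + n * k' ≤ 2 * e' + n * k

theorem corner (hC : CoordClass C) (hmin : MinSlope C n k e) (h : C a b)
    (hP : Pencil X0 n k e a b A B) : ∃ i j, (A (i, j) ≠ 0 ∨ B (i, j) ≠ 0) ∧ i + j ≤ n / 2 := by
  by_contra! hno
  obtain ⟨ha, hb⟩ := hC.ne_zero h
  obtain ⟨i₀, j₀, h₀⟩ := exists_supp hP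
  have h1 := hP.supp _ _ h₀
  have h2 := hno _ _ h₀
  obtain ⟨m, hm⟩ : ∃ m, m = n / 2 + 1 := ⟨_, rfl⟩
  rcases k with - | k
  · obtain ⟨hP', -⟩ := hP.mapDomain (n' := n) (k' := 1) (e' := e + n - m) (a' := a) (b' := a / b)
      (M := a ^ m * b ^ n / a ^ n) (fun ij => (ij.1 + ij.2 - m, n - ij.2)) (by
        intro i j hij hj hie
        have h3 := hno _ _ hij
        refine ⟨Nat.sub_le _ _, by dsimp; omega, ?_⟩
        dsimp
        obtain ⟨l, hl⟩ := Nat.exists_eq_add_of_le (show m ≤ i + j by omega)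
        obtain ⟨r, rfl⟩ := Nat.exists_eq_add_of_le hj
        rw [hl, Nat.add_sub_cancel_left, Nat.add_sub_cancel_left, _root_.div_pow, pow_add b]
        have : a ^ m * a ^ l = a ^ i * a ^ j := by rw [← pow_add, ← hl, pow_add]
        rw [pow_add a]
        field_simp
        linear_combination -this)
    have hC' : C a (a / b) := by
      have := hC.swap _ _ (hC.inv _ _ (hC.swap _ _ h))
      have := hC.mul _ _ this
      rwa [inv_mul_eq_div] at this
    have := hmin _ _ _ _ _ _ hC' hP'
    omega
  · obtain ⟨hP', -⟩ := hP.mapDomain (n' := n) (k' := k) (e' := e - m) (a' := a) (b' := b / a)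
      (M := a ^ m) (fun ij => (ij.1 + ij.2 - m, ij.2)) (by
        intro i j hij hj hie
        have h3 := hno _ _ hij
        rw [Nat.succ_mul] at hie
        refine ⟨hj, by dsimp; omega, ?_⟩
        dsimp
        obtain ⟨l, hl⟩ := Nat.exists_eq_add_of_le (show m ≤ i + j by omega)
        rw [hl, Nat.add_sub_cancel_left, _root_.div_pow]
        have : a ^ m * a ^ l = a ^ i * a ^ j := by rw [← pow_add, ← hl, pow_add]
        field_simp
        linear_combination -this)
    have := hmin _ _ _ _ _ _ (hC.div _ _ h) hP'
    rw [Nat.mul_succ] at this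
    rw [Nat.succ_mul] at h1
    omega

theorem corner' (hC : CoordClass C) (hmin : MinSlope C n k e) (h : C a b)
    (hP : Pencil X0 n k e a b A B) :
    ∃ i j, (A (i, j) ≠ 0 ∨ B (i, j) ≠ 0) ∧ i + (n - j) ≤ n / 2 := by
  by_contra! hno
  obtain ⟨ha, hb⟩ := hC.ne_zero h
  obtain ⟨i₀, j₀, h₀⟩ := exists_supp hP
  have h1 := hP.supp _ _ h₀
  have h2 := hno _ _ h₀
  obtain ⟨m, hm⟩ : ∃ m, m = n / 2 + 1 := ⟨_, rfl⟩
  obtain ⟨hP', -⟩ := hP.mapDomain (n' := n) (k' := k + 1) (e' := e + n - m) (a' := a) (b' := b * a)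
    (M := a ^ m / a ^ n) (fun ij => (ij.1 + (n - ij.2) - m, ij.2)) (by
      intro i j hij hj hie
      have h3 := hno _ _ hij
      refine ⟨hj, by dsimp; rw [Nat.succ_mul]; omega, ?_⟩
      dsimp
      obtain ⟨l, hl⟩ := Nat.exists_eq_add_of_le (show m ≤ i + (n - j) by omega)
      rw [hl, Nat.add_sub_cancel_left, mul_pow]
      have : a ^ m * a ^ l * a ^ j = a ^ i * a ^ n := by
        rw [← pow_add, ← hl, ← pow_add, ← pow_add, add_assoc, Nat.sub_add_cancel hj]
      field_simp
      linear_combination -this)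
  have := hmin _ _ _ _ _ _ (hC.mul _ _ h) hP'
  rw [Nat.mul_succ] at this
  omega

theorem row (hC : CoordClass C) (hmin : MinSlope C n k e) (h : C a b)
    (hP : Pencil X0 n k e a b A B) : ∃ j, A (0, j) ≠ 0 ∨ B (0, j) ≠ 0 := by
  by_contra! hno
  obtain ⟨ha, hb⟩ := hC.ne_zero h
  have hpos : ∀ i j, A (i, j) ≠ 0 ∨ B (i, j) ≠ 0 → i ≠ 0 := by
    rintro i j hij rfl
    rcases hij with h | h
    · exact h (hno j).1
    · exact h (hno j).2
  obtain ⟨i₀, j₀, h₀⟩ := exists_supp hP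
  have h1 := hP.supp _ _ h₀
  have h2 := hpos _ _ h₀
  obtain ⟨hP', -⟩ := hP.mapDomain (n' := n) (k' := k) (e' := e - 1) (a' := a) (b' := b)
    (M := a) (fun ij => (ij.1 - 1, ij.2)) (by
      intro i j hij hj hie
      have h3 := hpos _ _ hij
      refine ⟨hj, by dsimp; omega, ?_⟩
      dsimp
      obtain ⟨i, rfl⟩ := Nat.exists_eq_succ_of_ne_zero h3
      rw [Nat.succ_sub_one, pow_succ]
      ring)
  have := hmin _ _ _ _ _ _ h hP'
  omega

theorem jac_eq_zero_elim (hC : CoordClass C) (h : C a b)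
    (hj : ∀ D₁ D₂ : Derivation ℂ K2 K2, D₁ X0 = 1 → D₁ X1 = 0 → D₂ X0 = 0 → D₂ X1 = 1 →
      jac D₁ D₂ a b = 0) : False := by
  obtain ⟨f, rfl, rfl⟩ := hC.gen _ _ h
  obtain ⟨D₁, h10, h11⟩ := K2.exists_dX0
  obtain ⟨D₂, h20, h21⟩ := K2.exists_dX1
  exact jac_ne_zero h10 h11 h21 (hj D₁ D₂ h10 h11 h20 h21)

theorem tameClass (hC : CoordClass C) {m : ℕ}
    (ht : ∀ a b A B, C a b → Pencil X0 n k e a b A B → Tame n m a b A B) :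
    TameClass X0 n k e m C where
  subX _ _ h γ := hC.sub _ _ h γ
  subY _ _ h γ := hC.swap _ _ (hC.sub _ _ (hC.swap _ _ h) γ)
  inv _ _ h := hC.inv _ _ (hC.div_pow h k)
  tame := ht

theorem pencil_swap (hP : Pencil X0 n 0 e a b A B) :
    ∃ A' B', Pencil X0 e 0 n b a A' B' := by
  refine ⟨_, _, (hP.mapDomain (M := 1) (fun ij => (ij.2, ij.1)) ?_).1⟩
  intro i j _ hj hie
  exact ⟨by dsimp; omega, by dsimp; omega, by dsimp; ring⟩

theorem not_minSlope (hC : CoordClass C) (hmin : MinDeg C n) (hn : 1 ≤ n)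
    (hslope : MinSlope C n k e) (h : C a b) (hP : Pencil X0 n k e a b A B) : False := by
  obtain ⟨i, hi⟩ := top hmin hn h hP
  have hen := (hP.supp _ _ hi).2
  by_cases hcase : n * (k + 2) ≤ 2 * e
  · refine hC.jac_eq_zero_elim h fun D₁ D₂ h10 h11 h20 h21 => ?_
    refine noether_fano (m := n / 2) (q := 2) (p := n) (hC.tameClass fun a b A B h hP => ?_)
      (by omega) (by omega) hcase hn h hP h10 h11 h20 h21
    exact ⟨hC.corner hslope h hP, hC.corner' hslope h hP, hC.row hslope h hP, top hmin hn h hP,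
      hC.bezout hmin hn h hP⟩
  push Not at hcase
  obtain rfl | rfl | hk : k = 0 ∨ k = 1 ∨ 2 ≤ k := by omega
  · obtain ⟨A', B', hP'⟩ := pencil_swap hP
    have := hmin _ _ _ _ _ _ _ (hC.swap _ _ h) hP'
    omega
  · refine hC.jac_eq_zero_elim h fun D₁ D₂ h10 h11 h20 h21 => ?_
    refine noether_fano (m := e - n) (q := 3) (p := e) (hC.tameClass fun a b A B h hP => ?_)
      (by omega) (by omega) (by omega) (by omega) h hP h10 h11 h20 h21
    refine ⟨?_, ?_, hC.row hslope h hP, top hmin hn h hP, hC.bezout hmin hn h hP⟩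
    · by_contra! hno
      obtain ⟨ha, hb⟩ := hC.ne_zero h
      obtain ⟨m, hm⟩ : ∃ m, m = e - n + 1 := ⟨_, rfl⟩
      obtain ⟨hP', -⟩ := hP.mapDomain (n' := n) (k' := 0) (e' := n - 1) (a' := a) (b' := b / a)
        (M := a ^ m) (fun ij => (ij.1 + ij.2 - m, ij.2)) (by
          intro i j hij hj hie
          have h3 := hno _ _ hij
          refine ⟨hj, by dsimp; omega, ?_⟩
          dsimp
          obtain ⟨l, hl⟩ := Nat.exists_eq_add_of_le (show m ≤ i + j by omega)
          rw [hl, Nat.add_sub_cancel_left, _root_.div_pow]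
          have : a ^ m * a ^ l = a ^ i * a ^ j := by rw [← pow_add, ← hl, pow_add]
          field_simp
          linear_combination -this)
      obtain ⟨A', B', hP''⟩ := pencil_swap hP'
      have := hmin _ _ _ _ _ _ _ (hC.swap _ _ (hC.div _ _ h)) hP''
      omega
    · obtain ⟨i, hi⟩ := top hmin hn h hP
      have := (hP.supp _ _ hi).2
      exact ⟨i, n, hi, by omega⟩
  · nlinarith

theorem minDeg_eq_zero (hC : CoordClass C) (hmin : MinDeg C n) (h : C a b)
    (hP : Pencil X0 n k e a b A B) : n = 0 := by
  by_contra hn0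
  have hn : 1 ≤ n := by omega
  classical
  have hle : ∀ a b k e A B, C a b → Pencil X0 n k e a b A B → n * k ≤ 2 * e := by
    intro a b k e A B h hP
    obtain ⟨i, hi⟩ := top hmin hn h hP
    have := (hP.supp _ _ hi).2
    rw [mul_comm]
    omega
  have hex : ∃ N, ∃ a b k e A B, C a b ∧ Pencil X0 n k e a b A B ∧ 2 * e = N + n * k :=
    ⟨2 * e - n * k, a, b, k, e, A, B, h, hP, by have := hle _ _ _ _ _ _ h hP; omega⟩
  obtain ⟨a₁, b₁, k₁, e₁, A₁, B₁, h₁, hP₁, hN⟩ := Nat.find_spec hex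
  refine hC.not_minSlope hmin hn (k := k₁) (e := e₁) ?_ h₁ hP₁
  intro a b k' e' A B h hP
  have h2 := hle _ _ _ _ _ _ h hP
  have := Nat.find_min' hex ⟨a, b, k', e', A, B, h, hP,
    show 2 * e' = (2 * e' - n * k') + n * k' by omega⟩
  omega

end CoordClass

theorem K2.exists_eq_ev_div (u : K2) :
    ∃ A B : (ℕ × ℕ) →₀ ℂ, ev X0 X1 B ≠ 0 ∧ u * ev X0 X1 B = ev X0 X1 A := by
  by_cases hu : u = 0
  · exact ⟨0, Finsupp.single (0, 0) 1, by simp [ev_apply], by simp [hu]⟩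
  obtain ⟨P, Q, hPQ⟩ := (IntermediateField.mem_adjoin_simple_iff LX u).1
    (LX.adjoin_X1 ▸ IntermediateField.mem_top)
  have hQ : aeval X1 Q ≠ 0 := by
    intro h0
    rw [h0, div_zero] at hPQ
    exact hu hPQ
  obtain ⟨d, A, B, hd, -, hA, hB⟩ := exists_finsupp_pair (P := P) (Q := Q)
    (n := P.natDegree + Q.natDegree + 1) (by omega) (by omega)
  have hd0 : aeval X0 d ≠ 0 := fun h0 => Cremona2.transcendental_X0 ⟨d, hd, h0⟩
  refine ⟨A, B, by rw [hB]; exact mul_ne_zero hd0 hQ, ?_⟩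
  rw [hA, hB, hPQ]
  field_simp

namespace Cremona2

theorem m_inv_X0 : (m⁻¹ : Cremona2) X0 = X0 := by
  apply m.injective
  rw [← AlgEquiv.mul_apply, mul_inv_cancel, AlgEquiv.one_apply, m_X0]

theorem m_inv_X1 : (m⁻¹ : Cremona2) X1 = X1 / X0 := by
  apply m.injective
  rw [← AlgEquiv.mul_apply, mul_inv_cancel, AlgEquiv.one_apply, map_div₀, m_X0, m_X1,
    mul_div_cancel_left₀ _ X0_ne_zero]

theorem coordClass (f : Cremona2) :
    CoordClass fun a b => ∃ h ∈ H, (f * h) X0 = a ∧ (f * h) X1 = b where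
  gen := by
    rintro a b ⟨h, -, h0, h1⟩
    exact ⟨f * h, h0, h1⟩
  sub := by
    rintro _ _ ⟨h, hh, rfl, rfl⟩ γ
    refine ⟨h * tx (-γ), mul_mem hh (tx_mem _), ?_, ?_⟩ <;> simp [sub_eq_add_neg]
  swap := by
    rintro _ _ ⟨h, hh, rfl, rfl⟩
    refine ⟨h * w, mul_mem hh w_mem, ?_, ?_⟩ <;> simp
  inv := by
    rintro _ _ ⟨h, hh, rfl, rfl⟩
    refine ⟨h * ix, mul_mem hh ix_mem, ?_, ?_⟩ <;> simp
  mul := by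
    rintro _ _ ⟨h, hh, rfl, rfl⟩
    refine ⟨h * m, mul_mem hh m_mem, ?_, ?_⟩ <;> simp [mul_comm]
  div := by
    rintro _ _ ⟨h, hh, rfl, rfl⟩
    refine ⟨h * m⁻¹, mul_mem hh (inv_mem m_mem), ?_, ?_⟩ <;> simp [m_inv_X0, m_inv_X1]

theorem exists_pencil (f : Cremona2) : ∃ n k e A B, Pencil X0 n k e (f X0) (f X1) A B := by
  obtain ⟨A, B, hB, h⟩ := K2.exists_eq_ev_div (f.symm X0)
  have hf : ∀ A, ev (f X0) (f X1) A = f (ev X0 X1 A) := fun A =>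
    (map_ev (f : K2 →ₐ[ℂ] K2) X0 X1 A).symm
  obtain ⟨n, e, hb⟩ := exists_bound A B
  refine ⟨n, 0, e, A, B, hb, ?_, ?_⟩
  · rw [hf, hf, ← h, map_mul, AlgEquiv.apply_symm_apply]
  · rw [hf]
    simpa using hB

/-- The Noether–Castelnuovo theorem. -/
theorem mem_H (f : Cremona2) : f ∈ H := by
  classical
  let C : K2 → K2 → Prop := fun a b => ∃ h ∈ H, (f * h) X0 = a ∧ (f * h) X1 = b
  have hC : CoordClass C := coordClass f
  obtain ⟨n₀, k₀, e₀, A₀, B₀, hP₀⟩ := exists_pencil f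
  have hex : ∃ n, ∃ a b k e A B, C a b ∧ Pencil X0 n k e a b A B :=
    ⟨n₀, _, _, k₀, e₀, A₀, B₀, ⟨1, one_mem _, by simp, by simp⟩, hP₀⟩
  obtain ⟨a, b, k, e, A, B, h, hP⟩ := Nat.find_spec hex
  have hmin : CoordClass.MinDeg C (Nat.find hex) := fun a b n' k e A B h hP =>
    Nat.find_min' hex ⟨a, b, k, e, A, B, h, hP⟩
  rw [hC.minDeg_eq_zero hmin h hP] at hP
  obtain ⟨h, hh, rfl, rfl⟩ := h
  set g := f * h with hg
  have hev : ∀ A : (ℕ × ℕ) →₀ ℂ, (∀ i j, A (i, j) ≠ 0 → j ≤ 0) → ev X0 X1 A ∈ LX := by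
    intro A hA
    rw [ev_apply]
    refine sum_mem fun ij hij => ?_
    dsimp only
    rw [Nat.le_zero.1 (hA ij.1 ij.2 (Finsupp.mem_support_iff.1 hij)), pow_zero, mul_one]
    exact mul_mem (LX.algebraMap_mem _)
      (pow_mem (IntermediateField.mem_adjoin_simple_self ℂ X0) _)
  have hf : ∀ A, ev (g X0) (g X1) A = g (ev X0 X1 A) := fun A =>
    (map_ev (g : K2 →ₐ[ℂ] K2) X0 X1 A).symm
  have hrel := hP.rel
  have hne := hP.ne_zero
  have hz : g (ev X0 X1 A / ev X0 X1 B) = X0 := by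
    rw [map_div₀, ← hf, ← hf, hrel]
    field_simp
  have hmem : ev X0 X1 A / ev X0 X1 B ∈ LX := div_mem
    (hev A fun i j h => (hP.supp i j (Or.inl h)).1) (hev B fun i j h => (hP.supp i j (Or.inr h)).1)
  have hinv : g⁻¹ ∈ H := by
    apply mem_H_of_X0_mem_LX
    rw [← hz, ← AlgEquiv.mul_apply, inv_mul_cancel, AlgEquiv.one_apply]
    exact hmem
  have hgH : g ∈ H := by simpa using inv_mem hinv
  have : f = g * h⁻¹ := by rw [hg]; group
  rw [this]
  exact mul_mem hgH (inv_mem hh)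

end Cremona2

end

instance K2.instCharZero : CharZero K2 :=
  charZero_of_injective_algebraMap (algebraMap ℂ K2).injective

section acl

variable {K : Type*} [Field K] [CharZero K]

/-- The set of elements algebraic over `ℚ(S)`. -/
def acl (S : Set K) : Set K := (AlgebraicIndependent.matroid ℚ K).closure S

theorem mem_acl {S : Set K} {u : K} : u ∈ acl S ↔ IsAlgebraic (Algebra.adjoin ℚ S) u := by
  rw [acl, AlgebraicIndependent.matroid_closure_eq]
  rfl

theorem subset_acl (S : Set K) : S ⊆ acl S := Matroid.subset_closure _ _

theorem acl_mono {S T : Set K} (h : S ⊆ T) : acl S ⊆ acl T := Matroid.closure_subset_closure _ h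

theorem acl_subset {S T : Set K} (h : S ⊆ acl T) : acl S ⊆ acl T :=
  Matroid.closure_subset_closure_of_subset_closure h

theorem acl_exchange {S : Set K} {p q : K} (h : p ∈ acl (insert q S)) (hp : p ∉ acl S) :
    q ∈ acl (insert p S) :=
  (Matroid.closure_exchange ⟨h, hp⟩).1

/-- `acl S` as a subfield. -/
def aclField (S : Set K) : Subfield K where
  carrier := acl S
  mul_mem' ha hb := mem_acl.2 ((mem_acl.1 ha).mul (mem_acl.1 hb))
  add_mem' ha hb := mem_acl.2 ((mem_acl.1 ha).add (mem_acl.1 hb))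
  neg_mem' ha := mem_acl.2 (mem_acl.1 ha).neg
  one_mem' := mem_acl.2 isAlgebraic_one
  zero_mem' := mem_acl.2 isAlgebraic_zero
  inv_mem' _ ha := mem_acl.2 (mem_acl.1 ha).inv

theorem map_mem_acl (f : K →+* K) {S T : Set K} (h : ∀ s ∈ S, f s ∈ acl T) {u : K}
    (hu : u ∈ acl S) : f u ∈ acl T := by
  have h1 : f u ∈ acl (f '' S) := by
    rw [mem_acl] at hu ⊢
    let g : K →ₐ[ℚ] K := f.toRatAlgHom
    have hmem : ∀ a : Algebra.adjoin ℚ S, g a ∈ Algebra.adjoin ℚ (f '' S) := by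
      intro a
      have h2 := Subalgebra.mem_map.2 ⟨(a : K), a.2, (rfl : g a = g a)⟩
      rw [AlgHom.map_adjoin] at h2
      exact h2
    let f₀ := (g.comp (Algebra.adjoin ℚ S).val).codRestrict _ hmem
    exact hu.ringHom_of_comp_eq (f₀ : _ →+* _) f
      (fun a b hab => Subtype.ext (f.injective (congrArg Subtype.val hab))) rfl
  refine acl_subset ?_ h1
  rintro _ ⟨s, hs, rfl⟩
  exact h s hs

theorem countable_acl {S : Set K} (hS : S.Countable) : (acl S).Countable := by
  have : Countable S := hS
  have h1 : Countable (Algebra.adjoin ℚ S) := by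
    have : Countable (MvPolynomial S ℚ) := by
      rw [← Cardinal.mk_le_aleph0_iff]
      refine MvPolynomial.cardinalMk_le_max_lift.trans ?_
      simp
    rw [Algebra.adjoin_eq_range]
    exact (Set.countable_range _).to_subtype
  have := Algebraic.countable (Algebra.adjoin ℚ S) K
  refine this.mono fun u hu => mem_acl.1 hu

end acl

section descent

variable {K : Type*} [Field K] {B : Set (K →+* K)} {F K₁ : Subfield K}

/-- Linear relations over a stable subfield between invariants descend to invariant relations. -/
theorem exists_invariant_relation (hF : ∀ u, u ∈ F ↔ ∀ b ∈ B, b u = u)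
    (hK : ∀ b ∈ B, ∀ u ∈ K₁, b u ∈ K₁) {ι : Type*} [DecidableEq ι] (s : Finset ι) (f : ι → K)
    (hf : ∀ i, f i ∈ F) (k : ι → K) (hk : ∀ i, k i ∈ K₁) (hrel : ∑ i ∈ s, k i * f i = 0)
    (hne : ∃ i ∈ s, k i ≠ 0) :
    ∃ c : ι → K, (∀ i, c i ∈ F ⊓ K₁) ∧ ∑ i ∈ s, c i * f i = 0 ∧ ∃ i ∈ s, c i ≠ 0 := by
  induction s using Finset.strongInduction generalizing k with
  | H s ih =>
    obtain ⟨i₀, hi₀, h0⟩ := hne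
    let k' : ι → K := fun i => k i / k i₀
    have hk' : ∀ i, k' i ∈ K₁ := fun i => div_mem (hk i) (hk i₀)
    have hrel' : ∑ i ∈ s, k' i * f i = 0 := by
      have : ∀ i, k' i * f i = (k i * f i) / k i₀ := fun i => by simp only [k']; ring
      rw [Finset.sum_congr rfl fun i _ => this i, ← Finset.sum_div, hrel, zero_div]
    have h1 : k' i₀ = 1 := div_self h0
    by_cases hall : ∀ i ∈ s, ∀ b ∈ B, b (k' i) = k' i
    · refine ⟨fun i => if i ∈ s then k' i else 0, fun i => ?_, ?_, i₀, hi₀, ?_⟩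
      · dsimp only
        split_ifs with hi
        · exact ⟨(hF _).2 (hall i hi), hk' i⟩
        · exact zero_mem _
      · rw [← hrel']
        exact Finset.sum_congr rfl fun i hi => by simp only [if_pos hi]
      · simp only [if_pos hi₀, h1]
        exact one_ne_zero
    push Not at hall
    obtain ⟨i₁, hi₁, b, hb, hne⟩ := hall
    have hbrel : ∑ i ∈ s, b (k' i) * f i = 0 := by
      have := congrArg b hrel'
      rw [map_sum, map_zero] at this
      rw [← this]
      exact Finset.sum_congr rfl fun i _ => by rw [map_mul, (hF _).1 (hf i) b hb]
    have hdiff : ∑ i ∈ s, (b (k' i) - k' i) * f i = 0 := by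
      simp_rw [sub_mul]
      rw [Finset.sum_sub_distrib, hbrel, hrel', sub_zero]
    have hz : b (k' i₀) - k' i₀ = 0 := by rw [h1, map_one, sub_self]
    rw [← Finset.add_sum_erase s _ hi₀, hz, zero_mul, zero_add] at hdiff
    obtain ⟨c, hc, hc0, i₂, hi₂, hci⟩ := ih (s.erase i₀) (Finset.erase_ssubset hi₀)
      (fun i => b (k' i) - k' i) (fun i => sub_mem (hK b hb _ (hk' i)) (hk' i)) hdiff
      ⟨i₁, Finset.mem_erase.2 ⟨fun h => hne (by rw [h, h1, map_one]), hi₁⟩, sub_ne_zero.2 hne⟩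
    refine ⟨fun i => if i = i₀ then 0 else c i, fun i => ?_, ?_, i₂,
      Finset.mem_of_mem_erase hi₂, ?_⟩
    · dsimp only
      split_ifs
      · exact zero_mem _
      · exact hc i
    · rw [← Finset.add_sum_erase s _ hi₀]
      simp only [if_pos, zero_mul, zero_add]
      refine Eq.trans ?_ hc0
      exact Finset.sum_congr rfl fun i hi => by rw [if_neg (Finset.ne_of_mem_erase hi)]
    · simpa only [if_neg (Finset.ne_of_mem_erase hi₂)]

/-- An element of `K₁` that is a quotient of `F`-combinations of elements of `E` lies in `E`. -/
theorem mem_of_quotient (hF : ∀ u, u ∈ F ↔ ∀ b ∈ B, b u = u)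
    (hK : ∀ b ∈ B, ∀ u ∈ K₁, b u ∈ K₁) {E : Subfield K} (hE : E ≤ K₁) (hFE : F ⊓ K₁ ≤ E)
    {u : K} (hu : u ∈ K₁) {ι : Type*} (s : Finset ι) (f e e' : ι → K)
    (hf : ∀ i, f i ∈ F) (he : ∀ i, e i ∈ E) (he' : ∀ i, e' i ∈ E)
    (hrel : u * ∑ i ∈ s, f i * e' i = ∑ i ∈ s, f i * e i) (hne : ∑ i ∈ s, f i * e' i ≠ 0) :
    u ∈ E := by
  classical
  induction s using Finset.strongInduction generalizing e e' with
  | H s ih =>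
    by_cases hall : ∀ i ∈ s, u * e' i - e i = 0
    · obtain ⟨i, hi, h0⟩ := Finset.exists_ne_zero_of_sum_ne_zero hne
      have h1 : e' i ≠ 0 := right_ne_zero_of_mul h0
      rw [eq_div_of_mul_eq h1 (sub_eq_zero.1 (hall i hi))]
      exact div_mem (he i) (he' i)
    push Not at hall
    have hrel' : ∑ i ∈ s, (u * e' i - e i) * f i = 0 := by
      rw [← sub_eq_zero.2 hrel, Finset.mul_sum, ← Finset.sum_sub_distrib]
      exact Finset.sum_congr rfl fun i _ => by ring
    obtain ⟨c, hc, hc0, i₀, hi₀, hci⟩ := exists_invariant_relation hF hK s f hf _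
      (fun i => sub_mem (mul_mem hu (hE (he' i))) (hE (he i))) hrel' hall
    have key : ∀ e : ι → K, ∑ i ∈ s, f i * e i =
        ∑ i ∈ s.erase i₀, f i * (e i - c i / c i₀ * e i₀) := by
      intro e
      have h1 : ∑ i ∈ s, f i * (e i - c i / c i₀ * e i₀) = ∑ i ∈ s, f i * e i := by
        have : ∀ i, f i * (e i - c i / c i₀ * e i₀) = f i * e i - (c i * f i) * (e i₀ / c i₀) :=
          fun i => by ring
        rw [Finset.sum_congr rfl fun i _ => this i, Finset.sum_sub_distrib, ← Finset.sum_mul, hc0,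
          zero_mul, sub_zero]
      rw [← h1, ← Finset.add_sum_erase s _ hi₀, div_self hci, one_mul, sub_self, mul_zero, zero_add]
    have hmem : ∀ e : ι → K, (∀ i, e i ∈ E) → ∀ i, e i - c i / c i₀ * e i₀ ∈ E := fun e he i =>
      sub_mem (he i) (mul_mem (div_mem (hFE (hc i)) (hFE (hc i₀))) (he i₀))
    rw [key e, key e'] at hrel
    rw [key e'] at hne
    exact ih _ (Finset.erase_ssubset hi₀) _ _ (hmem e he) (hmem e' he') hrel hne

end descent

theorem K2.exists_countable_coeffs (u : K2) :
    ∃ k : Set ℂ, k.Countable ∧ u ∈ Subfield.closure (cst '' k ∪ {X0, X1}) := by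
  obtain ⟨A, B, hB, h⟩ := K2.exists_eq_ev_div u
  refine ⟨A '' A.support ∪ B '' B.support, ?_, ?_⟩
  · exact ((Finset.countable_toSet _).image _).union ((Finset.countable_toSet _).image _)
  have key : ∀ (A : (ℕ × ℕ) →₀ ℂ) (k : Set ℂ), A '' A.support ⊆ k →
      ev X0 X1 A ∈ Subfield.closure (cst '' k ∪ {X0, X1}) := by
    intro A k hk
    rw [ev_apply]
    refine sum_mem fun ij hij => ?_
    refine mul_mem (Subfield.subset_closure (Or.inl ⟨_, hk ⟨ij, hij, rfl⟩, rfl⟩)) (mul_mem ?_ ?_)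
    · exact pow_mem (Subfield.subset_closure (by simp)) _
    · exact pow_mem (Subfield.subset_closure (by simp)) _
  rw [eq_div_of_mul_eq hB h]
  exact div_mem (key _ _ Set.subset_union_left) (key _ _ Set.subset_union_right)

namespace Cremona2

/-- The coordinates together with a set of constants. -/
def base (k : Set ℂ) : Set K2 := cst '' k ∪ {X0, X1}

theorem base_countable {k : Set ℂ} (hk : k.Countable) : (base k).Countable :=
  (hk.image _).union (Set.to_countable _)

theorem exists_base {Γ : Set Cremona2} (hΓ : Γ.Countable) :
    ∃ k : Set ℂ, k.Countable ∧ ∀ g ∈ Γ, g X0 ∈ acl (base k) ∧ g X1 ∈ acl (base k) := by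
  choose k hk hmem using K2.exists_countable_coeffs
  refine ⟨⋃ g ∈ Γ, k (g X0) ∪ k (g X1), hΓ.biUnion fun g _ => (hk _).union (hk _), fun g hg => ?_⟩
  have key : ∀ u, k u ⊆ (⋃ g ∈ Γ, k (g X0) ∪ k (g X1)) →
      u ∈ acl (base (⋃ g ∈ Γ, k (g X0) ∪ k (g X1))) := by
    intro u hu
    have : Subfield.closure (cst '' k u ∪ {X0, X1}) ≤
        aclField (base (⋃ g ∈ Γ, k (g X0) ∪ k (g X1))) := by
      rw [Subfield.closure_le]
      refine Set.Subset.trans ?_ (subset_acl _)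
      exact Set.union_subset_union_left _ (Set.image_mono hu)
    exact this (hmem u)
  have h2 := Set.subset_biUnion_of_mem (u := fun g : Cremona2 => k (g X0) ∪ k (g X1)) hg
  exact ⟨key _ (Set.subset_union_left.trans h2), key _ (Set.subset_union_right.trans h2)⟩

theorem exists_notMem {ι : Type*} [Uncountable ι] {g : ι → Cremona2} (hg : Function.Injective g)
    {S : Set K2} (hS : S.Countable) : ∃ i, ∃ p ∈ ({X0, X1} : Set K2), g i p ∉ S := by
  by_contra! h
  have := hS.to_subtype
  have hinj : Function.Injective fun i =>
      ((⟨g i X0, h i _ (by simp)⟩, ⟨g i X1, h i _ (by simp)⟩) : S × S) := by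
    intro i j hij
    simp only [Prod.mk.injEq, Subtype.mk.injEq] at hij
    exact hg (ext_gens hij.1 hij.2)
  exact not_countable hinj.countable

/-- The automorphisms commuting with `B` and fixing `F` pointwise. -/
def central (B : Set Cremona2) (F : Subfield K2) : Subgroup Cremona2 where
  carrier := {z | (∀ b ∈ B, z * b = b * z) ∧ ∀ u ∈ F, z u = u}
  one_mem' := ⟨by simp, by simp⟩
  mul_mem' := by
    rintro z z' ⟨h1, h2⟩ ⟨h1', h2'⟩
    refine ⟨fun b hb => ?_, fun u hu => ?_⟩
    · rw [mul_assoc, h1' b hb, ← mul_assoc, h1 b hb, mul_assoc]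
    · rw [AlgEquiv.mul_apply, h2' u hu, h2 u hu]
  inv_mem' := by
    rintro z ⟨h1, h2⟩
    refine ⟨fun b hb => ?_, fun u hu => ?_⟩
    · rw [inv_mul_eq_iff_eq_mul, ← mul_assoc, h1 b hb, mul_assoc, mul_inv_cancel, mul_one]
    · apply z.injective
      rw [← AlgEquiv.mul_apply, mul_inv_cancel, AlgEquiv.one_apply, h2 u hu]

variable {B : Set Cremona2} {F : Subfield K2} {k : Set ℂ} {X Y : Set K2} {z : Cremona2}

/-- The invariants algebraic over the coordinates and their images under `z`. -/
def traces (F : Subfield K2) (k : Set ℂ) (z : Cremona2) : Set K2 :=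
  {u | u ∈ F ∧ u ∈ acl (base k ∪ {z X0, z X1})}

theorem traces_subset : traces F k z ⊆ F := fun _ h => h.1

theorem apply_mem_acl {T : Set K2} (hbase : cst '' k ⊆ T) (h0 : z X0 ∈ acl T) (h1 : z X1 ∈ acl T)
    {u : K2} (hu : u ∈ acl (base k)) : z u ∈ acl T := by
  refine map_mem_acl (z : K2 →+* K2) ?_ hu
  rintro _ (⟨c, hc, rfl⟩ | rfl | rfl)
  · simpa using subset_acl _ (hbase ⟨c, hc, rfl⟩)
  · exact h0
  · exact h1

/-- Descent: `z` maps the coordinates into the field generated by them and invariants. -/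
theorem descent (hF : ∀ u, u ∈ F ↔ ∀ b ∈ B, b u = u)
    (hB : ∀ b ∈ B, b X0 ∈ acl (base k) ∧ b X1 ∈ acl (base k)) (hz : z ∈ central B F)
    {u : K2} (hu : u ∈ acl (base k)) : z u ∈ acl (base k ∪ traces F k z) := by
  set K₁ : Subfield K2 := Subfield.closure (acl (base k) ∪ z '' acl (base k)) with hK₁
  have hbase : cst '' k ⊆ base k := Set.subset_union_left
  have hb0 : ∀ b ∈ B, ∀ v ∈ acl (base k), b v ∈ acl (base k) := fun b hb v hv =>
    apply_mem_acl hbase (hB b hb).1 (hB b hb).2 hv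
  have hstab : ∀ b ∈ ((fun b : Cremona2 => (b : K2 →+* K2)) '' B), ∀ u ∈ K₁, b u ∈ K₁ := by
    rintro _ ⟨b, hb, rfl⟩ u hu
    have : K₁ ≤ K₁.comap (b : K2 →+* K2) := by
      rw [hK₁, Subfield.closure_le]
      rintro v (hv | ⟨v, hv, rfl⟩)
      · exact Subfield.subset_closure (Or.inl (hb0 b hb v hv))
      · refine Subfield.subset_closure (Or.inr ⟨b v, hb0 b hb v hv, ?_⟩)
        exact DFunLike.congr_fun (hz.1 b hb) v
    exact this hu
  have hF' : ∀ u, u ∈ F ↔ ∀ b ∈ ((fun b : Cremona2 => (b : K2 →+* K2)) '' B), b u = u := by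
    intro u
    rw [hF]
    simp
  set E : Subfield K2 := Subfield.closure (acl (base k) ∪ (F ⊓ K₁ : Subfield K2)) with hE
  have hcF : ∀ c : ℂ, cst c ∈ F := fun c => (hF _).2 fun b _ => b.commutes c
  have hKacl : K₁ ≤ aclField (base k ∪ {z X0, z X1}) := by
    rw [hK₁, Subfield.closure_le]
    rintro v (hv | ⟨v, hv, rfl⟩)
    · exact acl_mono Set.subset_union_left hv
    · exact apply_mem_acl (hbase.trans Set.subset_union_left) (subset_acl _ (by simp))
        (subset_acl _ (by simp)) hv
  have hEacl : E ≤ aclField (base k ∪ traces F k z) := by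
    rw [hE, Subfield.closure_le]
    rintro v (hv | ⟨hv, hv'⟩)
    · exact acl_mono Set.subset_union_left hv
    · exact subset_acl _ (Or.inr ⟨hv, hKacl hv'⟩)
  obtain ⟨P, Q, hQ, h⟩ := K2.exists_eq_ev_div (z u)
  have hmon : ∀ i j : ℕ, X0 ^ i * X1 ^ j ∈ E := fun i j => by
    have h0 : X0 ∈ E := Subfield.subset_closure (Or.inl (subset_acl _ (by simp [base])))
    have h1 : X1 ∈ E := Subfield.subset_closure (Or.inl (subset_acl _ (by simp [base])))
    exact mul_mem (pow_mem h0 _) (pow_mem h1 _)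
  refine hEacl (mem_of_quotient hF' hstab (E := E) ?_ ?_ ?_ (P.support.disjSum Q.support)
    (Sum.elim (fun ij => cst (P ij)) (fun ij => cst (Q ij)))
    (Sum.elim (fun ij => X0 ^ ij.1 * X1 ^ ij.2) 0)
    (Sum.elim 0 (fun ij => X0 ^ ij.1 * X1 ^ ij.2)) ?_ ?_ ?_ ?_ ?_)
  · rw [hE, Subfield.closure_le]
    rintro v (hv | hv)
    · exact Subfield.subset_closure (Or.inl hv)
    · exact hv.2
  · exact fun v hv => Subfield.subset_closure (Or.inr hv)
  · exact Subfield.subset_closure (Or.inr ⟨u, hu, rfl⟩)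
  · rintro (ij | ij)
    · exact hcF _
    · exact hcF _
  · rintro (ij | ij)
    · exact hmon _ _
    · exact zero_mem _
  · rintro (ij | ij)
    · exact zero_mem _
    · exact hmon _ _
  · simpa [Finset.sum_disjSum, ev_apply, Finsupp.sum] using h
  · simpa [Finset.sum_disjSum, ev_apply, Finsupp.sum] using hQ

/-- The central automorphisms preserving the closure of the coordinates and `X`. -/
def stab (hF : ∀ u, u ∈ F ↔ ∀ b ∈ B, b u = u)
    (hB : ∀ b ∈ B, b X0 ∈ acl (base k) ∧ b X1 ∈ acl (base k)) (hX : X ⊆ F) :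
    Subgroup Cremona2 where
  carrier := {z | z ∈ central B F ∧ z X0 ∈ acl (base k ∪ X) ∧ z X1 ∈ acl (base k ∪ X)}
  one_mem' := ⟨one_mem _, subset_acl _ (by simp [base]), subset_acl _ (by simp [base])⟩
  mul_mem' := by
    rintro z z' ⟨hz, h0, h1⟩ ⟨hz', h0', h1'⟩
    have key : ∀ u ∈ acl (base k ∪ X), z u ∈ acl (base k ∪ X) := fun u hu => by
      refine map_mem_acl (z : K2 →+* K2) ?_ hu
      rintro s (hs | hs)
      · refine apply_mem_acl ?_ h0 h1 (subset_acl _ hs)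
        exact Set.subset_union_left.trans Set.subset_union_left
      · have : (z : K2 →+* K2) s = s := hz.2 s (hX hs)
        rw [this]
        exact subset_acl _ (Or.inr hs)
    exact ⟨mul_mem hz hz', key _ h0', key _ h1'⟩
  inv_mem' := by
    rintro z ⟨hz, h0, h1⟩
    have hsub : acl (base k ∪ traces F k z⁻¹) ⊆ acl (base k ∪ X) := by
      refine acl_subset ?_
      rintro u (hu | ⟨hu, hu'⟩)
      · exact subset_acl _ (Or.inl hu)
      · rw [← hz.2 u hu]
        refine map_mem_acl (z : K2 →+* K2) ?_ hu'
        rintro s (hs | rfl | rfl)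
        · refine apply_mem_acl ?_ h0 h1 (subset_acl _ hs)
          exact Set.subset_union_left.trans Set.subset_union_left
        · have : z (z⁻¹ X0) = X0 := by
            rw [← AlgEquiv.mul_apply, mul_inv_cancel, AlgEquiv.one_apply]
          exact this ▸ subset_acl _ (by simp [base])
        · have : z (z⁻¹ X1) = X1 := by
            rw [← AlgEquiv.mul_apply, mul_inv_cancel, AlgEquiv.one_apply]
          exact this ▸ subset_acl _ (by simp [base])
    have hz' := inv_mem hz
    exact ⟨hz', hsub (descent hF hB hz' (subset_acl _ (by simp [base]))),
      hsub (descent hF hB hz' (subset_acl _ (by simp [base])))⟩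

end Cremona2

theorem exists_mem_acl_pair {K : Type*} [Field K] [CharZero K] {S : Set K} {a b p : K}
    (h : p ∈ acl (S ∪ {a, b})) (hp : p ∉ acl S) :
    ∃ q ∈ ({a, b} : Set K), ({a, b} : Set K) ⊆ acl (insert p (insert q S)) := by
  have key : ∀ u v : K, p ∈ acl (insert u S) → v ∈ acl (insert p (insert v S)) ∧
      u ∈ acl (insert p (insert v S)) := fun u v hu =>
    ⟨subset_acl _ (by simp), acl_mono (by gcongr; simp) (acl_exchange hu hp)⟩
  by_cases ha : p ∈ acl (insert a S)
  · refine ⟨b, by simp, ?_⟩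
    rintro _ (rfl | rfl)
    · exact (key _ _ ha).2
    · exact (key _ _ ha).1
  · refine ⟨a, by simp, ?_⟩
    have h' : p ∈ acl (insert b (insert a S)) := by
      convert h using 2
      ext; simp; tauto
    rintro _ (rfl | rfl)
    · exact subset_acl _ (by simp)
    · exact acl_exchange h' ha

namespace Cremona2

variable {B : Set Cremona2} {F : Subfield K2} {k : Set ℂ} {X Y : Set K2} {z : Cremona2}

theorem mem_stab_of_traces (hF : ∀ u, u ∈ F ↔ ∀ b ∈ B, b u = u)
    (hB : ∀ b ∈ B, b X0 ∈ acl (base k) ∧ b X1 ∈ acl (base k)) (hX : X ⊆ F)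
    (hz : z ∈ central B F) (h : traces F k z ⊆ X) : z ∈ stab hF hB hX :=
  ⟨hz, acl_mono (by gcongr) (descent hF hB hz (subset_acl _ (by simp [base]))),
    acl_mono (by gcongr) (descent hF hB hz (subset_acl _ (by simp [base])))⟩

theorem mem_stab_of_base (hF : ∀ u, u ∈ F ↔ ∀ b ∈ B, b u = u)
    (hB : ∀ b ∈ B, b X0 ∈ acl (base k) ∧ b X1 ∈ acl (base k)) (hX : X ⊆ F)
    (hz : z ∈ central B F) (h : z X0 ∈ acl (base k) ∧ z X1 ∈ acl (base k)) :
    z ∈ stab hF hB hX :=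
  ⟨hz, acl_mono Set.subset_union_left h.1, acl_mono Set.subset_union_left h.2⟩

theorem stab_apply_mem (hF : ∀ u, u ∈ F ↔ ∀ b ∈ B, b u = u)
    (hB : ∀ b ∈ B, b X0 ∈ acl (base k) ∧ b X1 ∈ acl (base k)) (hX : X ⊆ F)
    (hz : z ∈ stab hF hB hX) {p : K2} (hp : p ∈ ({X0, X1} : Set K2)) :
    z p ∈ acl (base k ∪ X) := by
  obtain rfl | rfl := hp
  · exact hz.2.1
  · exact hz.2.2

theorem traces_subset_acl : base k ∪ traces F k z ⊆ acl (base k ∪ {z X0, z X1}) :=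
  Set.union_subset (Set.subset_union_left.trans (subset_acl _)) fun _ h => h.2

/-- There are no three independent families of automorphisms commuting with `B` and fixing its
invariants. -/
theorem rank_lt_three (hBc : B.Countable) (hF : ∀ u, u ∈ F ↔ ∀ b ∈ B, b u = u)
    {c₁ c₂ : Cremona2} (hc₁ : c₁ ∈ central B F) (hc₂ : c₂ ∈ central B F)
    {ι₁ ι₂ ι₃ : Type*} [Uncountable ι₁] [Uncountable ι₂] [Uncountable ι₃]
    {z₁ : ι₁ → Cremona2} {z₂ : ι₂ → Cremona2} {z₃ : ι₃ → Cremona2}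
    (hz₁ : ∀ i, z₁ i ∈ central B F) (hz₂ : ∀ i, z₂ i ∈ central B F)
    (hz₃ : ∀ i, z₃ i ∈ central B F)
    (h₁ : Function.Injective fun i => z₁ i * c₁ * (z₁ i)⁻¹)
    (h₂ : Function.Injective fun i => z₂ i * c₂ * (z₂ i)⁻¹)
    (h₂₁ : ∀ i, z₂ i * c₁ = c₁ * z₂ i)
    (h₃ : Function.Injective z₃) (h₃₁ : ∀ i, z₃ i * c₁ = c₁ * z₃ i)
    (h₃₂ : ∀ i, z₃ i * c₂ = c₂ * z₃ i) : False := by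
  obtain ⟨k, hk, hΓ⟩ := exists_base (Γ := B ∪ {c₁, c₂}) (hBc.union (Set.to_countable _))
  have hB : ∀ b ∈ B, b X0 ∈ acl (base k) ∧ b X1 ∈ acl (base k) := fun b hb => hΓ b (Or.inl hb)
  have hc₁s : ∀ {X : Set K2} (hX : X ⊆ F), c₁ ∈ stab hF hB hX := fun hX =>
    mem_stab_of_base hF hB hX hc₁ (hΓ c₁ (by simp))
  have hc₂s : ∀ {X : Set K2} (hX : X ⊆ F), c₂ ∈ stab hF hB hX := fun hX =>
    mem_stab_of_base hF hB hX hc₂ (hΓ c₂ (by simp))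
  have hbk := base_countable hk
  obtain ⟨i, p₀, hp₀, hp⟩ := exists_notMem h₁ (countable_acl hbk)
  set X₁ := traces F k (z₁ i)
  have hX₁ : X₁ ⊆ F := traces_subset
  have hpX₁ : (z₁ i * c₁ * (z₁ i)⁻¹) p₀ ∈ acl (base k ∪ X₁) := by
    have hz : z₁ i ∈ stab hF hB hX₁ := mem_stab_of_traces hF hB hX₁ (hz₁ i) subset_rfl
    exact stab_apply_mem hF hB hX₁ (mul_mem (mul_mem hz (hc₁s hX₁)) (inv_mem hz)) hp₀
  set p := (z₁ i * c₁ * (z₁ i)⁻¹) p₀ with hpdef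
  have hS₁ : (acl (base k ∪ X₁)).Countable :=
    (countable_acl (hbk.union (Set.to_countable {z₁ i X0, z₁ i X1}))).mono
      (acl_subset traces_subset_acl)
  obtain ⟨j, p₀', hp₀', hp'⟩ := exists_notMem h₂ hS₁
  set X₂ := X₁ ∪ traces F k (z₂ j) with hX₂def
  have hX₂ : X₂ ⊆ F := Set.union_subset hX₁ traces_subset
  have hzj : z₂ j ∈ stab hF hB hX₂ :=
    mem_stab_of_traces hF hB hX₂ (hz₂ j) Set.subset_union_right
  have hzi : z₁ i ∈ stab hF hB hX₂ :=
    mem_stab_of_traces hF hB hX₂ (hz₁ i) Set.subset_union_left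
  have hp'X₂ : (z₂ j * c₂ * (z₂ j)⁻¹) p₀' ∈ acl (base k ∪ X₂) :=
    stab_apply_mem hF hB hX₂ (mul_mem (mul_mem hzj (hc₂s hX₂)) (inv_mem hzj)) hp₀'
  have hS₂ : (acl (base k ∪ X₂)).Countable := by
    refine Set.Countable.mono (acl_subset ?_) (countable_acl (hS₁.union
      (countable_acl (hbk.union (Set.to_countable {z₂ j X0, z₂ j X1})))))
    have e : base k ∪ X₂ = (base k ∪ X₁) ∪ (base k ∪ traces F k (z₂ j)) := by
      rw [hX₂def]; ext; simp; tauto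
    rw [e]
    exact Set.Subset.trans (Set.union_subset_union (subset_acl _) traces_subset_acl) (subset_acl _)
  obtain ⟨l, p₀'', hp₀'', hp''⟩ := exists_notMem h₃ hS₂
  set z := z₁ i * z₂ j * z₃ l with hzdef
  have hz : z ∈ central B F := mul_mem (mul_mem (hz₁ i) (hz₂ j)) (hz₃ l)
  have hw₁ : z * c₁ * z⁻¹ = z₁ i * c₁ * (z₁ i)⁻¹ := by
    have a := h₂₁ j
    have b := h₃₁ l
    rw [← mul_inv_eq_iff_eq_mul] at a b
    rw [hzdef]
    calc _ = z₁ i * (z₂ j * (z₃ l * c₁ * (z₃ l)⁻¹) * (z₂ j)⁻¹) * (z₁ i)⁻¹ := by group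
      _ = _ := by rw [b, a]
  have hw₂ : (z₂ j * z₃ l) * c₂ * (z₂ j * z₃ l)⁻¹ = z₂ j * c₂ * (z₂ j)⁻¹ := by
    have b := h₃₂ l
    rw [← mul_inv_eq_iff_eq_mul] at b
    calc _ = z₂ j * (z₃ l * c₂ * (z₃ l)⁻¹) * (z₂ j)⁻¹ := by group
      _ = _ := by rw [b]
  set Xz := traces F k z with hXzdef
  have hXz : Xz ⊆ F := traces_subset
  have hpXz : p ∈ acl (base k ∪ Xz) := by
    have hz' : z ∈ stab hF hB hXz := mem_stab_of_traces hF hB hXz hz subset_rfl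
    rw [hpdef, ← hw₁]
    exact stab_apply_mem hF hB hXz (mul_mem (mul_mem hz' (hc₁s hXz)) (inv_mem hz')) hp₀
  obtain ⟨q, hq, hsub⟩ := exists_mem_acl_pair (acl_subset traces_subset_acl hpXz) hp
  set X' := X₁ ∪ Xz with hX'def
  have hX' : X' ⊆ F := Set.union_subset hX₁ hXz
  have hz' : z ∈ stab hF hB hX' := mem_stab_of_traces hF hB hX' hz Set.subset_union_right
  have hzi' : z₁ i ∈ stab hF hB hX' :=
    mem_stab_of_traces hF hB hX' (hz₁ i) Set.subset_union_left
  have h23 : z₂ j * z₃ l ∈ stab hF hB hX' := by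
    have := mul_mem (inv_mem hzi') hz'
    rwa [hzdef, mul_assoc, inv_mul_cancel_left] at this
  have hpX : (z₂ j * c₂ * (z₂ j)⁻¹) p₀' ∈ acl (base k ∪ X') := by
    rw [← hw₂]
    exact stab_apply_mem hF hB hX' (mul_mem (mul_mem h23 (hc₂s hX')) (inv_mem h23)) hp₀'
  have hX'sub : base k ∪ X' ⊆ acl (insert q (base k ∪ X₁)) := by
    have hpq : insert p (insert q (base k)) ⊆ acl (insert q (base k ∪ X₁)) := by
      rintro u (rfl | rfl | hu)
      · exact acl_mono (Set.subset_insert _ _) hpX₁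
      · exact subset_acl _ (by simp)
      · exact subset_acl _ (by simp [hu])
    rintro u (hu | hu | hu)
    · exact subset_acl _ (by simp [hu])
    · exact subset_acl _ (by simp [hu])
    · refine acl_subset ?_ (traces_subset_acl (Or.inr hu))
      refine Set.union_subset ?_ (hsub.trans (acl_subset hpq))
      exact fun v hv => hpq (by simp [hv])
  have hqX₂ : q ∈ acl (base k ∪ X₂) := by
    have h := acl_exchange (acl_subset hX'sub hpX) hp'
    refine acl_subset ?_ h
    refine Set.insert_subset hp'X₂ ?_
    refine Set.Subset.trans ?_ (subset_acl _)
    exact Set.union_subset_union_right _ Set.subset_union_left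
  have hzX₂ : z ∈ stab hF hB hX₂ := by
    have : ({z X0, z X1} : Set K2) ⊆ acl (base k ∪ X₂) := by
      refine hsub.trans (acl_subset ?_)
      rintro u (rfl | rfl | hu)
      · refine acl_mono ?_ hpX₁
        exact Set.union_subset_union_right _ Set.subset_union_left
      · exact hqX₂
      · exact subset_acl _ (Or.inl hu)
    exact ⟨hz, this (by simp), this (by simp)⟩
  apply hp''
  refine stab_apply_mem hF hB hX₂ ?_ hp₀''
  have := mul_mem (inv_mem (mul_mem hzi hzj)) hzX₂
  rwa [hzdef, inv_mul_cancel_left] at this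

end Cremona2

theorem X0_add_ne_zero {a : ℂ} : X0 + cst a ≠ 0 := by
  intro h
  apply Cremona2.transcendental_X0
  rw [eq_neg_of_add_eq_zero_left h]
  exact (isAlgebraic_algebraMap a).neg

namespace Cremona2

@[simp] theorem m_symm_X0 : m.symm X0 = X0 := m_inv_X0
@[simp] theorem m_symm_X1 : m.symm X1 = X1 / X0 := m_inv_X1

theorem commute_of_gens {f g : Cremona2} (h0 : f (g X0) = g (f X0)) (h1 : f (g X1) = g (f X1)) :
    Commute f g := ext_gens h0 h1

theorem tx_mul_tx (a b : ℂ) : tx a * tx b = tx (a + b) :=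
  ext_gens (by simp; ring) (by simp)

theorem tx_zero : tx 0 = 1 := ext_gens (by simp) (by simp)

theorem tx_inv (a : ℂ) : (tx a)⁻¹ = tx (-a) :=
  inv_eq_of_mul_eq_one_right (by rw [tx_mul_tx, add_neg_cancel, tx_zero])

theorem dx_mul_dx (l l' : ℂˣ) : dx l * dx l' = dx (l * l') :=
  ext_gens (by simp; ring) (by simp)

theorem dx_mul_tx (l : ℂˣ) (a : ℂ) : dx l * tx (l * a) = tx a * dx l :=
  ext_gens (by simp; ring) (by simp)

theorem ix_mul_dx (l : ℂˣ) : ix * dx l = dx l⁻¹ * ix :=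
  ext_gens (by simp; ring) (by simp)

theorem ty_mul_ty (a b : ℂ) : ty a * ty b = ty (a + b) :=
  ext_gens (by simp) (by simp; ring)

theorem w_mul_ty (a : ℂ) : w * ty a = tx a * w := ext_gens (by simp) (by simp)
theorem w_mul_tx (a : ℂ) : w * tx a = ty a * w := ext_gens (by simp) (by simp)
theorem w_mul_dx (l : ℂˣ) : w * dx l = dy l * w := ext_gens (by simp) (by simp)
theorem w_mul_dy (l : ℂˣ) : w * dy l = dx l * w := ext_gens (by simp) (by simp)

theorem dy_mul_ty (l : ℂˣ) (a : ℂ) : dy l * ty (l * a) = ty a * dy l :=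
  ext_gens (by simp) (by simp; ring)

theorem tx_comm_ty (a b : ℂ) : Commute (tx a) (ty b) := commute_of_gens (by simp) (by simp)
theorem tx_comm_dy (a : ℂ) (l : ℂˣ) : Commute (tx a) (dy l) := commute_of_gens (by simp) (by simp)
theorem tx_comm_iy (a : ℂ) : Commute (tx a) iy := commute_of_gens (by simp) (by simp)
theorem dx_comm_ty (l : ℂˣ) (a : ℂ) : Commute (dx l) (ty a) := commute_of_gens (by simp) (by simp)
theorem dx_comm_dy (l l' : ℂˣ) : Commute (dx l) (dy l') := commute_of_gens (by simp) (by simp)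
theorem dx_comm_iy (l : ℂˣ) : Commute (dx l) iy := commute_of_gens (by simp) (by simp)
theorem ix_comm_ty (a : ℂ) : Commute ix (ty a) := commute_of_gens (by simp) (by simp)

/-- The inversion up to sign as a product of unipotents. -/
theorem tx_ix_word (a : ℂˣ) : tx a * (ix * tx (-(a : ℂ)⁻¹) * ix) * tx a = ix * dx (-a ^ 2) := by
  have ha : cst (a : ℂ) ≠ 0 := by simp
  have h0 := X0_ne_zero
  have h1 := X0_add_ne_zero (a := a)
  refine ext_gens ?_ (by simp)
  have h3 : (X0 + cst a)⁻¹ - (cst a)⁻¹ = -X0 / (cst a * (X0 + cst a)) := by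
    field_simp
    ring
  have h4 : (tx a * (ix * tx (-(a : ℂ)⁻¹) * ix) * tx a) X0 =
      ((X0 + cst a)⁻¹ - (cst a)⁻¹)⁻¹ + cst a := by
    simp [sub_eq_add_neg]
  rw [h4, h3]
  simp only [AlgEquiv.mul_apply, ix_X0, dx_X0, map_mul, AlgEquiv.commutes, Units.val_neg,
    Units.val_pow_eq_pow_val,
    map_neg, map_pow]
  field_simp
  ring

theorem dx_word (a : ℂˣ) : ix * dx (-1) * (ix * dx (-a ^ 2)) = dx (a ^ 2) := by
  refine ext_gens ?_ (by simp)
  simp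

/-- The map `y ↦ y + a x`. -/
def e1 (a : ℂ) : Cremona2 := m⁻¹ * ty a * m

/-- The map `y ↦ y + a x ^ 2`. -/
def e2 (a : ℂ) : Cremona2 := m⁻¹ * e1 a * m

@[simp] theorem e1_X0 (a : ℂ) : e1 a X0 = X0 := by simp [e1]
@[simp] theorem e1_X1 (a : ℂ) : e1 a X1 = X1 + cst a * X0 := by
  have := X0_ne_zero
  simp [e1]
  field_simp
@[simp] theorem e2_X0 (a : ℂ) : e2 a X0 = X0 := by simp [e2]
@[simp] theorem e2_X1 (a : ℂ) : e2 a X1 = X1 + cst a * X0 ^ 2 := by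
  have := X0_ne_zero
  simp [e2]
  field_simp

theorem e2_mul_e2 (a b : ℂ) : e2 a * e2 b = e2 (a + b) :=
  ext_gens (by simp) (by simp; ring)

theorem e2_comm_ty (a b : ℂ) : Commute (e2 a) (ty b) :=
  commute_of_gens (by simp) (by simp; ring)

theorem e2_comm_e2 (a b : ℂ) : Commute (e2 a) (e2 b) :=
  commute_of_gens (by simp) (by simp; ring)

theorem dx_mul_e2 (l : ℂˣ) (a : ℂ) : dx l * e2 a = e2 (l ^ 2 * a) * dx l :=
  ext_gens (by simp) (by simp; ring)

theorem e2_word (a : ℂ) : tx 1 * e2 a * tx (-1) * (tx (-1) * e2 a * tx 1) =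
    e2 (2 * a) * ty (2 * a) :=
  ext_gens (by simp) (by simp [map_ofNat]; ring)

/-- The rotation `(x, y) ↦ (-y, x)` as a product of transvections. -/
theorem e1_word : e1 1 * (w * e1 (-1) * w) * e1 1 = w * dx (-1) :=
  ext_gens (by simp) (by simp)

theorem ix_mul_m_mul_ix : ix * m * ix = m⁻¹ :=
  ext_gens (by simp) (by simp; field_simp)

theorem m_word : m * (w * m⁻¹ * w) * m = iy * w := by
  have h0 := X0_ne_zero
  have h1 := X1_ne_zero
  refine ext_gens ?_ ?_
  · simp; field_simp
  · simp; field_simp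

end Cremona2

namespace Cremona2

theorem dx_eq_word (l : ℂˣ) {N : Subgroup Cremona2} (hx : ∀ a, tx a ∈ N)
    (hi : ∀ a, ix * tx a * ix ∈ N) : dx l ∈ N := by
  obtain ⟨a, rfl⟩ : ∃ a : ℂˣ, a ^ 2 = l := by
    obtain ⟨b, hb⟩ := IsAlgClosed.exists_pow_nat_eq (l : ℂ) two_pos
    have hb0 : b ≠ 0 := by
      rintro rfl
      exact l.ne_zero (by rw [← hb]; simp)
    exact ⟨Units.mk0 b hb0, Units.ext (by simpa using hb)⟩
  have h1 : ∀ a : ℂˣ, ix * dx (-a ^ 2) ∈ N := fun a => by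
    rw [← tx_ix_word]
    exact mul_mem (mul_mem (hx _) (hi _)) (hx _)
  rw [← dx_word]
  exact mul_mem (by simpa using h1 1) (h1 a)

theorem normal_eq_top {N : Subgroup Cremona2} [hN : N.Normal] (h : ty 1 ∈ N) : N = ⊤ := by
  have hty : ∀ a, ty a ∈ N := by
    intro a
    by_cases ha : a = 0
    · have : ty 0 = 1 := ext_gens (by simp) (by simp)
      rw [ha, this]
      exact one_mem _
    · have h1 := hN.conj_mem _ h (dy (Units.mk0 a ha)⁻¹)
      have h2 := dy_mul_ty (Units.mk0 a ha)⁻¹ a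
      rw [show (((Units.mk0 a ha)⁻¹ : ℂˣ) : ℂ) * a = 1 by simp [ha]] at h2
      rwa [h2, mul_inv_cancel_right] at h1
  have hconj : ∀ {g : Cremona2} (f : Cremona2), g ∈ N → f⁻¹ * g * f ∈ N := fun f hg => by
    simpa using hN.conj_mem _ hg f⁻¹
  have htx : ∀ a, tx a ∈ N := fun a => by
    have := hN.conj_mem _ (hty a) w
    rwa [w_mul_ty, mul_inv_cancel_right] at this
  have hix : ∀ a, ix * tx a * ix ∈ N := fun a => by
    have := hN.conj_mem _ (htx a) ix
    rwa [ix_inv] at this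
  have hdx : ∀ l, dx l ∈ N := fun l => dx_eq_word l htx hix
  have hix' : ix ∈ N := by
    have h1 : ix * dx (-1 ^ 2) ∈ N := by
      have := tx_ix_word 1
      rw [← this]
      exact mul_mem (mul_mem (htx _) (hix _)) (htx _)
    exact (mul_mem_cancel_right (hdx _)).1 h1
  have he : ∀ a, e1 a ∈ N := fun a => hconj _ (hty a)
  have hw : w ∈ N := by
    have h1 : w * dx (-1) ∈ N := by
      rw [← e1_word]
      have h2 := hN.conj_mem _ (he (-1)) w
      rw [w_inv] at h2
      exact mul_mem (mul_mem (he _) h2) (he _)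
    exact (mul_mem_cancel_right (hdx _)).1 h1
  have hiy : iy ∈ N := mul_mem (mul_mem hw hix') hw
  have hm : m ∈ N := by
    have h1 : (QuotientGroup.mk' N) (m * (w * m⁻¹ * w) * m) = 1 := by
      rw [m_word]
      exact (QuotientGroup.eq_one_iff _).2 (mul_mem hiy hw)
    have h2 : (QuotientGroup.mk' N) w = 1 := (QuotientGroup.eq_one_iff _).2 hw
    simp only [map_mul, map_inv, h2, one_mul, mul_one, mul_inv_cancel] at h1
    exact (QuotientGroup.eq_one_iff _).1 h1
  rw [eq_top_iff]
  intro f _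
  have hH : H ≤ N := by
    rw [H, Subgroup.closure_le]
    rintro _ ((⟨a, rfl⟩ | ⟨l, rfl⟩) | rfl | rfl | rfl)
    · exact htx a
    · exact hdx l
    · exact hix'
    · exact hw
    · exact hm
  exact hH (mem_H f)

theorem ty_one_ne_one : ty 1 ≠ 1 := by
  intro h
  have := ty_X1 1
  rw [h] at this
  simp at this

theorem map_ty_one_ne_one {φ : Cremona2 →* Cremona2} (hsurj : Function.Surjective φ) :
    φ (ty 1) ≠ 1 := by
  intro h
  have hk : φ.ker = ⊤ := normal_eq_top (MonoidHom.mem_ker.2 h)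
  obtain ⟨g, hg⟩ := hsurj (ty 1)
  have : g ∈ φ.ker := hk ▸ Subgroup.mem_top g
  exact ty_one_ne_one (hg.symm.trans (MonoidHom.mem_ker.1 this))

end Cremona2

namespace Cremona2

/-- The field of rational functions invariant under all elements of `B`. -/
def invariants (B : Set Cremona2) : IntermediateField ℂ K2 where
  carrier := {u | ∀ b ∈ B, b u = u}
  mul_mem' hu hv b hb := by rw [map_mul, hu b hb, hv b hb]
  add_mem' hu hv b hb := by rw [map_add, hu b hb, hv b hb]
  algebraMap_mem' c b _ := b.commutes c
  inv_mem' u hu b hb := by rw [map_inv₀, hu b hb]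

theorem apply_mem_invariants {B : Set Cremona2} {g : Cremona2} (hg : ∀ b ∈ B, Commute g b) {u : K2}
    (hu : u ∈ invariants B) : g u ∈ invariants B := fun b hb => by
  rw [← AlgEquiv.mul_apply, ← (hg b hb).eq, AlgEquiv.mul_apply, hu b hb]

variable {φ : Cremona2 →* Cremona2}

theorem map_tx_injective (h : φ (ty 1) ≠ 1) : Function.Injective fun a => φ (tx a) := by
  intro a b hab
  by_contra hne
  apply h
  have hab : φ (tx a) = φ (tx b) := hab
  have h1 : φ (tx (a - b)) = 1 := by
    rw [sub_eq_add_neg, ← tx_mul_tx, ← tx_inv, map_mul, map_inv, hab, mul_inv_cancel]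
  have h2 := congrArg φ (dx_mul_tx (Units.mk0 (a - b) (sub_ne_zero.2 hne)) 1)
  rw [Units.val_mk0, mul_one, map_mul, map_mul, h1, mul_one] at h2
  have h3 : φ (tx 1) = 1 := mul_eq_right.1 h2.symm
  have h4 := congrArg φ (w_mul_tx 1)
  rw [map_mul, map_mul, h3, mul_one] at h4
  exact mul_eq_right.1 h4.symm

theorem map_e2_injective (h : φ (ty 1) ≠ 1) : Function.Injective fun a => φ (e2 a) := by
  intro a b hab
  by_contra hne
  apply h
  have hab : φ (e2 a) = φ (e2 b) := hab
  have hc : a - b ≠ 0 := sub_ne_zero.2 hne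
  have h1 : φ (e2 (a - b)) = 1 := by
    have h0 : e2 (a - b) * e2 b = e2 a := by rw [e2_mul_e2, sub_add_cancel]
    have := congrArg φ h0
    rw [map_mul, hab] at this
    exact mul_eq_right.1 this
  have h2 : ∀ s : ℂ, s ≠ 0 → φ (e2 s) = 1 := by
    intro s hs
    obtain ⟨l, hl⟩ := IsAlgClosed.exists_pow_nat_eq (s / (a - b)) two_pos
    have hl0 : l ≠ 0 := by
      rintro rfl
      apply hs
      simpa [hc, eq_comm] using hl
    have h2 := congrArg φ (dx_mul_e2 (Units.mk0 l hl0) (a - b))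
    rw [Units.val_mk0, hl, div_mul_cancel₀ _ hc, map_mul, map_mul, h1, mul_one] at h2
    exact mul_eq_right.1 h2.symm
  have h3 := congrArg φ (e2_word (1 / 2))
  simp only [map_mul, h2 (1 / 2) (by norm_num), h2 (2 * (1 / 2)) (by norm_num), mul_one,
    one_mul] at h3
  rw [show (2 * (1 / 2) : ℂ) = 1 by norm_num, ← map_mul, ← map_mul, ← map_mul, tx_mul_tx, tx_mul_tx,
    tx_mul_tx] at h3
  rw [← h3]
  norm_num [tx_zero]

/-- The rational translations `y ↦ y + q`. -/
def ratTrans (φ : Cremona2 →* Cremona2) : Set Cremona2 := Set.range fun q : ℚ => φ (ty q)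

theorem commute_ratTrans {g : Cremona2} (hg : ∀ a, Commute g (ty a)) :
    ∀ b ∈ ratTrans φ, Commute (φ g) b := by
  rintro _ ⟨q, rfl⟩
  exact (hg q).map φ

theorem not_trivial_on_invariants (h : φ (ty 1) ≠ 1)
    (htx : ∀ a, ∀ u ∈ invariants (ratTrans φ), φ (tx a) u = u)
    (hdx : ∀ l, ∀ u ∈ invariants (ratTrans φ), φ (dx l) u = u) : False := by
  set F := (invariants (ratTrans φ)).toSubfield with hFdef
  have mtx : ∀ a, φ (tx a) ∈ central (ratTrans φ) F := fun a =>
    ⟨fun b hb => (commute_ratTrans (tx_comm_ty a) b hb).eq, htx a⟩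
  have mdx : ∀ l, φ (dx l) ∈ central (ratTrans φ) F := fun l =>
    ⟨fun b hb => (commute_ratTrans (dx_comm_ty l) b hb).eq, hdx l⟩
  have me2 : ∀ a, φ (e2 a) ∈ central (ratTrans φ) F := fun a => by
    have hc : ∀ a, ∀ b ∈ ratTrans φ, Commute (φ (e2 a)) b := fun a =>
      commute_ratTrans (e2_comm_ty a)
    refine ⟨fun b hb => (hc a b hb).eq, fun u hu => ?_⟩
    have h2 := congrArg φ (dx_mul_e2 (Units.mk0 2 two_ne_zero) (a / 3))
    have h3 : e2 (2 ^ 2 * (a / 3)) = e2 a * e2 (a / 3) := by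
      rw [e2_mul_e2]; congr 1; ring
    rw [Units.val_mk0, h3, map_mul, map_mul, map_mul] at h2
    have h4 := DFunLike.congr_fun h2 u
    have h5 : φ (e2 (a / 3)) u ∈ F := apply_mem_invariants (hc _) hu
    simp only [AlgEquiv.mul_apply, hdx _ u hu, hdx _ _ h5] at h4
    have h7 : φ (e2 (a / 3)) u = φ (e2 (a / 3)) (φ (e2 a) u) := by
      have := DFunLike.congr_fun ((e2_comm_e2 a (a / 3)).map φ).eq u
      rw [AlgEquiv.mul_apply, AlgEquiv.mul_apply] at this
      rw [← this, ← h4]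
    exact ((φ (e2 (a / 3))).injective h7).symm
  have conj1 : ∀ a, φ (tx a) * φ (dx (-1)) * (φ (tx a))⁻¹ = φ (tx (2 * a)) * φ (dx (-1)) := by
    intro a
    rw [← map_inv, ← map_mul, ← map_mul, ← map_mul, tx_inv]
    congr 1
    exact ext_gens (by simp [map_ofNat]; ring) (by simp)
  have conj2 : ∀ l, φ (dx l) * φ (e2 1) * (φ (dx l))⁻¹ = φ (e2 (l ^ 2)) := by
    intro l
    rw [← map_inv, ← map_mul, ← map_mul, dx_mul_e2, mul_inv_cancel_right, mul_one]
  have : Uncountable ℂ := Complex.ofReal_injective.uncountable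
  refine rank_lt_three (B := ratTrans φ) (F := F) (Set.countable_range _) (fun u => Iff.rfl)
    (mdx (-1)) (me2 1) (ι₁ := ℂ) (ι₂ := ℝ) (ι₃ := ℂ) (z₁ := fun a => φ (tx a))
    (z₂ := fun t => φ (dx (Units.mk0 (Real.exp t : ℂ) (by exact_mod_cast Real.exp_ne_zero t))))
    (z₃ := fun a => φ (e2 a)) mtx (fun _ => mdx _) me2 ?_ ?_ ?_ (map_e2_injective h) ?_ ?_
  · intro a b hab
    simp only [conj1] at hab
    simpa using map_tx_injective h (mul_right_cancel hab)
  · intro a b hab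
    simp only [conj2, Units.val_mk0] at hab
    have := map_e2_injective h hab
    have h2 : Real.exp a ^ 2 = Real.exp b ^ 2 := by exact_mod_cast this
    exact Real.exp_injective
      ((pow_left_inj₀ (Real.exp_pos _).le (Real.exp_pos _).le two_ne_zero).1 h2)
  · intro t
    simp only [← map_mul, dx_mul_dx]
    rw [mul_comm]
  · intro a
    have := congrArg φ (dx_mul_e2 (-1) a)
    simpa using this.symm
  · intro a
    exact ((e2_comm_e2 a 1).map φ).eq

/-- The translation `x ↦ x + 1` acts nontrivially on the invariants. -/
theorem exists_map_tx_one_ne (h : φ (ty 1) ≠ 1) :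
    ∃ u ∈ invariants (ratTrans φ), φ (tx 1) u ≠ u := by
  by_contra! h1
  have htx : ∀ a, ∀ u ∈ invariants (ratTrans φ), φ (tx a) u = u := by
    intro a u hu
    by_cases ha : a = 0
    · rw [ha, tx_zero, map_one, AlgEquiv.one_apply]
    · have h2 := DFunLike.congr_fun (congrArg φ (dx_mul_tx (Units.mk0 a ha)⁻¹ a)) u
      rw [show (((Units.mk0 a ha)⁻¹ : ℂˣ) : ℂ) * a = 1 by simp [ha], map_mul, map_mul,
        AlgEquiv.mul_apply, AlgEquiv.mul_apply, h1 u hu] at h2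
      have h4 := DFunLike.congr_fun (congrArg φ (dx_mul_tx (Units.mk0 a ha) 1)) u
      have h3 := h1 _ (apply_mem_invariants (commute_ratTrans (dx_comm_ty (Units.mk0 a ha))) hu)
      rw [Units.val_mk0, mul_one, map_mul, map_mul, AlgEquiv.mul_apply, AlgEquiv.mul_apply, h3]
        at h4
      exact (φ (dx (Units.mk0 a ha))).injective h4
  refine not_trivial_on_invariants h htx fun l u hu => ?_
  let N : Subgroup Cremona2 :=
    { carrier := {g | ∀ u ∈ invariants (ratTrans φ), φ g u = u}
      one_mem' := fun u _ => by rw [map_one, AlgEquiv.one_apply]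
      mul_mem' := fun {a b} ha hb u hu => by rw [map_mul, AlgEquiv.mul_apply, hb u hu, ha u hu]
      inv_mem' := fun {a} ha u hu => by
        apply (φ a).injective
        rw [map_inv, ← AlgEquiv.mul_apply, mul_inv_cancel, AlgEquiv.one_apply, ha u hu] }
  refine dx_eq_word l (N := N) htx (fun a u hu => ?_) u hu
  have h3 := htx a _ (apply_mem_invariants (commute_ratTrans ix_comm_ty) hu)
  rw [map_mul, map_mul, AlgEquiv.mul_apply, AlgEquiv.mul_apply, h3, ← AlgEquiv.mul_apply,
    ← map_mul, ix_ix, map_one, AlgEquiv.one_apply]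

end Cremona2

section

open Polynomial

/-- Evaluation of `P ∈ ℂ[y][x]` at the two coordinates. -/
def evXY : ℂ[X][X] →+* K2 := eval₂RingHom (aeval X1 : ℂ[X] →ₐ[ℂ] K2).toRingHom X0

theorem K2.exists_eq_evXY_div (u : K2) :
    ∃ P Q : ℂ[X][X], evXY Q ≠ 0 ∧ u * evXY Q = evXY P := by
  obtain ⟨A, B, hB, h⟩ := K2.exists_eq_ev_div u
  have key : ∀ A : (ℕ × ℕ) →₀ ℂ, ∃ P, evXY P = ev X0 X1 A := by
    intro A
    refine ⟨A.sum fun ij c => monomial ij.1 (monomial ij.2 c), ?_⟩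
    rw [ev_apply, Finsupp.sum, map_sum]
    refine Finset.sum_congr rfl fun ij _ => ?_
    simp [evXY, eval₂_monomial, aeval_monomial]
    ring
  obtain ⟨P, hP⟩ := key A
  obtain ⟨Q, hQ⟩ := key B
  exact ⟨P, Q, by rwa [hQ], by rw [hP, hQ, h]⟩

theorem K2.transcendental_of_notMem {u : K2} (h : u ∉ (⊥ : IntermediateField ℂ K2)) :
    Transcendental ℂ u := by
  intro hu
  have hi : IsIntegral ℂ u := hu.isIntegral
  have hd := minpoly.irreducible hi
  have hdeg := IsAlgClosed.degree_eq_one_of_irreducible ℂ hd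
  apply h
  rw [← IntermediateField.adjoin_simple_eq_bot_iff]
  apply IntermediateField.finrank_eq_one_iff.1
  rw [IntermediateField.adjoin.finrank hi, natDegree_eq_of_degree_eq_some hdeg]
  rfl

/-- A function not in `ℂ(y)` specializes to a nonconstant function at some `y = a`. -/
theorem K2.exists_specialization {u : K2} (hu : Cremona2.w u ∉ LX) :
    ∃ (P Q : ℂ[X][X]) (a : ℂ), u * evXY Q = evXY P ∧ Q.map (evalRingHom a) ≠ 0 ∧
      ∀ c : ℂ, P.map (evalRingHom a) ≠ C c * Q.map (evalRingHom a) := by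
  obtain ⟨P, Q, hQ, h⟩ := K2.exists_eq_evXY_div u
  have hminor : ∃ i j, P.coeff i * Q.coeff j - P.coeff j * Q.coeff i ≠ 0 := by
    by_contra! hc
    have hQ0 : Q ≠ 0 := by rintro rfl; simp at hQ
    obtain ⟨j, hj⟩ : ∃ j, Q.coeff j ≠ 0 := by
      by_contra! h0
      exact hQ0 (Polynomial.ext (by simpa using h0))
    have hPQ : C (Q.coeff j) * P = C (P.coeff j) * Q := by
      ext1 i
      rw [coeff_C_mul, coeff_C_mul]
      linear_combination hc i j
    have h2 := congrArg evXY hPQ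
    have hC : ∀ p : ℂ[X], evXY (C p) = aeval X1 p := fun p => by simp [evXY]
    rw [map_mul, map_mul, ← h, hC, hC, ← mul_assoc] at h2
    have h3 := mul_right_cancel₀ hQ h2
    have hq : aeval X0 (Q.coeff j) ≠ 0 :=
      fun h0 => hj ((transcendental_iff.1 Cremona2.transcendental_X0) _ h0)
    have h4 := congrArg Cremona2.w h3
    have hw : ∀ p : ℂ[X], Cremona2.w (aeval X1 p) = aeval X0 p := fun p => by
      have := (aeval_algHom_apply (Cremona2.w : K2 →ₐ[ℂ] K2) X1 p).symm
      simpa using this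
    rw [map_mul, hw, hw] at h4
    apply hu
    rw [eq_div_of_mul_eq hq ((mul_comm _ _).trans h4)]
    exact (IntermediateField.mem_adjoin_simple_iff _ _).2 ⟨_, _, rfl⟩
  obtain ⟨i, j, hij⟩ := hminor
  obtain ⟨a, ha⟩ : ∃ a : ℂ, (P.coeff i * Q.coeff j - P.coeff j * Q.coeff i).eval a ≠ 0 := by
    by_contra! h0
    exact hij (Polynomial.funext (by simpa using h0))
  simp only [eval_sub, eval_mul] at ha
  refine ⟨P, Q, a, h, ?_, ?_⟩
  · intro h0
    have e1 := congrArg (coeff · i) h0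
    have e2 := congrArg (coeff · j) h0
    simp only [coeff_map, coe_evalRingHom, coeff_zero] at e1 e2
    simp [e1, e2] at ha
  · intro c h0
    have e1 := congrArg (coeff · i) h0
    have e2 := congrArg (coeff · j) h0
    simp only [coeff_map, coe_evalRingHom, coeff_C_mul] at e1 e2
    rw [e1, e2] at ha
    apply ha
    ring

open scoped LaurentSeries PowerSeries

theorem RatFunc.exists_laurent (F : Type) [Field F] : ∃ j : RatFunc F →+* LaurentSeries F,
    j RatFunc.X = algebraMap (PowerSeries F) (LaurentSeries F) PowerSeries.X ∧
    ∀ c : F, j (algebraMap F (RatFunc F) c) =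
      algebraMap (PowerSeries F) (LaurentSeries F) (PowerSeries.C c) := by
  have hinj : Function.Injective ((algebraMap (PowerSeries F) (LaurentSeries F)).comp
      (Polynomial.coeToPowerSeries.ringHom : F[X] →+* PowerSeries F)) := by
    exact (IsFractionRing.injective (PowerSeries F) (LaurentSeries F)).comp
      (Polynomial.coe_injective F)
  refine ⟨IsFractionRing.lift (K := RatFunc F) hinj, ?_, fun c => ?_⟩
  · rw [← RatFunc.algebraMap_X, IsFractionRing.lift_algebraMap]
    simp
  · rw [IsScalarTower.algebraMap_apply F F[X] (RatFunc F), IsFractionRing.lift_algebraMap]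
    simp

/-- The Taylor expansion along `y = a`. -/
theorem K2.exists_taylor (a : ℂ) : ∃ j : K2 →+* LaurentSeries LX,
    j X0 = algebraMap (PowerSeries LX) (LaurentSeries LX)
      (PowerSeries.C ⟨X0, IntermediateField.mem_adjoin_simple_self ℂ X0⟩) ∧
    j X1 = algebraMap (PowerSeries LX) (LaurentSeries LX)
      (PowerSeries.X + PowerSeries.C (algebraMap ℂ LX a)) ∧
    ∀ c : ℂ, j (cst c) = algebraMap (PowerSeries LX) (LaurentSeries LX)
      (PowerSeries.C (algebraMap ℂ LX c)) := by
  obtain ⟨e, he⟩ := exists_ratFunc_equiv LX.transcendental_X1 LX.adjoin_X1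
  obtain ⟨i, hi, hi'⟩ := RatFunc.exists_laurent LX
  have hC : ∀ z : LX, i (e.symm z) =
      algebraMap (PowerSeries LX) (LaurentSeries LX) (PowerSeries.C z) := by
    intro z
    have : e.symm (z : K2) = algebraMap LX (RatFunc LX) z := e.symm.commutes z
    rw [this, hi']
  have hX : i (e.symm X1) = algebraMap (PowerSeries LX) (LaurentSeries LX) PowerSeries.X := by
    rw [e.symm_apply_eq.2 he.symm, hi]
  refine ⟨i.comp ((e.symm : K2 →+* RatFunc LX).comp (Cremona2.ty a : K2 →+* K2)), ?_, ?_, ?_⟩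
  · simpa using hC ⟨X0, IntermediateField.mem_adjoin_simple_self ℂ X0⟩
  · have := hC (algebraMap ℂ LX a)
    simp only [RingHom.comp_apply, RingHom.coe_coe, Cremona2.ty_X1, map_add]
    rw [hX]
    congr 1
  · intro c
    simpa using hC (algebraMap ℂ LX c)

end

section

open Polynomial
open scoped LaurentSeries PowerSeries

theorem LX.transcendental_X0 :
    Transcendental ℂ (⟨X0, IntermediateField.mem_adjoin_simple_self ℂ X0⟩ : LX) := by
  intro h
  exact Cremona2.transcendental_X0 (IsAlgebraic.algHom LX.val h)

/-- A homomorphism into Laurent series which takes `u` to a power series with transcendental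
constant term takes values in power series on the algebraic closure of `ℂ(u)`. -/
theorem K2.mem_range_of_isAlgebraic {j : K2 →+* LaurentSeries LX}
    (hj : ∀ c : ℂ, j (cst c) = algebraMap (PowerSeries LX) (LaurentSeries LX)
      (PowerSeries.C (algebraMap ℂ LX c))) {f : K2} {p : PowerSeries LX}
    (hp : j f = algebraMap (PowerSeries LX) (LaurentSeries LX) p)
    (hr : Transcendental ℂ (PowerSeries.constantCoeff p)) {u : K2}
    (hu : IsAlgebraic (IntermediateField.adjoin ℂ {f}) u) :
    ∃ q, j u = algebraMap (PowerSeries LX) (LaurentSeries LX) q := by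
  have hpoly : ∀ g : ℂ[X], ∃ q : PowerSeries LX,
      j (aeval f g) = algebraMap (PowerSeries LX) (LaurentSeries LX) q ∧
      PowerSeries.constantCoeff q = aeval (PowerSeries.constantCoeff p) g := by
    intro g
    induction g using Polynomial.induction_on with
    | C a =>
      refine ⟨PowerSeries.C (algebraMap ℂ LX a), ?_, ?_⟩
      · rw [aeval_C]; exact hj a
      · rw [aeval_C, PowerSeries.constantCoeff_C]
    | add g h hg hh =>
      obtain ⟨q, h1, h2⟩ := hg
      obtain ⟨q', h1', h2'⟩ := hh
      exact ⟨q + q', by rw [map_add, map_add, map_add, h1, h1'],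
        by rw [map_add, map_add, h2, h2']⟩
    | monomial n a hg =>
      obtain ⟨q, h1, h2⟩ := hg
      refine ⟨q * p, ?_, ?_⟩
      · rw [pow_succ, ← mul_assoc, map_mul (aeval f), map_mul j, h1, aeval_X, hp, map_mul]
      · rw [pow_succ, ← mul_assoc, map_mul (aeval _) (C a * X ^ n) X, aeval_X, map_mul, h2]
  have hfield : ∀ z ∈ IntermediateField.adjoin ℂ {f}, ∃ q : PowerSeries LX,
      j z = algebraMap (PowerSeries LX) (LaurentSeries LX) q := by
    intro z hz
    obtain ⟨g, h, rfl⟩ := (IntermediateField.mem_adjoin_simple_iff _ _).1 hz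
    by_cases hh : h = 0
    · exact ⟨0, by simp [hh]⟩
    obtain ⟨q, h1, h2⟩ := hpoly g
    obtain ⟨q', h1', h2'⟩ := hpoly h
    have hq' : PowerSeries.constantCoeff q' ≠ 0 := by
      rw [h2']
      exact fun h0 => hh (transcendental_iff.1 hr _ h0)
    refine ⟨q * q'⁻¹, ?_⟩
    have hq0 : q' ≠ 0 := by rintro rfl; simp at hq'
    rw [map_div₀, h1, h1', div_eq_iff, ← map_mul, mul_assoc, PowerSeries.inv_mul_cancel _ hq',
      mul_one]
    rwa [ne_eq, FaithfulSMul.algebraMap_eq_zero_iff]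
  set L0 := IntermediateField.adjoin ℂ {f}
  have hi : IsIntegral L0 u := hu.isIntegral
  let i : L0 →+* LaurentSeries LX := j.comp (algebraMap L0 K2)
  have hl : (minpoly L0 u).map i ∈
      Polynomial.lifts (algebraMap (PowerSeries LX) (LaurentSeries LX)) := by
    rw [Polynomial.lifts_iff_coeff_lifts]
    intro n
    rw [coeff_map]
    obtain ⟨q, hq⟩ := hfield _ ((minpoly L0 u).coeff n).2
    exact ⟨q, hq.symm⟩
  obtain ⟨g, hg, -, hgm⟩ := Polynomial.lifts_and_degree_eq_and_monic hl
    ((minpoly.monic hi).map i)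
  have hint : IsIntegral (PowerSeries LX) (j u) := by
    refine ⟨g, hgm, ?_⟩
    rw [← eval_map, hg, eval_map, ← hom_eval₂]
    have := minpoly.aeval L0 u
    rw [aeval_def] at this
    rw [this, map_zero]
  obtain ⟨q, hq⟩ := IsIntegrallyClosed.isIntegral_iff.1 hint
  exact ⟨q, hq.symm⟩

theorem K2.exists_place_of_notMem {f : K2} (hf : Cremona2.w f ∉ LX)
    {F : IntermediateField ℂ K2}
    (hF : ∀ u ∈ F, IsAlgebraic (IntermediateField.adjoin ℂ {f}) u) :
    Nonempty (F →ₐ[ℂ] LX) := by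
  obtain ⟨P, Q, a, hPQ, hQ, hc⟩ := K2.exists_specialization hf
  obtain ⟨j, hj0, hj1, hj⟩ := K2.exists_taylor a
  set x : LX := ⟨X0, IntermediateField.mem_adjoin_simple_self ℂ X0⟩ with hx
  let σ : ℂ[X][X] →+* PowerSeries LX := eval₂RingHom (eval₂RingHom
    ((PowerSeries.C (R := LX)).comp (algebraMap ℂ LX))
      (PowerSeries.X + PowerSeries.C (algebraMap ℂ LX a))) (PowerSeries.C x)
  have h1 : ∀ R, j (evXY R) = algebraMap (PowerSeries LX) (LaurentSeries LX) (σ R) := by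
    intro R
    refine RingHom.congr_fun (f := j.comp evXY)
      (g := (algebraMap (PowerSeries LX) (LaurentSeries LX)).comp σ) ?_ R
    ext1
    · ext1
      · ext c
        simpa [evXY, σ] using congrArg (HahnSeries.coeff · _) (hj c)
      · simpa [evXY, σ] using hj1
    · simpa [evXY, σ] using hj0
  have h2 : ∀ R, PowerSeries.constantCoeff (σ R) = aeval x (R.map (evalRingHom a)) := by
    intro R
    refine RingHom.congr_fun (f := (PowerSeries.constantCoeff (R := LX)).comp σ)
      (g := (aeval x : ℂ[X] →ₐ[ℂ] LX).toRingHom.comp (mapRingHom (evalRingHom a))) ?_ R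
    ext1
    · ext1
      · ext c
        simp [σ]
      · simp [σ]
    · simp [σ]
  have ht : ∀ g : ℂ[X], aeval x g = 0 → g = 0 := transcendental_iff.1 LX.transcendental_X0
  have hQ0 : PowerSeries.constantCoeff (σ Q) ≠ 0 := by
    rw [h2]
    exact fun h0 => hQ (ht _ h0)
  have hσ0 : σ Q ≠ 0 := fun h0 => hQ0 (by rw [h0, map_zero])
  have hp : j f = algebraMap (PowerSeries LX) (LaurentSeries LX) (σ P * (σ Q)⁻¹) := by
    have h3 := congrArg j hPQ
    rw [map_mul, h1, h1] at h3
    have hne : algebraMap (PowerSeries LX) (LaurentSeries LX) (σ Q) ≠ 0 := by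
      rwa [ne_eq, FaithfulSMul.algebraMap_eq_zero_iff]
    apply mul_right_cancel₀ hne
    rw [h3, ← map_mul, mul_assoc, PowerSeries.inv_mul_cancel _ hQ0, mul_one]
  have hr : Transcendental ℂ (PowerSeries.constantCoeff (σ P * (σ Q)⁻¹)) := by
    intro halg
    have hv : ((PowerSeries.constantCoeff (σ P * (σ Q)⁻¹) : LX) : K2) ∈
        (⊥ : IntermediateField ℂ K2) := by
      by_contra hn
      exact K2.transcendental_of_notMem hn (IsAlgebraic.algHom LX.val halg)
    obtain ⟨c, hc'⟩ := IntermediateField.mem_bot.1 hv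
    have hc2 : PowerSeries.constantCoeff (σ P * (σ Q)⁻¹) = algebraMap ℂ LX c :=
      Subtype.ext hc'.symm
    apply hc c
    apply sub_eq_zero.1
    apply ht
    rw [map_sub, map_mul, aeval_C, ← h2, ← h2, ← hc2, map_mul, mul_assoc, ← map_mul _ _ (σ Q),
      PowerSeries.inv_mul_cancel _ hQ0, map_one, mul_one, sub_self]
  have hval : ∀ u : F, ∃ q, j u = algebraMap (PowerSeries LX) (LaurentSeries LX) q :=
    fun u => K2.mem_range_of_isAlgebraic hj hp hr (hF u u.2)
  choose ρ hρ using hval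
  have hinj : Function.Injective (algebraMap (PowerSeries LX) (LaurentSeries LX)) :=
    IsFractionRing.injective _ _
  have hcomm : ∀ c : ℂ, ρ (algebraMap ℂ F c) = PowerSeries.C (algebraMap ℂ LX c) := by
    intro c
    apply hinj
    rw [← hρ]
    exact hj c
  refine ⟨{ toFun := fun u => PowerSeries.constantCoeff (ρ u)
            map_one' := ?_, map_zero' := ?_, map_mul' := ?_, map_add' := ?_, commutes' := ?_ }⟩
  · have : ρ 1 = 1 := hinj (by rw [← hρ]; simp)
    rw [this, map_one]
  · intro u v
    have : ρ (u * v) = ρ u * ρ v := hinj (by rw [map_mul, ← hρ, ← hρ, ← hρ]; simp)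
    rw [this, map_mul]
  · have : ρ 0 = 0 := hinj (by rw [← hρ]; simp)
    rw [this, map_zero]
  · intro u v
    have : ρ (u + v) = ρ u + ρ v := hinj (by rw [map_add, ← hρ, ← hρ, ← hρ]; simp)
    rw [this, map_add]
  · intro c
    simp [hcomm]

end

section

open Polynomial

theorem IsAlgebraic.of_ringHom {R S A B : Type} [Field R] [Field S] [Field A] [Field B]
    [Algebra R A] [Algebra S B] (i : R →+* S) (j : A →+* B)
    (h : (algebraMap S B).comp i = j.comp (algebraMap R A)) {u : A} (hu : IsAlgebraic R u) :
    IsAlgebraic S (j u) :=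
  (hu.isIntegral.map_of_comp_eq i j h).isAlgebraic

theorem K2.exists_place {f : K2} {F : IntermediateField ℂ K2}
    (hF : ∀ u ∈ F, IsAlgebraic (IntermediateField.adjoin ℂ {f}) u) :
    Nonempty (F →ₐ[ℂ] LX) := by
  by_cases hf : Cremona2.w f ∈ LX
  · have hsub : ∀ z ∈ IntermediateField.adjoin ℂ {f}, Cremona2.w z ∈ LX := by
      intro z hz
      have : IntermediateField.adjoin ℂ {f} ≤ LX.comap (Cremona2.w : K2 →ₐ[ℂ] K2) := by
        rw [IntermediateField.adjoin_simple_le_iff]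
        exact hf
      exact this hz
    have hmem : ∀ u : F, Cremona2.w u ∈ LX := by
      intro u
      apply Cremona2.mem_LX_of_isAlgebraic
      exact IsAlgebraic.of_ringHom
        (R := IntermediateField.adjoin ℂ {f})
        (((Cremona2.w : K2 →+* K2).comp
          (algebraMap (IntermediateField.adjoin ℂ {f}) K2)).codRestrict LX.toSubfield
            fun z => hsub z z.2) (Cremona2.w : K2 →+* K2) rfl (hF u u.2)
    exact ⟨((Cremona2.w : K2 →ₐ[ℂ] K2).comp F.val).codRestrict LX.toSubalgebra hmem⟩
  · exact K2.exists_place_of_notMem hf hF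

theorem K2.exists_eq_adjoin {F : IntermediateField ℂ K2} (hne : F ≠ ⊥)
    (hF : ∀ f ∈ F, Transcendental ℂ f → ∀ u ∈ F, IsAlgebraic (IntermediateField.adjoin ℂ {f}) u) :
    ∃ t : K2, Transcendental ℂ t ∧ F = IntermediateField.adjoin ℂ {t} := by
  obtain ⟨f, hfF, hf⟩ : ∃ f ∈ F, f ∉ (⊥ : IntermediateField ℂ K2) := by
    by_contra! h
    exact hne (le_bot_iff.1 h)
  have hft := K2.transcendental_of_notMem hf
  obtain ⟨ψ⟩ := K2.exists_place (hF f hfF hft)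
  have htop : IntermediateField.adjoin ℂ
      {(⟨X0, IntermediateField.mem_adjoin_simple_self ℂ X0⟩ : LX)} = ⊤ :=
    Cremona2.adjoin_LX_eq_top (IntermediateField.mem_adjoin_simple_self ℂ X0)
  obtain ⟨e, -⟩ := exists_ratFunc_equiv LX.transcendental_X0 htop
  let χ : F →ₐ[ℂ] RatFunc ℂ := (e.symm : LX →ₐ[ℂ] RatFunc ℂ).comp ψ
  have hχ : Function.Injective χ := χ.toRingHom.injective
  obtain ⟨t, ht⟩ : ∃ t : F, χ.fieldRange = IntermediateField.adjoin ℂ {χ t} := by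
    have h1 := RatFunc.Luroth.eq_adjoin_generator (E := χ.fieldRange)
    have h2 : RatFunc.Luroth.generator χ.fieldRange ∈ χ.fieldRange := by
      have := IntermediateField.mem_adjoin_simple_self ℂ (RatFunc.Luroth.generator χ.fieldRange)
      rwa [← h1] at this
    obtain ⟨t, ht⟩ := h2
    exact ⟨t, h1.trans (by rw [← ht]; rfl)⟩
  have hFt : F = IntermediateField.adjoin ℂ {(t : K2)} := by
    apply le_antisymm
    · intro u hu
      have h1 : χ ⟨u, hu⟩ ∈ χ.fieldRange := ⟨_, rfl⟩
      rw [ht] at h1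
      obtain ⟨g, h, hgh⟩ := (IntermediateField.mem_adjoin_simple_iff _ _).1 h1
      rw [aeval_algHom_apply, aeval_algHom_apply, ← map_div₀] at hgh
      have h2 := congrArg Subtype.val (hχ hgh)
      refine (IntermediateField.mem_adjoin_simple_iff _ _).2 ⟨g, h, h2.trans ?_⟩
      have h3 : ∀ g : ℂ[X], ((aeval t g : F) : K2) = aeval (t : K2) g :=
        fun g => (aeval_algHom_apply F.val t g).symm
      rw [← h3, ← h3]
      rfl
    · rw [IntermediateField.adjoin_simple_le_iff]
      exact t.2
  refine ⟨t, ?_, hFt⟩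
  apply K2.transcendental_of_notMem
  intro h
  exact hne (hFt.trans (IntermediateField.adjoin_simple_eq_bot_iff.2 h))

end

section

open Polynomial

theorem K2.isAlgebraic_of_transcendental {f u : K2} (hf : Transcendental ℂ f)
    (hu : Transcendental (IntermediateField.adjoin ℂ {f}) u) {F : IntermediateField ℂ K2}
    (hfF : f ∈ F) (huF : u ∈ F) (v : K2) : IsAlgebraic F v := by
  have h1 : AlgebraicIndependent ℂ (fun _ : Unit => f) :=
    algebraicIndependent_unique_type_iff.2 hf
  have hle : Algebra.adjoin ℂ (Set.range fun _ : Unit => f) ≤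
      (IntermediateField.adjoin ℂ {f}).toSubalgebra := by
    rw [Set.range_const]
    exact IntermediateField.algebra_adjoin_le_adjoin _ _
  have h2 : Transcendental (Algebra.adjoin ℂ (Set.range fun _ : Unit => f)) u := by
    intro h
    obtain ⟨p, hp, h⟩ := h
    refine hu ⟨p.map (Subalgebra.inclusion hle).toRingHom, ?_, ?_⟩
    · exact (Polynomial.map_ne_zero_iff (Subalgebra.inclusion_injective hle)).2 hp
    · rw [← h, aeval_def, eval₂_map, aeval_def]
      rfl
  have h3 := (h1.option_iff_transcendental u).2 h2
  have hb := h3.isTranscendenceBasis_of_trdeg_le_of_finite (by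
    rw [← K2.isTranscendenceBasis_X.cardinalMk_eq_trdeg]
    simp)
  have := hb.isAlgebraic
  obtain ⟨p, hp, h⟩ := Algebra.IsAlgebraic.isAlgebraic
    (R := Algebra.adjoin ℂ (Set.range fun o : Option Unit => o.elim u fun _ => f)) v
  have hle2 : Algebra.adjoin ℂ (Set.range fun o : Option Unit => o.elim u fun _ => f) ≤
      F.toSubalgebra := by
    rw [Algebra.adjoin_le_iff]
    rintro _ ⟨o, rfl⟩
    cases o
    · exact huF
    · exact hfF
  refine ⟨p.map (Subalgebra.inclusion hle2).toRingHom, ?_, ?_⟩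
  · exact (Polynomial.map_ne_zero_iff (Subalgebra.inclusion_injective hle2)).2 hp
  · rw [← h, aeval_def, eval₂_map, aeval_def]
    rfl

namespace Cremona2

theorem finite_apply_of_isAlgebraic {B : Set Cremona2} {v : K2}
    (hv : IsAlgebraic (invariants B) v) : ((fun b : Cremona2 => b v) '' B).Finite := by
  obtain ⟨p, hp, h⟩ := hv
  have hp' : p.map (algebraMap (invariants B) K2) ≠ 0 :=
    (Polynomial.map_ne_zero_iff (algebraMap (invariants B) K2).injective).2 hp
  refine Set.Finite.subset (Polynomial.finite_setOfPred_isRoot hp') ?_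
  rintro _ ⟨b, hb, rfl⟩
  have hcomp : (b : K2 →+* K2).comp (algebraMap (invariants B) K2) =
      algebraMap (invariants B) K2 := RingHom.ext fun z => z.2 b hb
  have h1 := congrArg (b : K2 →+* K2) h
  rw [aeval_def, map_zero, hom_eval₂, hcomp] at h1
  rw [Set.mem_ofPred_eq, IsRoot.def, eval_map]
  exact h1

/-- The invariants of an infinite set of Cremona transformations form a field `ℂ(t)`. -/
theorem exists_invariants_eq_adjoin {B : Set Cremona2} (hB : B.Infinite)
    (hne : invariants B ≠ ⊥) :
    ∃ t : K2, Transcendental ℂ t ∧ invariants B = IntermediateField.adjoin ℂ {t} := by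
  refine K2.exists_eq_adjoin hne fun f hf hft u hu => ?_
  by_contra hut
  apply hB
  have halg := K2.isAlgebraic_of_transcendental hft hut hf hu
  have hfin := (finite_apply_of_isAlgebraic (halg X0)).prod (finite_apply_of_isAlgebraic (halg X1))
  refine Set.Finite.of_finite_image (f := fun b : Cremona2 => (b X0, b X1))
    (hfin.subset ?_) ?_
  · rintro _ ⟨b, hb, rfl⟩
    exact ⟨⟨b, hb, rfl⟩, ⟨b, hb, rfl⟩⟩
  · intro b _ c _ h
    exact ext_gens (congrArg Prod.fst h) (congrArg Prod.snd h)

end Cremona2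

end

section

open Polynomial

namespace Cremona2

theorem ratTrans_infinite {φ : Cremona2 →* Cremona2} (h : φ (ty 1) ≠ 1) :
    (ratTrans φ).Infinite := by
  apply Set.infinite_range_of_injective
  intro p q hpq
  have h1 : φ (tx p) = φ (tx q) := by
    have h2 : φ (w * ty p * w) = φ (w * ty q * w) := by
      simp only [map_mul]
      rw [show φ (ty p) = φ (ty q) from hpq]
    simpa [w_mul_ty, mul_assoc, w_w] using h2
  exact_mod_cast map_tx_injective h h1

/-- If a set of automorphisms moves some `v ∈ ℂ(t)` to infinitely many places, then only constants
in `ℂ(t)` are fixed by it. -/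
theorem mem_bot_of_infinite_orbit {S : Set Cremona2} {t v z : K2}
    (hv : v ∈ IntermediateField.adjoin ℂ {t}) (hS : ((fun g : Cremona2 => g v) '' S).Infinite)
    (hz : z ∈ IntermediateField.adjoin ℂ {t}) (hfix : ∀ g ∈ S, g z = z) :
    z ∈ (⊥ : IntermediateField ℂ K2) := by
  by_contra hn
  apply hS
  have haev : ∀ (g : Cremona2) (p : ℂ[X]), g (aeval t p) = aeval (g t) p := fun g p =>
    (aeval_algHom_apply (g : K2 →ₐ[ℂ] K2) t p).symm
  have ht : ((fun g : Cremona2 => g t) '' S).Finite := by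
    obtain ⟨p, q, rfl⟩ := (IntermediateField.mem_adjoin_simple_iff _ _).1 hz
    have hq : aeval t q ≠ 0 := by
      intro h0
      apply hn
      rw [h0, div_zero]
      exact zero_mem _
    set z := aeval t p / aeval t q with hzdef
    have hr : p.map (algebraMap ℂ K2) - C z * q.map (algebraMap ℂ K2) ≠ 0 := by
      intro h0
      have hq0 : q ≠ 0 := by rintro rfl; simp at hq
      obtain ⟨i, hi⟩ : ∃ i, q.coeff i ≠ 0 := by
        by_contra! h1
        exact hq0 (Polynomial.ext (by simpa using h1))
      have h1 := congrArg (coeff · i) h0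
      simp only [coeff_sub, coeff_map, coeff_C_mul, coeff_zero] at h1
      have hi' : algebraMap ℂ K2 (q.coeff i) ≠ 0 := by simpa using hi
      apply hn
      rw [IntermediateField.mem_bot]
      refine ⟨p.coeff i / q.coeff i, ?_⟩
      rw [map_div₀, sub_eq_zero.1 h1, mul_div_cancel_right₀ _ hi']
    refine Set.Finite.subset (Polynomial.finite_setOfPred_isRoot hr) ?_
    rintro _ ⟨g, hg, rfl⟩
    have h2 : aeval t p = z * aeval t q := (div_mul_cancel₀ _ hq).symm
    have h3 := congrArg g h2
    rw [map_mul, hfix g hg, haev, haev] at h3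
    rw [Set.mem_ofPred_eq, IsRoot.def, eval_sub, eval_mul, eval_C, eval_map_algebraMap,
      eval_map_algebraMap, h3, sub_self]
  obtain ⟨p, q, rfl⟩ := (IntermediateField.mem_adjoin_simple_iff _ _).1 hv
  refine (ht.image fun s => aeval s p / aeval s q).subset ?_
  rintro _ ⟨g, hg, rfl⟩
  refine ⟨g t, ⟨g, hg, rfl⟩, ?_⟩
  simp only [map_div₀, haev]

theorem mem_bot_of_translation {F : IntermediateField ℂ K2} {t v z : K2} {g : Cremona2}
    (hF : F = IntermediateField.adjoin ℂ {t}) (hv : v ∈ F) (hg : g v = v + 1) (hz : z ∈ F)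
    (hfix : g z = z) : z ∈ (⊥ : IntermediateField ℂ K2) := by
  subst hF
  have hpow : ∀ n : ℕ, (g ^ n) v = v + cst n := by
    intro n
    induction n with
    | zero => simp
    | succ n ih =>
      rw [pow_succ', AlgEquiv.mul_apply, ih, map_add, hg, AlgEquiv.commutes]
      push_cast [map_add, map_one]
      ring
  refine mem_bot_of_infinite_orbit (S := Set.range fun n : ℕ => g ^ n) hv ?_ hz ?_
  · rw [← Set.range_comp]
    apply Set.infinite_range_of_injective
    intro n k hnk
    simp only [Function.comp_apply, hpow, add_right_inj] at hnk
    exact_mod_cast (algebraMap ℂ K2).injective hnk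
  · rintro _ ⟨n, rfl⟩
    show (g ^ n) z = z
    induction n with
    | zero => rfl
    | succ n ih => rw [pow_succ', AlgEquiv.mul_apply, ih, hfix]

theorem mem_bot_of_dilation {F : IntermediateField ℂ K2} {t v z : K2} {g : Cremona2}
    (hF : F = IntermediateField.adjoin ℂ {t}) (hv : v ∈ F) (hv0 : v ≠ 0) (hg : g v = 2 * v)
    (hz : z ∈ F) (hfix : g z = z) : z ∈ (⊥ : IntermediateField ℂ K2) := by
  subst hF
  have hpow : ∀ n : ℕ, (g ^ n) v = cst (2 ^ n) * v := by
    intro n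
    induction n with
    | zero => simp
    | succ n ih =>
      rw [pow_succ', AlgEquiv.mul_apply, ih, map_mul, hg, AlgEquiv.commutes]
      simp only [map_pow, map_ofNat]
      ring
  refine mem_bot_of_infinite_orbit (S := Set.range fun n : ℕ => g ^ n) hv ?_ hz ?_
  · rw [← Set.range_comp]
    apply Set.infinite_range_of_injective
    intro n k hnk
    simp only [Function.comp_apply, hpow] at hnk
    have h1 := (algebraMap ℂ K2).injective (mul_right_cancel₀ hv0 hnk)
    exact Nat.pow_right_injective le_rfl (by exact_mod_cast h1)
  · rintro _ ⟨n, rfl⟩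
    show (g ^ n) z = z
    induction n with
    | zero => rfl
    | succ n ih => rw [pow_succ', AlgEquiv.mul_apply, ih, hfix]

/-- Normalized coordinates are unique. -/
theorem eq_of_normalized {F : IntermediateField ℂ K2} {t v z : K2} {g d : Cremona2}
    (hF : F = IntermediateField.adjoin ℂ {t}) (hv : v ∈ F) (hgv : g v = v + 1) (hdv : d v = 2 * v)
    (hz : z ∈ F) (hgz : g z = z + 1) (hdz : d z = 2 * z) : z = v := by
  obtain ⟨c, hc⟩ := IntermediateField.mem_bot.1
    (mem_bot_of_translation hF hv hgv (sub_mem hz hv) (by rw [map_sub, hgv, hgz]; ring))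
  have h1 : d (z - v) = z - v := by rw [← hc, AlgEquiv.commutes]
  rw [map_sub, hdv, hdz] at h1
  linear_combination h1

end Cremona2

end

section

open Polynomial

theorem cst_add (a b : ℂ) : cst (a + b) = cst a + cst b := map_add _ _ _
theorem cst_sub (a b : ℂ) : cst (a - b) = cst a - cst b := map_sub _ _ _
theorem cst_mul (a b : ℂ) : cst (a * b) = cst a * cst b := map_mul _ _ _
theorem cst_pow (a : ℂ) (n : ℕ) : cst (a ^ n) = cst a ^ n := map_pow _ _ _
theorem cst_neg (a : ℂ) : cst (-a) = -cst a := map_neg _ _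
theorem cst_div (a b : ℂ) : cst (a / b) = cst a / cst b := map_div₀ _ _ _
theorem cst_zero : cst 0 = 0 := map_zero _
theorem cst_one : cst 1 = 1 := map_one _
theorem cst_two : cst 2 = 2 := map_ofNat _ 2
theorem cst_inj {a b : ℂ} : cst a = cst b ↔ a = b := (algebraMap ℂ K2).injective.eq_iff
theorem cst_eq_zero {a : ℂ} : cst a = 0 ↔ a = 0 := by rw [← cst_zero, cst_inj]

theorem K2.coeff_eq_zero_of_transcendental {t : K2} (ht : Transcendental ℂ t) {a b c : ℂ}
    (h : cst a * t ^ 2 + cst b * t + cst c = 0) : a = 0 ∧ b = 0 ∧ c = 0 := by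
  have h1 : C a * X ^ 2 + C b * X + C c = 0 := by
    apply transcendental_iff.1 ht
    simpa using h
  have h2 := fun i => congrArg (coeff · i) h1
  have h20 := h2 0
  have h21 := h2 1
  have h22 := h2 2
  simp [coeff_X, coeff_C] at h20 h21 h22
  exact ⟨h22, h21, h20⟩

namespace Cremona2

/-- `g` and its inverse map the field `F` into itself. -/
def Stabilizes (F : IntermediateField ℂ K2) (g : Cremona2) : Prop :=
  (∀ z ∈ F, g z ∈ F) ∧ ∀ z ∈ F, g⁻¹ z ∈ F

theorem transcendental_of_adjoin_eq {F : IntermediateField ℂ K2} {t t' : K2}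
    (hF : F = IntermediateField.adjoin ℂ {t}) (hF' : F = IntermediateField.adjoin ℂ {t'})
    (ht : Transcendental ℂ t) : Transcendental ℂ t' := by
  apply K2.transcendental_of_notMem
  intro h
  have hb : F = ⊥ := hF'.trans (IntermediateField.adjoin_simple_eq_bot_iff.2 h)
  rw [hF, IntermediateField.adjoin_simple_eq_bot_iff, IntermediateField.mem_bot] at hb
  obtain ⟨c, rfl⟩ := hb
  exact ht (isAlgebraic_algebraMap c)

theorem Stabilizes.exists_mobius {F : IntermediateField ℂ K2} {t : K2} {g : Cremona2}
    (hg : Stabilizes F g) (hF : F = IntermediateField.adjoin ℂ {t}) (ht : Transcendental ℂ t) :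
    ∃ α β γ δ : ℂ, α * δ - β * γ ≠ 0 ∧ cst γ * t + cst δ ≠ 0 ∧
      g t = (cst α * t + cst β) / (cst γ * t + cst δ) := by
  have htF : t ∈ F := hF ▸ IntermediateField.mem_adjoin_simple_self ℂ t
  have hlift : ∀ z : F, t ∈ IntermediateField.adjoin ℂ {(z : K2)} →
      IntermediateField.adjoin ℂ {z} = ⊤ := by
    intro z hz
    have hle : F ≤ IntermediateField.adjoin ℂ {(z : K2)} := by
      conv_lhs => rw [hF]
      rw [IntermediateField.adjoin_le_iff, Set.singleton_subset_iff]
      exact hz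
    have hm : IntermediateField.adjoin ℂ {(z : K2)} =
        (IntermediateField.adjoin ℂ {z}).map F.val := by
      rw [IntermediateField.adjoin_map, Set.image_singleton]
      rfl
    rw [eq_top_iff]
    intro u _
    have hu := hle u.2
    rw [hm] at hu
    obtain ⟨u', hu', he⟩ := hu
    rwa [← Subtype.ext he]
  have hgt : t ∈ IntermediateField.adjoin ℂ {g t} := by
    have h1 := hg.2 t htF
    rw [hF] at h1
    obtain ⟨p, q, hpq⟩ := (IntermediateField.mem_adjoin_simple_iff _ _).1 h1
    refine (IntermediateField.mem_adjoin_simple_iff _ _).2 ⟨p, q, ?_⟩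
    have := congrArg g hpq
    rwa [← AlgEquiv.mul_apply, mul_inv_cancel, AlgEquiv.one_apply, map_div₀, ← aeval_algHom_apply,
      ← aeval_algHom_apply] at this
  obtain ⟨α, β, γ, δ, h1, h2, h3⟩ := mobius_of_adjoin (F := ℂ) (E := F) (y := ⟨t, htF⟩)
    (z := ⟨g t, hg.1 t htF⟩) (fun h => ht (IsAlgebraic.algHom F.val h))
    (hlift _ (IntermediateField.mem_adjoin_simple_self ℂ t)) (hlift _ hgt)
  refine ⟨α, β, γ, δ, h1, fun h => h2 (Subtype.ext h), congrArg Subtype.val h3⟩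

theorem adjoin_eq_of_mem {t t' : K2} (h : t ∈ IntermediateField.adjoin ℂ {t'})
    (h' : t' ∈ IntermediateField.adjoin ℂ {t}) :
    IntermediateField.adjoin ℂ {t} = IntermediateField.adjoin ℂ {t'} :=
  le_antisymm (IntermediateField.adjoin_simple_le_iff.2 h)
    (IntermediateField.adjoin_simple_le_iff.2 h')

theorem cst_mem (F : IntermediateField ℂ K2) (c : ℂ) : cst c ∈ F := F.algebraMap_mem c

theorem adjoin_sub_cst (t : K2) (c : ℂ) :
    IntermediateField.adjoin ℂ {t} = IntermediateField.adjoin ℂ {t - cst c} := by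
  apply adjoin_eq_of_mem
  · have := add_mem (IntermediateField.mem_adjoin_simple_self ℂ (t - cst c))
      (cst_mem (IntermediateField.adjoin ℂ {t - cst c}) c)
    rwa [sub_add_cancel] at this
  · exact sub_mem (IntermediateField.mem_adjoin_simple_self ℂ t) (cst_mem _ c)

theorem adjoin_inv (t : K2) :
    IntermediateField.adjoin ℂ {t} = IntermediateField.adjoin ℂ {t⁻¹} := by
  apply adjoin_eq_of_mem
  · have := inv_mem (IntermediateField.mem_adjoin_simple_self ℂ t⁻¹)
    rwa [inv_inv] at this
  · exact inv_mem (IntermediateField.mem_adjoin_simple_self ℂ t)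

theorem adjoin_div_cst (t : K2) {c : ℂ} (hc : c ≠ 0) :
    IntermediateField.adjoin ℂ {t} = IntermediateField.adjoin ℂ {t / cst c} := by
  have hc' : cst c ≠ 0 := cst_eq_zero.not.2 hc
  apply adjoin_eq_of_mem
  · have := mul_mem (IntermediateField.mem_adjoin_simple_self ℂ (t / cst c))
      (cst_mem (IntermediateField.adjoin ℂ {t / cst c}) c)
    rwa [div_mul_cancel₀ _ hc'] at this
  · exact div_mem (IntermediateField.mem_adjoin_simple_self ℂ t) (cst_mem _ c)

/-- Moving a fixed point of a Möbius transformation to infinity. -/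
theorem Stabilizes.exists_affine {F : IntermediateField ℂ K2} {t : K2} {u : Cremona2}
    (hu : Stabilizes F u) (hF : F = IntermediateField.adjoin ℂ {t}) (ht : Transcendental ℂ t) :
    ∃ t' α β, F = IntermediateField.adjoin ℂ {t'} ∧ α ≠ 0 ∧ u t' = cst α * t' + cst β := by
  obtain ⟨α, β, γ, δ, hdet, hden, hut⟩ := hu.exists_mobius hF ht
  by_cases hγ : γ = 0
  · subst hγ
    have hδ : δ ≠ 0 := by rintro rfl; simp at hdet
    have hδ' : cst δ ≠ 0 := cst_eq_zero.not.2 hδ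
    have hα : α ≠ 0 := by rintro rfl; simp at hdet
    refine ⟨t, α / δ, β / δ, hF, div_ne_zero hα hδ, ?_⟩
    rw [hut, cst_div, cst_div, cst_zero, zero_mul, zero_add]
    field_simp
  · obtain ⟨c, hc⟩ : ∃ c : ℂ, γ * c ^ 2 + (δ - α) * c - β = 0 := by
      have hdeg : (C γ * X ^ 2 + C (δ - α) * X + C (-β)).degree = 2 := degree_quadratic hγ
      obtain ⟨c, hc⟩ := IsAlgClosed.exists_root (C γ * X ^ 2 + C (δ - α) * X + C (-β))
        (by rw [hdeg]; decide)
      refine ⟨c, ?_⟩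
      have h1 : eval c (C γ * X ^ 2 + C (δ - α) * X + C (-β)) = 0 := hc
      simp only [eval_add, eval_mul, eval_C, eval_X, eval_pow] at h1
      linear_combination h1
    have hβ : β = γ * c ^ 2 + (δ - α) * c := by linear_combination -hc
    have hκ : α - c * γ ≠ 0 := by
      intro h0
      apply hdet
      rw [hβ]
      linear_combination (δ + γ * c) * h0
    have hκ' : cst (α - c * γ) ≠ 0 := cst_eq_zero.not.2 hκ
    have htc : t - cst c ≠ 0 := by
      intro h0
      apply ht
      rw [sub_eq_zero.1 h0]
      exact isAlgebraic_algebraMap c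
    refine ⟨(t - cst c)⁻¹, (γ * c + δ) / (α - c * γ), γ / (α - c * γ),
      hF.trans ((adjoin_sub_cst t c).trans (adjoin_inv _)), div_ne_zero ?_ hκ, ?_⟩
    · intro h0
      apply hdet
      rw [hβ]
      linear_combination (α - c * γ) * h0
    · have h1 : u t - cst c = cst (α - c * γ) * (t - cst c) / (cst γ * t + cst δ) := by
        rw [hut, hβ, eq_div_iff hden, sub_mul, div_mul_cancel₀ _ hden]
        simp only [cst_add, cst_sub, cst_mul, cst_pow]
        ring
      rw [map_inv₀, map_sub, AlgEquiv.commutes, h1, cst_div, cst_div, inv_div, cst_add, cst_mul]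
      field_simp
      ring

end Cremona2

end

section

open Polynomial

namespace Cremona2

theorem fixes_of_fixes_generator {F : IntermediateField ℂ K2} {t : K2} {g : Cremona2}
    (hF : F = IntermediateField.adjoin ℂ {t}) (hg : g t = t) {z : K2} (hz : z ∈ F) : g z = z := by
  rw [hF] at hz
  obtain ⟨p, q, rfl⟩ := (IntermediateField.mem_adjoin_simple_iff _ _).1 hz
  rw [map_div₀, ← AlgEquiv.coe_toAlgHom, ← aeval_algHom_apply, ← aeval_algHom_apply,
    AlgEquiv.coe_toAlgHom, hg]

/-- A nontrivial automorphism of `ℂ(t)` conjugate to its square and to its cube is a translation. -/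
theorem exists_translation {F : IntermediateField ℂ K2} {t : K2} {u d e : Cremona2}
    (hF : F = IntermediateField.adjoin ℂ {t}) (ht : Transcendental ℂ t)
    (hu : Stabilizes F u) (hd : Stabilizes F d) (he : Stabilizes F e)
    (hdu : d * u ^ 2 = u * d) (heu : e * u ^ 3 = u * e) (hne : ∃ v ∈ F, u v ≠ v) :
    ∃ t', F = IntermediateField.adjoin ℂ {t'} ∧ Transcendental ℂ t' ∧ u t' = t' + 1 := by
  obtain ⟨t₁, α, β, hF₁, hα, hut₁⟩ := hu.exists_affine hF ht
  have hnt : ∀ {g : Cremona2} {s : K2} {n : ℕ}, Stabilizes F g → g * u ^ n = u * g →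
      F = IntermediateField.adjoin ℂ {s} → (u ^ n) s ≠ s := by
    intro g s n hg hgu hs h
    obtain ⟨v, hv, hne⟩ := hne
    apply hne
    have h1 := DFunLike.congr_fun hgu (g⁻¹ v)
    rw [AlgEquiv.mul_apply, AlgEquiv.mul_apply, fixes_of_fixes_generator hs h (hg.2 v hv),
      ← AlgEquiv.mul_apply g, mul_inv_cancel, AlgEquiv.one_apply] at h1
    exact h1.symm
  have hu1 : ∀ {s : K2}, F = IntermediateField.adjoin ℂ {s} → u s ≠ s := by
    intro s hs h
    refine hnt hd hdu hs ?_
    rw [pow_two, AlgEquiv.mul_apply, h, h]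
  by_cases hα1 : α = 1
  · subst hα1
    have hβ : β ≠ 0 := by
      rintro rfl
      exact hu1 hF₁ (by rw [hut₁, cst_one, cst_zero, one_mul, add_zero])
    have hF₂ := hF₁.trans (adjoin_div_cst t₁ hβ)
    refine ⟨_, hF₂, transcendental_of_adjoin_eq hF hF₂ ht, ?_⟩
    rw [map_div₀, hut₁, AlgEquiv.commutes, cst_one, one_mul, add_div,
      div_self (cst_eq_zero.not.2 hβ)]
  · exfalso
    obtain ⟨s, hs, hst, hus⟩ : ∃ s, F = IntermediateField.adjoin ℂ {s} ∧ Transcendental ℂ s ∧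
        u s = cst α * s := by
      have hF₂ := hF₁.trans (adjoin_sub_cst t₁ (β / (1 - α)))
      refine ⟨_, hF₂, transcendental_of_adjoin_eq hF hF₂ ht, ?_⟩
      have h0 : β = (1 - α) * (β / (1 - α)) :=
        (mul_div_cancel₀ β (sub_ne_zero.2 (Ne.symm hα1))).symm
      have h1 : cst β = cst ((1 - α) * (β / (1 - α))) := congrArg (fun z => cst z) h0
      rw [cst_mul, cst_sub, cst_one] at h1
      rw [map_sub, hut₁, AlgEquiv.commutes]
      linear_combination h1
    have hpow : ∀ n : ℕ, (u ^ n) s = cst (α ^ n) * s := by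
      intro n
      induction n with
      | zero => simp
      | succ n ih =>
        rw [pow_succ', AlgEquiv.mul_apply, ih, map_mul, hus, AlgEquiv.commutes, pow_succ, cst_mul]
        ring
    have hα2 : α ^ 2 ≠ 1 := by
      intro h
      exact hnt hd hdu hs (by rw [hpow, h, cst_one, one_mul])
    have hα3 : α ^ 3 ≠ 1 := by
      intro h
      exact hnt he heu hs (by rw [hpow, h, cst_one, one_mul])
    obtain ⟨a, b, c, f, hdet, hden, hds⟩ := hd.exists_mobius hs hst
    have h1 := DFunLike.congr_fun hdu s
    rw [AlgEquiv.mul_apply, AlgEquiv.mul_apply, hpow, map_mul, AlgEquiv.commutes] at h1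
    have hden' : cst c * (cst α * s) + cst f ≠ 0 := by
      have h2 := u.injective.ne hden
      simpa [hus] using h2
    have h2 : cst (α ^ 2) * ((cst a * s + cst b) / (cst c * s + cst f)) =
        (cst a * (cst α * s) + cst b) / (cst c * (cst α * s) + cst f) := by
      rw [← hds, h1, hds]
      simp only [map_div₀, map_add, map_mul, hus, AlgEquiv.commutes]
    rw [← mul_div_assoc, div_eq_div_iff hden hden'] at h2
    have h3 : cst (a * c * α * (α ^ 2 - 1)) * s ^ 2 +
        cst (a * f * α * (α - 1) + b * c * (α ^ 3 - 1)) * s + cst (b * f * (α ^ 2 - 1)) = 0 := by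
      simp only [cst_add, cst_sub, cst_mul, cst_pow, cst_one] at h2 ⊢
      linear_combination h2
    obtain ⟨e1, e2, e3⟩ := K2.coeff_eq_zero_of_transcendental hst h3
    have hα2' := sub_ne_zero.2 hα2
    have hα3' := sub_ne_zero.2 hα3
    have hα1' := sub_ne_zero.2 hα1
    simp only [mul_eq_zero, hα, hα2', or_false] at e1 e3
    apply hdet
    rcases e1 with rfl | rfl
    · rw [zero_mul, zero_mul, zero_mul, zero_add, mul_eq_zero] at e2
      rw [e2.resolve_right hα3']
      ring
    · rw [mul_zero, zero_mul, add_zero] at e2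
      rw [((mul_eq_zero.1 e2).resolve_right hα1') |> fun h => (mul_eq_zero.1 h).resolve_right hα]
      ring

end Cremona2

end

section

open Polynomial

namespace Cremona2

variable {φ : Cremona2 →* Cremona2}

theorem apply_cst (g : Cremona2) (c : ℂ) : g (cst c) = cst c := g.commutes c

theorem stabilizes_of_commute {g : Cremona2} (hg : ∀ a, Commute g (ty a)) :
    Stabilizes (invariants (ratTrans φ)) (φ g) := by
  refine ⟨fun z hz => apply_mem_invariants (commute_ratTrans hg) hz, fun z hz => ?_⟩
  rw [← map_inv]
  exact apply_mem_invariants (commute_ratTrans fun a => (hg a).inv_left) hz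

theorem tx_one_pow (n : ℕ) : tx 1 ^ n = tx n := by
  induction n with
  | zero => simp [tx_zero]
  | succ n ih => rw [pow_succ, ih, tx_mul_tx, Nat.cast_succ]

theorem dx_mul_tx_one_pow (n : ℕ) (hn : (n : ℂ) ≠ 0) :
    dx (Units.mk0 (n : ℂ) hn) * tx 1 ^ n = tx 1 * dx (Units.mk0 (n : ℂ) hn) := by
  have := dx_mul_tx (Units.mk0 (n : ℂ) hn) 1
  rwa [Units.val_mk0, mul_one, ← tx_one_pow] at this

/-- The invariants of the rational translations form a field `ℂ(t)`, and in a suitable coordinate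
`t` the images of the linear fractional transformations of `x` act through a field endomorphism. -/
theorem exists_coordinate (h : φ (ty 1) ≠ 1) : ∃ (t : K2) (τ : ℂ →+* ℂ), Transcendental ℂ t ∧
    invariants (ratTrans φ) = IntermediateField.adjoin ℂ {t} ∧
    (∀ a, φ (tx a) t = t + cst (τ a)) ∧ (∀ l : ℂˣ, φ (dx l) t = cst (τ l) * t) ∧
    φ ix t = t⁻¹ := by
  set F := invariants (ratTrans φ) with hFdef
  have hne := exists_map_tx_one_ne h
  have hbot : F ≠ ⊥ := by
    rintro hb
    obtain ⟨u, hu, hut⟩ := hne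
    rw [← hFdef, hb, IntermediateField.mem_bot] at hu
    obtain ⟨c, rfl⟩ := hu
    exact hut (AlgEquiv.commutes _ c)
  obtain ⟨t₀, ht₀, hF₀⟩ := exists_invariants_eq_adjoin (ratTrans_infinite h) hbot
  have sU : ∀ a, Stabilizes F (φ (tx a)) := fun a => stabilizes_of_commute (tx_comm_ty a)
  have sD : ∀ l, Stabilizes F (φ (dx l)) := fun l => stabilizes_of_commute (dx_comm_ty l)
  have sI : Stabilizes F (φ ix) := stabilizes_of_commute ix_comm_ty
  obtain ⟨t₁, hF₁, ht₁, hu₁⟩ := exists_translation hF₀ ht₀ (sU 1)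
    (sD (Units.mk0 ((2 : ℕ) : ℂ) (by norm_num))) (sD (Units.mk0 ((3 : ℕ) : ℂ) (by norm_num)))
    (by simpa only [map_mul, map_pow] using congrArg φ (dx_mul_tx_one_pow 2 (by norm_num)))
    (by simpa only [map_mul, map_pow] using congrArg φ (dx_mul_tx_one_pow 3 (by norm_num))) hne
  have ht₁F : t₁ ∈ F := by
    rw [hFdef, hF₁]; exact IntermediateField.mem_adjoin_simple_self ℂ t₁
  have fixU : ∀ z ∈ F, φ (tx 1) z = z → ∃ c : ℂ, z = cst c := by
    intro z hz hfix
    obtain ⟨c, hc⟩ := IntermediateField.mem_bot.1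
      (mem_bot_of_translation hF₁ ht₁F hu₁ hz hfix)
    exact ⟨c, hc.symm⟩
  have hU : ∀ a, ∃ c : ℂ, φ (tx a) t₁ = t₁ + cst c := by
    intro a
    obtain ⟨c, hc⟩ := fixU (φ (tx a) t₁ - t₁) (sub_mem ((sU a).1 _ ht₁F) ht₁F) (by
      rw [map_sub, ← AlgEquiv.mul_apply, ← map_mul, tx_mul_tx, add_comm, ← tx_mul_tx, map_mul,
        AlgEquiv.mul_apply, hu₁, map_add, map_one]
      ring)
    exact ⟨c, by rw [← hc]; ring⟩
  choose τ hτ using hU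
  have τ_add : ∀ a b, τ (a + b) = τ a + τ b := by
    intro a b
    have h1 := hτ (a + b)
    rw [← tx_mul_tx, map_mul, AlgEquiv.mul_apply, hτ, map_add, apply_cst, hτ, add_assoc,
      add_right_inj, ← cst_add, cst_inj] at h1
    rw [← h1, add_comm]
  have τ_one : τ 1 = 1 := by
    have h1 := hτ 1
    rw [hu₁, add_right_inj, ← cst_one, cst_inj] at h1
    exact h1.symm
  have hD : ∀ l : ℂˣ, ∃ c : ℂ, φ (dx l) t₁ = cst (τ l) * t₁ + cst c := by
    intro l
    have h1 := DFunLike.congr_fun (congrArg φ (dx_mul_tx l 1)) t₁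
    rw [map_mul, map_mul, AlgEquiv.mul_apply, AlgEquiv.mul_apply, hτ, mul_one, map_add,
      apply_cst] at h1
    obtain ⟨c, hc⟩ := fixU (φ (dx l) t₁ - cst (τ l) * t₁)
      (sub_mem ((sD l).1 _ ht₁F) (mul_mem (cst_mem F _) ht₁F)) (by
        rw [map_sub, map_mul, ← h1, hu₁, apply_cst]
        ring)
    exact ⟨c, by rw [← hc]; ring⟩
  choose σ hσ using hD
  let two : ℂˣ := Units.mk0 2 two_ne_zero
  have τ_two : τ 2 = 2 := by
    rw [show (2 : ℂ) = 1 + 1 by norm_num, τ_add, τ_one]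
  set t := t₁ - cst (-σ two) with htdef
  have hF : F = IntermediateField.adjoin ℂ {t} := hF₁.trans (adjoin_sub_cst _ _)
  have ht : Transcendental ℂ t := transcendental_of_adjoin_eq hF₀ hF ht₀
  have htF : t ∈ F := hF ▸ IntermediateField.mem_adjoin_simple_self ℂ t
  have ht0 : t ≠ 0 := fun h0 => ht (h0 ▸ isAlgebraic_zero)
  have hU : ∀ a, φ (tx a) t = t + cst (τ a) := by
    intro a
    rw [htdef, map_sub, hτ, apply_cst]
    ring
  have hD2 : φ (dx two) t = 2 * t := by
    rw [htdef, map_sub, hσ, apply_cst, Units.val_mk0, τ_two, cst_two, cst_neg]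
    ring
  have fixD : ∀ z ∈ F, φ (dx two) z = z → ∃ c : ℂ, z = cst c := by
    intro z hz hfix
    obtain ⟨c, hc⟩ := IntermediateField.mem_bot.1
      (mem_bot_of_dilation hF htF ht0 hD2 hz hfix)
    exact ⟨c, hc.symm⟩
  have hD : ∀ l : ℂˣ, φ (dx l) t = cst (τ l) * t := by
    intro l
    obtain ⟨c, hc⟩ : ∃ c : ℂ, φ (dx l) t = cst (τ l) * t + cst c := by
      refine ⟨σ l + σ two - τ l * σ two, ?_⟩
      rw [htdef, map_sub, hσ, apply_cst, cst_sub, cst_add, cst_mul, cst_neg]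
      ring
    have h1 : φ (dx l) (φ (dx two) t) = φ (dx two) (φ (dx l) t) := by
      rw [← AlgEquiv.mul_apply, ← AlgEquiv.mul_apply, ← map_mul, ← map_mul, dx_mul_dx, dx_mul_dx,
        mul_comm]
    rw [hD2, hc, map_mul, hc, map_add, map_mul, apply_cst, apply_cst, hD2,
      map_ofNat] at h1
    rw [hc, show cst c = 0 by linear_combination h1, add_zero]
  have τ_mul : ∀ l k : ℂˣ, τ (l * k) = τ l * τ k := by
    intro l k
    have h1 := hD (l * k)
    rw [← dx_mul_dx, map_mul, AlgEquiv.mul_apply, hD, map_mul, apply_cst, hD, ← mul_assoc]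
      at h1
    have h2 := mul_right_cancel₀ ht0 h1
    rw [← cst_mul, cst_inj, Units.val_mul] at h2
    rw [← h2, mul_comm]
  have τ_zero : τ 0 = 0 := by
    have := τ_add 0 0
    rw [add_zero] at this
    linear_combination -this
  let τ' : ℂ →+* ℂ :=
    { toFun := τ
      map_one' := τ_one
      map_zero' := τ_zero
      map_add' := τ_add
      map_mul' := fun a b => by
        by_cases ha : a = 0
        · rw [ha, zero_mul, τ_zero, zero_mul]
        by_cases hb : b = 0
        · rw [hb, mul_zero, τ_zero, mul_zero]
        exact τ_mul (Units.mk0 a ha) (Units.mk0 b hb) }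
  refine ⟨t, τ', ht, hF, hU, hD, ?_⟩
  obtain ⟨c, hc⟩ := fixD (φ ix t * t) (mul_mem (sI.1 t htF) htF) (by
    have h1 := DFunLike.congr_fun (congrArg φ (ix_mul_dx two⁻¹)) t
    have h2 : τ ((two⁻¹ : ℂˣ) : ℂ) * 2 = 1 := by
      rw [← τ_two]
      have := τ_mul two⁻¹ two
      rw [← Units.val_mul, inv_mul_cancel, Units.val_one, τ_one] at this
      exact this.symm
    rw [inv_inv, map_mul, map_mul, AlgEquiv.mul_apply, AlgEquiv.mul_apply, hD, map_mul,
      apply_cst] at h1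
    have h3 : cst (τ ((two⁻¹ : ℂˣ) : ℂ)) * 2 = 1 := by
      rw [← cst_two, ← cst_mul, h2, cst_one]
    rw [map_mul, hD2, ← h1]
    linear_combination (φ ix t * t) * h3)
  have hI : φ ix t = cst c / t := eq_div_of_mul_eq ht0 hc
  have hc0 : c ≠ 0 := by
    rintro rfl
    rw [cst_zero, zero_div, map_eq_zero_iff _ (φ ix).injective] at hI
    exact ht0 hI
  have h1 := DFunLike.congr_fun (congrArg φ (tx_ix_word 1)) t
  have hτn : τ (-1) = -1 := by
    have h2 := τ_add 1 (-1)
    rw [add_neg_cancel, τ_zero, τ_one] at h2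
    linear_combination -h2
  have hUn : φ (tx (-1)) t = t - 1 := by rw [hU, hτn, cst_neg, cst_one, sub_eq_add_neg]
  have hU1 : φ (tx 1) t = t + 1 := by rw [hU, τ_one, cst_one]
  have hne : ∀ a b : ℂ, a ≠ 0 → cst a * t + cst b ≠ 0 := by
    intro a b ha h0
    exact ha (K2.coeff_eq_zero_of_transcendental ht (a := 0) (b := a) (c := b)
      (by rw [cst_zero, zero_mul, zero_add, h0])).2.1
  have htm1 : t - 1 ≠ 0 := by
    have := hne 1 (-1) one_ne_zero
    rwa [cst_neg, cst_one, one_mul, ← sub_eq_add_neg] at this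
  have htm2 : cst c - t ≠ 0 := by
    have := hne (-1) c (by norm_num)
    rw [cst_neg, cst_one] at this
    convert this using 1
    ring
  have htm3 : cst c - (t + 1) ≠ 0 := by
    have := hne (-1) (c - 1) (by norm_num)
    rw [cst_neg, cst_sub, cst_one] at this
    convert this using 1
    ring
  have htp1 : t + 1 ≠ 0 := by
    have := hne 1 1 one_ne_zero
    rwa [cst_one, one_mul] at this
  simp only [map_mul, AlgEquiv.mul_apply, Units.val_one, inv_one, one_pow] at h1
  rw [hU1, map_add, map_one, hI, map_add, map_one, map_div₀, apply_cst, hUn, map_add,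
    map_one, map_div₀, apply_cst, map_sub, map_one, hI, map_add, map_one, map_div₀,
    apply_cst, map_sub, map_one, map_div₀, apply_cst, hU1, hD, map_mul,
    apply_cst, hI] at h1
  have hl : τ ((-1 : ℂˣ) : ℂ) = -1 := by
    rw [Units.val_neg, Units.val_one, hτn]
  have h2 : cst (c - 1) * t ^ 2 + cst (c - 1) * t + cst (c * (c - 1)) = 0 := by
    rw [hl, cst_neg, cst_one] at h1
    have h3 : cst c / (t + 1) - 1 ≠ 0 := by
      rw [div_sub_one htp1]
      exact div_ne_zero htm3 htp1
    rw [div_sub_one htp1, div_div_eq_mul_div] at h1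
    rw [div_add_one htm3, ← mul_div_assoc, div_eq_div_iff htm3 ht0] at h1
    simp only [cst_sub, cst_mul, cst_one]
    linear_combination h1
  have h3 := (K2.coeff_eq_zero_of_transcendental ht h2).1
  rw [hI, sub_eq_zero.1 h3, cst_one, one_div]

end Cremona2

end

namespace Cremona2

variable {φ : Cremona2 →* Cremona2}

theorem apply_apply_of_mul_eq {a b c d : Cremona2} (h : a * b = c * d) (z : K2) :
    φ a (φ b z) = φ c (φ d z) := by
  rw [← AlgEquiv.mul_apply, ← AlgEquiv.mul_apply, ← map_mul, ← map_mul, h]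

theorem dx_mul_m (l : ℂˣ) : dx l * m = m * dx l * dy l :=
  ext_gens (by simp) (by simp; ring)

theorem m_comm_dy (l : ℂˣ) : Commute m (dy l) :=
  ext_gens (by simp) (by simp; ring)

theorem iy_mul_dy (l : ℂˣ) : iy * dy l = dy l⁻¹ * iy :=
  ext_gens (by simp) (by simp [mul_comm])

theorem conj_m_comm_m : Commute (tx 1 * m * tx (-1)) m :=
  ext_gens (by simp) (by simp; ring)

theorem m_mul_e1 (a : ℂ) : m * e1 a = ty a * m := by
  simp [e1, ← mul_assoc]

end Cremona2

theorem K2.algebraicIndependent_pair {F : IntermediateField ℂ K2} {t s : K2}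
    (ht : Transcendental ℂ t) (htF : t ∈ F) (hs : Transcendental F s) :
    AlgebraicIndependent ℂ ![t, s] := by
  have h1 : AlgebraicIndependent ℂ (fun _ : Unit => t) :=
    algebraicIndependent_unique_type_iff.2 ht
  have hle : Algebra.adjoin ℂ (Set.range fun _ : Unit => t) ≤ F.toSubalgebra := by
    rw [Set.range_const, Algebra.adjoin_le_iff]
    rintro _ rfl
    exact htF
  have h2 : Transcendental (Algebra.adjoin ℂ (Set.range fun _ : Unit => t)) s := by
    rintro ⟨p, hp, h⟩
    refine hs ⟨p.map (Subalgebra.inclusion hle).toRingHom, ?_, ?_⟩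
    · exact (Polynomial.map_ne_zero_iff (Subalgebra.inclusion_injective hle)).2 hp
    · rw [← h, Polynomial.aeval_def, Polynomial.eval₂_map, Polynomial.aeval_def]
      rfl
  have h3 := ((h1.option_iff_transcendental s).2 h2).comp ![some (), none] (by
    intro i j hij
    fin_cases i <;> fin_cases j <;> simp_all)
  convert h3 using 1
  ext i
  fin_cases i <;> rfl

namespace Cremona2

variable {φ : Cremona2 →* Cremona2}

theorem exists_coordinate_fixed (h : φ (ty 1) ≠ 1) : ∃ (t : K2) (τ : ℂ →+* ℂ),
    Transcendental ℂ t ∧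
    (∀ a, φ (tx a) t = t + cst (τ a)) ∧ (∀ l : ℂˣ, φ (dx l) t = cst (τ l) * t) ∧
    φ ix t = t⁻¹ ∧ (∀ a, φ (ty a) t = t) ∧ (∀ l : ℂˣ, φ (dy l) t = t) ∧ φ iy t = t ∧
    ∃ t', invariants (Set.range fun l : ℂˣ => φ (dy l)) = IntermediateField.adjoin ℂ {t'} := by
  obtain ⟨t, τ, ht, hF, hU, hD, hI⟩ := exists_coordinate h
  let two : ℂˣ := Units.mk0 2 two_ne_zero
  have hU1 : φ (tx 1) t = t + 1 := by rw [hU, map_one, cst_one]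
  have hD2 : φ (dx two) t = 2 * t := by rw [hD, Units.val_mk0, map_ofNat, cst_two]
  have htF : t ∈ invariants (ratTrans φ) := hF ▸ IntermediateField.mem_adjoin_simple_self ℂ t
  have uniq : ∀ {F : IntermediateField ℂ K2} {t' : K2} (_ : F = IntermediateField.adjoin ℂ {t'})
      (_ : t ∈ F) {g : Cremona2} (_ : Commute (tx 1) g) (_ : Commute (dx two) g)
      (_ : φ g t ∈ F), φ g t = t := by
    intro F t' hF' htF' g h1 h2 hg
    refine eq_of_normalized hF' htF' hU1 hD2 hg ?_ ?_
    · rw [apply_apply_of_mul_eq h1.eq, hU1, map_add, map_one]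
    · rw [apply_apply_of_mul_eq h2.eq, hD2, map_mul, map_ofNat]
  have hTy : ∀ a, φ (ty a) t = t := by
    refine fun a => uniq hF htF (tx_comm_ty _ _) (dx_comm_ty _ _) ?_
    rintro _ ⟨q, rfl⟩
    change φ (ty q) (φ (ty a) t) = φ (ty a) t
    rw [apply_apply_of_mul_eq (c := ty a) (d := ty q) (by rw [ty_mul_ty, ty_mul_ty, add_comm])]
    rw [htF _ ⟨q, rfl⟩]
  have hDy : ∀ l, φ (dy l) t = t := by
    refine fun l => uniq hF htF (tx_comm_dy _ _) (dx_comm_dy _ _) ?_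
    rintro _ ⟨q, rfl⟩
    change φ (ty q) (φ (dy l) t) = φ (dy l) t
    rw [apply_apply_of_mul_eq (dy_mul_ty l q).symm, hTy]
  have htF' : t ∈ invariants (Set.range fun l : ℂˣ => φ (dy l)) := by
    rintro _ ⟨l, rfl⟩
    exact hDy l
  have ht0 : t ≠ 0 := fun h0 => ht (h0 ▸ isAlgebraic_zero)
  obtain ⟨t', -, hF'⟩ := exists_invariants_eq_adjoin
    (B := Set.range fun l : ℂˣ => φ (dy l)) (by
      have : Infinite ℂˣ := Infinite.of_injective
        (fun n : ℕ => Units.mk0 ((n : ℂ) + 1) (Nat.cast_add_one_ne_zero n)) fun a b hab => by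
          simpa using congrArg Units.val hab
      apply Set.infinite_range_of_injective
      intro l k hlk
      have hlk : φ (dy l) = φ (dy k) := hlk
      have h1 : φ (dx l) = φ (dx k) := by
        have h2 : ∀ l, φ (dx l) = φ w * φ (dy l) * φ w := by
          intro l
          rw [← map_mul, ← map_mul, w_mul_dy, mul_assoc, w_w, mul_one]
        rw [h2, h2, hlk]
      have h2 := DFunLike.congr_fun h1 t
      rw [hD, hD] at h2
      exact Units.ext (τ.injective (cst_inj.1 (mul_right_cancel₀ ht0 h2)))) (by
      intro hb
      rw [hb, IntermediateField.mem_bot] at htF'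
      obtain ⟨c, hc⟩ := htF'
      exact ht (hc ▸ isAlgebraic_algebraMap c))
  refine ⟨t, τ, ht, hU, hD, hI, hTy, hDy, ?_, t', hF'⟩
  refine uniq hF' htF' (tx_comm_iy _) (dx_comm_iy _) ?_
  rintro _ ⟨l, rfl⟩
  change φ (dy l) (φ iy t) = φ iy t
  rw [apply_apply_of_mul_eq (c := iy) (d := dy l⁻¹) (by rw [iy_mul_dy, inv_inv]), hDy]

/-- Every nontrivial endomorphism of the Cremona group acts on the generators, in a suitable pair
of algebraically independent functions, through a field endomorphism of `ℂ`. -/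
theorem exists_coordinates (h : φ (ty 1) ≠ 1) : ∃ (t s : K2) (τ : ℂ →+* ℂ),
    AlgebraicIndependent ℂ ![t, s] ∧
    (∀ a, φ (tx a) t = t + cst (τ a)) ∧ (∀ l : ℂˣ, φ (dx l) t = cst (τ l) * t) ∧
    φ ix t = t⁻¹ ∧ (∀ a, φ (tx a) s = s) ∧ (∀ l : ℂˣ, φ (dx l) s = s) ∧ φ ix s = s ∧
    φ w t = s ∧ φ w s = t ∧ φ m t = t ∧ φ m s = t * s := by
  obtain ⟨t, τ, ht, hU, hD, hI, hTy, hDy, hIy, t', hF'⟩ := exists_coordinate_fixed h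
  have ht0 : t ≠ 0 := fun h0 => ht (h0 ▸ isAlgebraic_zero)
  obtain ⟨s, hs⟩ : ∃ s, φ w t = s := ⟨_, rfl⟩
  have hws : φ w s = t := by
    rw [← hs, ← AlgEquiv.mul_apply, ← map_mul, w_w, map_one, AlgEquiv.one_apply]
  have hs0 : s ≠ 0 := by
    rw [← hs]
    exact (map_ne_zero_iff _ (φ w).injective).2 ht0
  have sU : ∀ a, φ (tx a) s = s := fun a => by
    rw [← hs, ← apply_apply_of_mul_eq (w_mul_ty a), hTy]
  have sD : ∀ l, φ (dx l) s = s := fun l => by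
    rw [← hs, ← apply_apply_of_mul_eq (w_mul_dy l), hDy]
  have sI : φ ix s = s := by
    rw [← hs, apply_apply_of_mul_eq (c := w) (d := iy), hIy]
    simp [iy, ← mul_assoc]
  have sTy : ∀ a, φ (ty a) s = s + cst (τ a) := fun a => by
    rw [← hs, ← apply_apply_of_mul_eq (w_mul_tx a), hU, map_add, apply_cst]
  have sDy : ∀ l, φ (dy l) s = cst (τ l) * s := fun l => by
    rw [← hs, ← apply_apply_of_mul_eq (w_mul_dx l), hD, map_mul, apply_cst]
  let two : ℂˣ := Units.mk0 2 two_ne_zero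
  have hU1 : φ (tx 1) t = t + 1 := by rw [hU, map_one, cst_one]
  have hUn : φ (tx (-1)) t = t - 1 := by
    rw [hU, map_neg, map_one, cst_neg, cst_one, sub_eq_add_neg]
  have hD2 : φ (dx two) t = 2 * t := by rw [hD, Units.val_mk0, map_ofNat, cst_two]
  have sDy2 : φ (dy two) s = 2 * s := by rw [sDy, Units.val_mk0, map_ofNat, cst_two]
  have htF' : t ∈ invariants (Set.range fun l : ℂˣ => φ (dy l)) := by
    rintro _ ⟨l, rfl⟩
    exact hDy l
  have hconst : ∀ z, (∀ l, φ (dy l) z = z) → φ (dx two) z = z → ∃ c : ℂ, z = cst c := by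
    intro z hz hfix
    obtain ⟨c, hc⟩ := IntermediateField.mem_bot.1 (mem_bot_of_dilation hF' htF' ht0 hD2
      (z := z) (by rintro _ ⟨l, rfl⟩; exact hz l) hfix)
    exact ⟨c, hc.symm⟩
  have hdm : ∀ z, φ (dx two) (φ m z) = φ m (φ (dx two) (φ (dy two) z)) := by
    intro z
    rw [apply_apply_of_mul_eq (c := m * dx two) (d := dy two) (dx_mul_m two), map_mul,
      AlgEquiv.mul_apply]
  have htwo : (2 : K2) ≠ 0 := two_ne_zero
  obtain ⟨α, hα⟩ : ∃ α : ℂ, φ m t = cst α * t := by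
    obtain ⟨α, hα⟩ := hconst (φ m t / t) (fun l => by
      rw [map_div₀, hDy, ← apply_apply_of_mul_eq (m_comm_dy l).eq, hDy]) (by
      rw [map_div₀, hdm, hDy, hD2, map_mul, map_ofNat, mul_div_mul_left _ _ htwo])
    exact ⟨α, by rw [← hα, div_mul_cancel₀ _ ht0]⟩
  have hτ0 : ∀ l : ℂˣ, cst (τ l) ≠ 0 := fun l => by
    rw [Ne, cst_eq_zero, map_eq_zero]
    exact l.ne_zero
  obtain ⟨β, hβ⟩ : ∃ β : ℂ, φ m s = cst β * t * s := by
    obtain ⟨β, hβ⟩ := hconst (φ m s / (t * s)) (fun l => by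
      rw [map_div₀, map_mul, hDy, ← apply_apply_of_mul_eq (m_comm_dy l).eq, sDy, map_mul,
        apply_cst, mul_left_comm, mul_div_mul_left _ _ (hτ0 l)]) (by
      rw [map_div₀, map_mul, hdm, hD2, sD, sDy2, map_mul, sD, map_mul, map_ofNat, map_ofNat,
        mul_assoc, mul_div_mul_left _ _ htwo])
    exact ⟨β, by rw [← hβ, mul_assoc, div_mul_cancel₀ _ (mul_ne_zero ht0 hs0)]⟩
  have hα0 : cst α ≠ 0 := by
    intro h0
    rw [h0, zero_mul, map_eq_zero_iff _ (φ m).injective] at hα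
    exact ht0 hα
  have hβα : β ^ 2 = α := by
    have h1 : ix * m * ix * m = 1 := by rw [ix_mul_m_mul_ix, inv_mul_cancel]
    have h2 := DFunLike.congr_fun (congrArg φ h1) s
    simp only [map_mul, AlgEquiv.mul_apply, map_one, AlgEquiv.one_apply, hβ, hα, hI, sI, apply_cst,
      map_inv₀] at h2
    rw [← cst_inj, cst_pow]
    field_simp at h2
    linear_combination h2
  have hα1 : α = 1 := by
    have h1 := apply_apply_of_mul_eq (φ := φ) (conj_m_comm_m).eq s
    simp only [map_mul, AlgEquiv.mul_apply, hβ, hα, hU1, hUn, sU, apply_cst, map_sub, map_one,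
      map_add] at h1
    have hβ0 : cst β ≠ 0 := by
      rw [Ne, cst_eq_zero]
      rintro rfl
      rw [← hβα, zero_pow two_ne_zero, cst_zero] at hα0
      exact hα0 rfl
    have h2 : cst 0 * t ^ 2 + cst (2 * α - 2) * t + cst (α - 1) = 0 := by
      simp only [cst_sub, cst_mul, cst_one, cst_two, cst_zero]
      have h3 : cst β * cst β * s ≠ 0 := mul_ne_zero (mul_ne_zero hβ0 hβ0) hs0
      apply mul_left_cancel₀ h3
      linear_combination h1
    exact sub_eq_zero.1 (K2.coeff_eq_zero_of_transcendental ht h2).2.2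
  subst hα1
  rw [cst_one, one_mul] at hα
  have hββ : cst β * cst β = 1 := by rw [← cst_mul, ← sq, hβα, cst_one]
  have Et : ∀ a, φ (e1 a) t = t := fun a => by
    apply (φ m).injective
    rw [apply_apply_of_mul_eq (m_mul_e1 a), hα, hTy]
  have Es : ∀ a, φ (e1 a) s = s + cst β * cst (τ a) * t := fun a => by
    apply (φ m).injective
    rw [apply_apply_of_mul_eq (m_mul_e1 a), map_add, map_mul, map_mul, hβ, map_mul, map_mul, hα,
      sTy, hTy]
    simp only [apply_cst]
    ring
  have hβ1 : cst β = 1 := by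
    have h1 := DFunLike.congr_fun (congrArg φ e1_word) s
    simp only [map_mul, AlgEquiv.mul_apply, Es, Et, hs, hws, sD, map_add, apply_cst, map_neg,
      map_one] at h1
    apply mul_right_cancel₀ ht0
    linear_combination h1 + (s + cst β * t) * hββ
  rw [hβ1, one_mul] at hβ
  refine ⟨t, s, τ, ?_, hU, hD, hI, sU, sD, sI, hs, hws, hα, hβ⟩
  refine K2.algebraicIndependent_pair (F := invariants (Set.range fun a => φ (ty a))) ht
    (by rintro _ ⟨a, rfl⟩; exact hTy a) fun halg => ?_
  refine Set.infinite_range_of_injective (f := fun a : ℂ => φ (ty a) s) (fun a b hab => ?_)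
    ((finite_apply_of_isAlgebraic halg).subset ?_)
  · have hab : φ (ty a) s = φ (ty b) s := hab
    rw [sTy, sTy, add_right_inj, cst_inj] at hab
    exact τ.injective hab
  · rintro _ ⟨a, rfl⟩
    exact ⟨_, ⟨a, rfl⟩, rfl⟩

end Cremona2

theorem K2.exists_ringHom {t s : K2} (hts : AlgebraicIndependent ℂ ![t, s]) (τ : ℂ →+* ℂ) :
    ∃ θ : K2 →+* K2, (∀ c, θ (cst c) = cst (τ c)) ∧ θ X0 = t ∧ θ X1 = s := by
  obtain ⟨g, hg, hgC, hg0, hg1⟩ : ∃ g : MvPolynomial (Fin 2) ℂ →+* K2, Function.Injective g ∧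
      (∀ c, g (MvPolynomial.C c) = cst (τ c)) ∧ g (MvPolynomial.X 0) = t ∧
      g (MvPolynomial.X 1) = s := by
    refine ⟨(MvPolynomial.aeval ![t, s]).toRingHom.comp (MvPolynomial.map τ), ?_, ?_, ?_, ?_⟩
    · intro p q hpq
      exact MvPolynomial.map_injective τ τ.injective (hts hpq)
    · intro c
      simp
    · simp
    · simp
  refine ⟨IsFractionRing.lift hg, fun c => ?_, ?_, ?_⟩
  · have : cst c = algebraMap (MvPolynomial (Fin 2) ℂ) K2 (MvPolynomial.C c) := by
      rw [cst, IsScalarTower.algebraMap_apply ℂ (MvPolynomial (Fin 2) ℂ) K2]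
      rfl
    rw [this, IsFractionRing.lift_algebraMap, hgC]
  · rw [X0, IsFractionRing.lift_algebraMap, hg0]
  · rw [X1, IsFractionRing.lift_algebraMap, hg1]

namespace Cremona2

theorem map_injective_of_map_ty_one_ne_one {φ : Cremona2 →* Cremona2} (h : φ (ty 1) ≠ 1) :
    Function.Injective φ := by
  obtain ⟨t, s, τ, hts, hU, hD, hI, sU, sD, sI, wt, ws, mt, ms⟩ := exists_coordinates h
  obtain ⟨θ, hC, h0, h1⟩ := K2.exists_ringHom hts τ
  let S : Subgroup Cremona2 :=
    { carrier := {f | ∀ z, φ f (θ z) = θ (f z)}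
      mul_mem' := fun {f g} hf hg z => by
        rw [map_mul, AlgEquiv.mul_apply, AlgEquiv.mul_apply, hg, hf]
      one_mem' := fun z => by rw [map_one, AlgEquiv.one_apply, AlgEquiv.one_apply]
      inv_mem' := fun {f} hf z => by
        apply (φ f).injective
        rw [hf, ← AlgEquiv.mul_apply, ← AlgEquiv.mul_apply, ← map_mul, mul_inv_cancel, map_one,
          AlgEquiv.one_apply, AlgEquiv.one_apply] }
  have mem_S : ∀ f : Cremona2, φ f t = θ (f X0) → φ f s = θ (f X1) → f ∈ S := by
    intro f hf0 hf1 z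
    refine DFunLike.congr_fun (f := ((φ f : K2 ≃+* K2) : K2 →+* K2).comp θ)
      (g := θ.comp ((f : K2 ≃+* K2) : K2 →+* K2)) (K2.ringHom_ext (fun c => ?_) ?_ ?_) z
    · change φ f (θ (cst c)) = θ (f (cst c))
      rw [apply_cst, hC, apply_cst]
    · change φ f (θ X0) = θ (f X0)
      rw [h0, hf0]
    · change φ f (θ X1) = θ (f X1)
      rw [h1, hf1]
  have hS : H ≤ S := by
    rw [H, Subgroup.closure_le]
    rintro _ ((⟨a, rfl⟩ | ⟨l, rfl⟩) | rfl | rfl | rfl)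
    · exact mem_S _ (by rw [hU, tx_X0, map_add, h0, hC]) (by rw [sU, tx_X1, h1])
    · exact mem_S _ (by rw [hD, dx_X0, map_mul, h0, hC]) (by rw [sD, dx_X1, h1])
    · exact mem_S _ (by rw [hI, ix_X0, map_inv₀, h0]) (by rw [sI, ix_X1, h1])
    · exact mem_S _ (by rw [wt, w_X0, h1]) (by rw [ws, w_X1, h0])
    · exact mem_S _ (by rw [mt, m_X0, h0]) (by rw [ms, m_X1, map_mul, h0, h1])
  rw [injective_iff_map_eq_one]
  intro f hf
  ext z
  have hz := hS (mem_H f) z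
  rw [hf, AlgEquiv.one_apply] at hz
  exact (θ.injective hz).symm

end Cremona2

/-- The plane Cremona group is hopfian: every surjective group endomorphism of
`Bir(ℙ²_ℂ) = Aut_ℂ(ℂ(x,y))` is injective, hence an automorphism. -/
theorem cremona_hopfian (φ : Cremona2 →* Cremona2) (hsurj : Function.Surjective φ) :
    Function.Bijective φ :=
  ⟨Cremona2.map_injective_of_map_ty_one_ne_one (Cremona2.map_ty_one_ne_one hsurj), hsurj⟩
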